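/- Let A be a finitary hereditary abelian category over a finite field and t an odd positive integer. For t-periodic complexes A_1^• = (A_1^i, 0)_{i∈Z_t} and A_2^• = (A_2^i, 0)_{i∈Z_t} with zero differentials, in the derived Hall algebra DH_t(A) of D_t(A): [A_1^•][A_2^•] = ∑_{[X^•], X^• = (X^i,0)_{i∈Z_t} ∈ Iso(D_t(A))} ∑_{M^j, N^j, S^j ∈ Iso(A)} ( ∏_{i∈Z_t} ( g^{A_1^i}_{S^{i+1} M^i} · g^{X^i}_{M^i N^i} · g^{A_2^i}_{N^i S^i} · a_{M^i} a_{N^i} a_{S^i} ) / ( a_{X^i} · ⟨A_1^i, S^i⟩ · ⟨S^{i+1}, N^i⟩ ) · sqrt( ⟨A_1^i, A_2^i⟩ · ∏_{k=1}^{t-1} ⟨A_1^{i+k}, A_2^i⟩^{(-1)^{k+1}} ) ) · ( a'_{X^•} / ( a'_{A_1^•} a'_{A_2^•} ) ) [X^•], where a'_{Y^•} := a_{Y^•} · {Y^•, Y^•}^{1/2} and {X,Y} := ∏_{i=1}^{t} |Hom_{D_t(A)}(X[i], Y)|^{(-1)^i}. -/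

import Mathlib

/-!
STATEMENT 18.
For a finitary hereditary abelian category `A` over a finite field and an odd positive
integer `t`, the product of classes of `t`-periodic complexes with zero differentials in
the derived Hall algebra `DH_t(A)` is given by the explicit formula of Proposition 5.8.
`D_t(A)` is encoded as any triangulated localization `L : C_t(A) ⥤ E` at the
quasi-isomorphisms, with shift compatible with the degree shift of periodic complexes.
-/

open CategoryTheory CategoryTheory.Limits CategoryTheory.Pretriangulated

noncomputable section

namespace GreenDH

def IsoCl (C : Type*) [Category C] : Type _ := Quotient (CategoryTheory.isIsomorphicSetoid C)

def cl {C : Type*} [Category C] (X : C) : IsoCl C := Quotient.mk _ X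

def IsoCl.out {C : Type*} [Category C] (s : IsoCl C) : C := Quotient.out s

def autCard {C : Type*} [Category C] (X : C) : ℕ := Nat.card (Aut X)

def homCard {C : Type*} [Category C] (X Y : C) : ℕ := Nat.card (X ⟶ Y)

def ext1Card {A : Type} [SmallCategory A] [Abelian A] [HasExt.{0} A] (X Y : A) : ℕ :=
  Nat.card (Abelian.Ext X Y 1)

/-- The multiplicative Euler form `⟨X, Y⟩ = |Hom(X,Y)| / |Ext¹(X,Y)|`. -/
def eulerR {A : Type} [SmallCategory A] [Abelian A] [HasExt.{0} A] (X Y : A) : ℝ :=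
  (homCard X Y : ℝ) / (ext1Card X Y : ℝ)

def hall {A : Type} [SmallCategory A] [Abelian A] (a b c : A) : ℕ :=
  Nat.card {S : Subobject c // Nonempty ((S : A) ≅ b) ∧ Nonempty ((cokernel S.arrow) ≅ a)}

def pShape (t : ℕ) : ComplexShape (ZMod t) := ComplexShape.up' (1 : ZMod t)

abbrev Ct (A : Type) [SmallCategory A] [Abelian A] (t : ℕ) :=
  HomologicalComplex A (pShape t)

def mkZero {A : Type} [SmallCategory A] [Abelian A] {t : ℕ} (f : ZMod t → A) : Ct A t where
  X := f
  d _ _ := 0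
  shape _ _ _ := rfl
  d_comp_d' := by intros; simp

variable {A : Type} [SmallCategory A] [Abelian A]
variable {E : Type*} [Category E] [Preadditive E] [HasZeroObject E] [HasShift E ℤ]
  [∀ n : ℤ, (shiftFunctor E n).Additive] [Pretriangulated E]

/-- `|Hom(Y, L)_X|`: morphisms `Y ⟶ L` with cone isomorphic to `X`. -/
def coneHomCard (Y L X : E) : ℕ :=
  Nat.card {l : Y ⟶ L // ∃ (g : L ⟶ X) (h : X ⟶ Y⟦(1 : ℤ)⟧),
    Triangle.mk l g h ∈ distinguishedTriangles (C := E)}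

/-- The derived Hall number `F^L_{XY}` of a `t`-periodic triangulated category (odd `t`). -/
def Fodd (t : ℕ) (X Y L : E) : ℝ :=
  (coneHomCard Y L X : ℝ) / (autCard Y : ℝ) *
    Real.sqrt (∏ i ∈ Finset.Icc 1 t,
      ((Nat.card (Y⟦(i : ℤ)⟧ ⟶ L) : ℝ) / (Nat.card (Y⟦(i : ℤ)⟧ ⟶ Y) : ℝ)) ^ ((-1 : ℤ) ^ i))

/-- The multiplication of `DH_t(A)`, extended bilinearly from the basis. -/
def dhMulOdd (t : ℕ) (u v : IsoCl E → ℝ) : IsoCl E → ℝ :=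
  fun L => ∑ᶠ X : IsoCl E, ∑ᶠ Y : IsoCl E, u X * v Y * Fodd t X.out Y.out L.out

def delta {C : Type*} [Category C] (s : IsoCl C) : IsoCl C → ℝ :=
  open scoped Classical in fun x => if x = s then 1 else 0

/-- `a'_{Y^•} = a_{Y^•} · {Y^•, Y^•}^{1/2}` where
`{X, Y} = ∏_{i=1}^{t} |Hom_{D_t(A)}(X[i], Y)|^{(-1)^i}`, for the `t`-periodic complex
with zero differentials and components `f`. -/
def aprime [HasExt.{0} A] {t : ℕ} (L : Ct A t ⥤ E) (f : ZMod t → A) : ℝ :=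
  (autCard (L.obj (mkZero f)) : ℝ) *
    Real.sqrt (∏ i ∈ Finset.Icc 1 t,
      (Nat.card ((L.obj (mkZero f))⟦(i : ℤ)⟧ ⟶ L.obj (mkZero f)) : ℝ) ^ ((-1 : ℤ) ^ i))

/-! ### Extensions -/

/-- An extension of `a` by `b`. -/
structure Ex (a b : A) where
  P : A
  j : b ⟶ P
  π : P ⟶ a
  w : j ≫ π = 0
  se : (ShortComplex.mk j π w).ShortExact

attribute [simp] Ex.w

@[simp] lemma Ex.w_assoc {a b c : A} (X : Ex a b) (f : a ⟶ c) : X.j ≫ X.π ≫ f = 0 := by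
  rw [← Category.assoc, X.w, zero_comp]

instance {a b : A} (X : Ex a b) : Mono X.j := X.se.mono_f
instance {a b : A} (X : Ex a b) : Epi X.π := X.se.epi_g

lemma Ex.lift' {a b c : A} (X : Ex a b) (v : c ⟶ X.P) (h : v ≫ X.π = 0) :
    ∃ s : c ⟶ b, s ≫ X.j = v :=
  ⟨X.se.exact.lift v h, X.se.exact.lift_f v h⟩

lemma Ex.desc' {a b c : A} (X : Ex a b) (v : X.P ⟶ c) (h : X.j ≫ v = 0) :
    ∃ s : a ⟶ c, X.π ≫ s = v :=
  ⟨X.se.exact.desc v h, X.se.exact.g_desc v h⟩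

def Ex.cls [HasExt.{0} A] {a b : A} (X : Ex a b) : Abelian.Ext a b 1 := X.se.extClass

lemma exists_ex [HasExt.{0} A] {a b : A} (e : Abelian.Ext a b 1) : ∃ X : Ex a b, X.cls = e := by
  let _i := HasDerivedCategory.standard A
  let F := DerivedCategory.singleFunctor A 0
  obtain ⟨Y, f, g, hT⟩ := distinguished_cocone_triangle₂ (e.hom : _ ⟶ _)
  have hle : Y.IsLE 0 := by
    rw [DerivedCategory.isLE_iff]
    intro i hi
    have := DerivedCategory.HomologySequence.exact₂ _ hT i
    exact this.isZero_of_both_zeros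
      ((DerivedCategory.isZero_of_isLE (F.obj b) 0 i hi).eq_of_src _ _)
      ((DerivedCategory.isZero_of_isLE (F.obj a) 0 i hi).eq_of_tgt _ _)
  have hge : Y.IsGE 0 := by
    rw [DerivedCategory.isGE_iff]
    intro i hi
    have := DerivedCategory.HomologySequence.exact₂ _ hT i
    exact this.isZero_of_both_zeros
      ((DerivedCategory.isZero_of_isGE (F.obj b) 0 i hi).eq_of_src _ _)
      ((DerivedCategory.isZero_of_isGE (F.obj a) 0 i hi).eq_of_tgt _ _)
  obtain ⟨P, ⟨u⟩⟩ := DerivedCategory.exists_iso_singleFunctor_obj_of_isGE_of_isLE Y 0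
  obtain ⟨j, hj⟩ := (DerivedCategory.singleFunctor A 0).map_surjective (f ≫ u.hom)
  obtain ⟨p, hp⟩ := (DerivedCategory.singleFunctor A 0).map_surjective (u.inv ≫ g)
  have hT' : Triangle.mk ((DerivedCategory.singleFunctor A 0).map j)
      ((DerivedCategory.singleFunctor A 0).map p) e.hom ∈ distTriang (DerivedCategory A) := by
    refine isomorphic_distinguished _ hT _ (Triangle.isoMk _ _ (Iso.refl _) u.symm (Iso.refl _)
      ?_ ?_ ?_)
    · change F.map j ≫ u.inv = 𝟙 _ ≫ f
      rw [Category.id_comp, hj, Category.assoc, u.hom_inv_id, Category.comp_id]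
    · change F.map p ≫ 𝟙 _ = u.inv ≫ g
      rw [Category.comp_id, hp]
    · change e.hom ≫ (shiftFunctor _ (1 : ℤ)).map (𝟙 _) = 𝟙 _ ≫ e.hom
      rw [CategoryTheory.Functor.map_id, Category.id_comp]
      exact Category.comp_id _
  have w : j ≫ p = 0 := by
    apply (DerivedCategory.singleFunctor A 0).map_injective
    rw [Functor.map_comp, Functor.map_zero]
    exact comp_distTriang_mor_zero₁₂ _ hT'
  let η := DerivedCategory.singleFunctorCompHomologyFunctorIso A 0
  have hse : (ShortComplex.mk j p w).ShortExact := by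
    have hex := DerivedCategory.HomologySequence.exact₂ _ hT' 0
    have hm : Mono ((DerivedCategory.homologyFunctor A 0).map
        ((DerivedCategory.singleFunctor A 0).map j)) := by
      refine (DerivedCategory.HomologySequence.mono_homologyMap_mor₁_iff _ hT' (-1) 0 (by lia)).2 ?_
      exact (DerivedCategory.isZero_of_isGE (F.obj a) 0 (-1) (by lia)).eq_of_src _ _
    have he : Epi ((DerivedCategory.homologyFunctor A 0).map
        ((DerivedCategory.singleFunctor A 0).map p)) := by
      refine (DerivedCategory.HomologySequence.epi_homologyMap_mor₂_iff _ hT' 0 1 (by lia)).2 ?_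
      exact (DerivedCategory.isZero_of_isLE (F.obj b) 0 1 (by lia)).eq_of_tgt _ _
    have h0 : (ShortComplex.mk ((DerivedCategory.homologyFunctor A 0).map
        ((DerivedCategory.singleFunctor A 0).map j)) ((DerivedCategory.homologyFunctor A 0).map
        ((DerivedCategory.singleFunctor A 0).map p)) (by
          rw [← Functor.map_comp, ← Functor.map_comp, w]; simp)).ShortExact :=
      { exact := hex, mono_f := hm, epi_g := he }
    refine ShortComplex.shortExact_of_iso (ShortComplex.isoMk (η.app _) (η.app _) (η.app _) ?_ ?_) h0
    · exact (η.hom.naturality j).symm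
    · exact (η.hom.naturality p).symm
  refine ⟨⟨P, j, p, w, hse⟩, ?_⟩
  apply Abelian.Ext.ext
  change hse.extClass.hom = _
  rw [ShortComplex.ShortExact.extClass_hom]
  obtain ⟨c, hc1, hc2⟩ := complete_distinguished_triangle_morphism _ _ hT'
    hse.singleTriangle_distinguished (𝟙 (F.obj b)) (𝟙 (F.obj P))
    ((Category.comp_id _).trans (Category.id_comp _).symm)
  obtain ⟨c, rfl⟩ := (DerivedCategory.singleFunctor A 0).map_surjective c
  have : c = 𝟙 _ := by
    have : p ≫ c = p ≫ 𝟙 _ := by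
      apply (DerivedCategory.singleFunctor A 0).map_injective
      rw [Functor.map_comp, Category.comp_id]
      exact hc1.trans (Category.id_comp _)
    have hep : Epi p := hse.epi_g
    exact (cancel_epi p).1 this
  subst this
  change e.hom ≫ (shiftFunctor _ (1 : ℤ)).map (𝟙 _) = F.map (𝟙 a) ≫ hse.singleδ at hc2
  rw [CategoryTheory.Functor.map_id, CategoryTheory.Functor.map_id, Category.id_comp] at hc2
  exact hc2.symm.trans (Category.comp_id _)

section
variable [HasExt.{0} A]
open Abelian

/-- pullback of an Ext¹ class -/
def pull {a' a b : A} (f : a' ⟶ a) (e : Ext a b 1) : Ext a' b 1 :=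
  (Ext.mk₀ f).comp e (zero_add 1)

/-- push forward of an Ext¹ class -/
def push {a b b' : A} (e : Ext a b 1) (f : b ⟶ b') : Ext a b' 1 :=
  e.comp (Ext.mk₀ f) (add_zero 1)

@[simp] lemma pull_id {a b : A} (e : Ext a b 1) : pull (𝟙 a) e = e := by simp [pull]
@[simp] lemma push_id {a b : A} (e : Ext a b 1) : push e (𝟙 b) = e := by simp [push]
@[simp] lemma pull_comp {a'' a' a b : A} (f : a'' ⟶ a') (g : a' ⟶ a) (e : Ext a b 1) :
    pull (f ≫ g) e = pull f (pull g e) := by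
  simp only [pull]
  rw [← Ext.mk₀_comp_mk₀, Ext.comp_assoc_of_second_deg_zero]
@[simp] lemma push_comp {a b b' b'' : A} (f : b ⟶ b') (g : b' ⟶ b'') (e : Ext a b 1) :
    push e (f ≫ g) = push (push e f) g := by
  simp only [push]
  rw [← Ext.mk₀_comp_mk₀, Ext.comp_assoc_of_second_deg_zero]
lemma pull_push {a' a b b' : A} (f : a' ⟶ a) (g : b ⟶ b') (e : Ext a b 1) :
    push (pull f e) g = pull f (push e g) := by
  simp only [pull, push]
  rw [Ext.comp_assoc_of_third_deg_zero]
@[simp] lemma pull_add {a' a b : A} (f : a' ⟶ a) (e e' : Ext a b 1) :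
    pull f (e + e') = pull f e + pull f e' := by simp [pull]
@[simp] lemma push_add {a b b' : A} (f : b ⟶ b') (e e' : Ext a b 1) :
    push (e + e') f = push e f + push e' f := by simp [push]
lemma add_pull {a' a b : A} (f g : a' ⟶ a) (e : Ext a b 1) :
    pull (f + g) e = pull f e + pull g e := by simp [pull, Ext.mk₀_add]
lemma push_add' {a b b' : A} (f g : b ⟶ b') (e : Ext a b 1) :
    push e (f + g) = push e f + push e g := by simp [push, Ext.mk₀_add]
@[simp] lemma pull_zero {a' a b : A} (f : a' ⟶ a) : pull f (0 : Ext a b 1) = 0 := by simp [pull]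
@[simp] lemma push_zero {a b b' : A} (f : b ⟶ b') : push (0 : Ext a b 1) f = 0 := by simp [push]
@[simp] lemma zero_pull {a' a b : A} (e : Ext a b 1) : pull (0 : a' ⟶ a) e = 0 := by simp [pull]
@[simp] lemma push_zero' {a b b' : A} (e : Ext a b 1) : push e (0 : b ⟶ b') = 0 := by simp [push]

lemma Ex.pull_π {a b : A} (X : Ex a b) : pull X.π X.cls = 0 := X.se.comp_extClass
lemma Ex.push_j {a b : A} (X : Ex a b) : push X.cls X.j = 0 := X.se.extClass_comp

/-- `v^*[X] = 0` iff `v` lifts. -/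
lemma Ex.exists_lift {a b c : A} (X : Ex a b) (v : c ⟶ a) (h : pull v X.cls = 0) :
    ∃ s : c ⟶ X.P, s ≫ X.π = v := by
  obtain ⟨s, hs⟩ := Ext.covariant_sequence_exact₃ _ X.se (Ext.mk₀ v) (zero_add 1) h
  obtain ⟨s, rfl⟩ := (Ext.mk₀_bijective _ _).2 s
  exact ⟨s, (Ext.mk₀_bijective _ _).1 (by simpa [Ext.mk₀_comp_mk₀] using hs)⟩

lemma Ex.exists_ext {a b c : A} (X : Ex a b) (v : b ⟶ c) (h : push X.cls v = 0) :
    ∃ s : X.P ⟶ c, X.j ≫ s = v := by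
  obtain ⟨s, hs⟩ := Ext.contravariant_sequence_exact₁ X.se _ (Ext.mk₀ v) (add_zero 1) h
  obtain ⟨s, rfl⟩ := (Ext.mk₀_bijective _ _).2 s
  exact ⟨s, (Ext.mk₀_bijective _ _).1 (by simpa [Ext.mk₀_comp_mk₀] using hs)⟩

lemma Ex.naturality {a b a' b' : A} (X : Ex a b) (Y : Ex a' b') (k : b ⟶ b') (l : X.P ⟶ Y.P)
    (v : a ⟶ a') (h₁ : X.j ≫ l = k ≫ Y.j) (h₂ : l ≫ Y.π = X.π ≫ v) :
    push X.cls k = pull v Y.cls :=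
  ShortComplex.ShortExact.extClass_naturality X.se Y.se
    { τ₁ := k, τ₂ := l, τ₃ := v, comm₁₂ := h₁.symm, comm₂₃ := h₂ }

/-- Morphisms of extensions exist as soon as the classes match. -/
lemma Ex.exists_map {a b a' b' : A} (X : Ex a b) (Y : Ex a' b') (k : b ⟶ b')
    (v : a ⟶ a') (h : push X.cls k = pull v Y.cls) :
    ∃ l : X.P ⟶ Y.P, X.j ≫ l = k ≫ Y.j ∧ l ≫ Y.π = X.π ≫ v := by
  obtain ⟨l₀, hl₀⟩ := X.exists_ext (k ≫ Y.j) (by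
    rw [push_comp, h, pull_push, Y.push_j, pull_zero])
  obtain ⟨w, hw⟩ := X.desc' (X.π ≫ v - l₀ ≫ Y.π) (by
    rw [Preadditive.comp_sub, reassoc_of% hl₀]; simp)
  have h' := X.naturality Y k l₀ (v - w) hl₀ (by rw [Preadditive.comp_sub, hw]; abel)
  have h2 : pull w Y.cls = 0 := by
    have := add_pull w (v - w) Y.cls
    rw [add_sub_cancel, ← h, h'] at this
    simpa using this
  obtain ⟨s, hs⟩ := Y.exists_lift w h2
  refine ⟨l₀ + X.π ≫ s, ?_, ?_⟩
  · simp [hl₀]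
  · rw [Preadditive.add_comp, Category.assoc, hs, hw]; abel

section
variable (hered : ∀ X Y : A, Subsingleton (Abelian.Ext X Y 2))
include hered

lemma pull_surj {a' a b : A} (i : a' ⟶ a) [Mono i] (e : Ext a' b 1) : ∃ e', pull i e' = e := by
  have hS : (ShortComplex.mk i (cokernel.π i) (cokernel.condition i)).ShortExact :=
    { exact := ShortComplex.exact_cokernel i, mono_f := ‹_›, epi_g := by dsimp; infer_instance }
  exact Ext.contravariant_sequence_exact₁ hS b e (n₁ := 2) rfl (Subsingleton.elim _ _)

lemma push_surj {a b b' : A} (p : b ⟶ b') [Epi p] (e : Ext a b' 1) : ∃ e', push e' p = e := by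
  have hS : (ShortComplex.mk (kernel.ι p) p (kernel.condition p)).ShortExact :=
    { exact := ShortComplex.exact_kernel p, mono_f := by dsimp; infer_instance, epi_g := ‹_› }
  exact Ext.covariant_sequence_exact₃ _ hS e (n₁ := 2) rfl (Subsingleton.elim _ _)

/-- Left exact sequences `0 → h → c → v` extend to short exact sequences. -/
lemma exists_ex_of_left_exact {h c v : A} (i : h ⟶ c) (p : c ⟶ v) [Mono i] (w : i ≫ p = 0)
    (hex : (ShortComplex.mk i p w).Exact) :
    ∃ (X : Ex v h) (u : c ⟶ X.P), i ≫ u = X.j ∧ u ≫ X.π = p := by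
  let B : Ex (Limits.image p) h :=
    { P := c
      j := i
      π := Limits.factorThruImage p
      w := by rw [← cancel_mono (Limits.image.ι p)]; simp [w]
      se :=
        { exact := by
            rw [ShortComplex.exact_iff_exact_up_to_refinements] at hex ⊢
            intro T x hx
            exact hex x (by
              have hx' : x ≫ factorThruImage p = 0 := hx
              have : (show T ⟶ c from x) ≫ factorThruImage p ≫ Limits.image.ι p = (show T ⟶ c from x) ≫ p :=
                congrArg (fun u => (show T ⟶ c from x) ≫ u) (Limits.image.fac p)
              rw [reassoc_of% hx', zero_comp] at this
              exact this.symm)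
          mono_f := ‹_›
          epi_g := by dsimp; infer_instance } }
  obtain ⟨e, he⟩ := pull_surj hered (Limits.image.ι p) B.cls
  obtain ⟨X, rfl⟩ := exists_ex e
  obtain ⟨l, h1, h2⟩ := B.exists_map X (𝟙 _) (Limits.image.ι p) (by simp [he])
  exact ⟨X, l, by simpa using h1, by simpa [B] using h2⟩

end
end

/-! ### Calculus of fractions -/
section Frac
variable {t : ℕ}

instance : DecidableRel (pShape t).Rel := fun _ _ => Classical.propDecidable _

lemma pRel {i j : ZMod t} (h : i + 1 = j) : (pShape t).Rel i j := h

lemma pRel' (i : ZMod t) : (pShape t).Rel i (i + 1) := rfl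

lemma pNext {i j : ZMod t} (h : i + 1 = j) : (pShape t).next i = j :=
  (pShape t).next_eq' (pRel h)

lemma pPrev {i j : ZMod t} (h : i + 1 = j) : (pShape t).prev j = i :=
  (pShape t).prev_eq' (pRel h)

lemma pEx (j : ZMod t) : ∃ i, (pShape t).Rel i j := ⟨j - 1, pRel (by ring)⟩

abbrev Qis (A : Type) [SmallCategory A] [Abelian A] (t : ℕ) := HomologicalComplex.quasiIso A (pShape t)

def MonoAt {K L : Ct A t} (φ : K ⟶ L) (i j k : ZMod t) : Prop :=
  ∀ ⦃T : A⦄ (x₂ : T ⟶ K.X j) (_ : x₂ ≫ K.d j k = 0) (y₁ : T ⟶ L.X i)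
    (_ : x₂ ≫ φ.f j = y₁ ≫ L.d i j),
    ∃ (T' : A) (π : T' ⟶ T) (_ : Epi π) (x₁ : T' ⟶ K.X i), π ≫ x₂ = x₁ ≫ K.d i j

def EpiAt {K L : Ct A t} (φ : K ⟶ L) (i j k : ZMod t) : Prop :=
  ∀ ⦃T : A⦄ (y₂ : T ⟶ L.X j) (_ : y₂ ≫ L.d j k = 0),
    ∃ (T' : A) (π : T' ⟶ T) (_ : Epi π) (x₂ : T' ⟶ K.X j) (_ : x₂ ≫ K.d j k = 0)
      (y₁ : T' ⟶ L.X i), π ≫ y₂ = x₂ ≫ φ.f j + y₁ ≫ L.d i j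

lemma qis_iff {K L : Ct A t} (φ : K ⟶ L) : Qis A t φ ↔
    ∀ i j k : ZMod t, (pShape t).Rel i j → (pShape t).Rel j k → MonoAt φ i j k ∧ EpiAt φ i j k := by
  change HomologicalComplex.quasiIso A (pShape t) φ ↔ _
  rw [HomologicalComplex.mem_quasiIso_iff, quasiIso_iff]
  constructor
  · intro h i j k hi hk
    have := h j
    rw [quasiIsoAt_iff_isIso_homologyMap] at this
    exact ⟨(HomologicalComplex.mono_homologyMap_iff_up_to_refinements φ i j k (pPrev hi)
      (pNext hk)).1 inferInstance,
      (HomologicalComplex.epi_homologyMap_iff_up_to_refinements φ i j k (pPrev hi)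
      (pNext hk)).1 inferInstance⟩
  · intro h j
    obtain ⟨h1, h2⟩ := h (j - 1) j (j + 1) (pRel (by ring)) rfl
    rw [quasiIsoAt_iff_isIso_homologyMap]
    have := (HomologicalComplex.mono_homologyMap_iff_up_to_refinements φ (j-1) j (j+1)
      (pPrev (by ring)) (pNext rfl)).2 h1
    have := (HomologicalComplex.epi_homologyMap_iff_up_to_refinements φ (j-1) j (j+1)
      (pPrev (by ring)) (pNext rfl)).2 h2
    exact isIso_of_mono_of_epi _

/-- Acyclicity. -/
def Acyc (K : Ct A t) : Prop := ∀ i j k : ZMod t, (pShape t).Rel i j → (pShape t).Rel j k →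
  ∀ ⦃T : A⦄ (x : T ⟶ K.X j) (_ : x ≫ K.d j k = 0),
      ∃ (T' : A) (π : T' ⟶ T) (_ : Epi π) (x₁ : T' ⟶ K.X i), π ≫ x = x₁ ≫ K.d i j

open HomologicalComplex

/-- cocycles in a homotopy cofiber, componentwise -/
lemma cof_lift {F G : Ct A t} (φ : F ⟶ G) {T : A} {j k : ZMod t} (h : (pShape t).Rel j k)
    (a : T ⟶ F.X k) (b : T ⟶ G.X j) : ∃ w : T ⟶ (homotopyCofiber φ).X j,
      w ≫ homotopyCofiber.fstX φ j k h = a ∧ w ≫ homotopyCofiber.sndX φ j = b :=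
  ⟨a ≫ homotopyCofiber.inlX φ k j h + b ≫ homotopyCofiber.inrX φ j, by simp, by simp⟩

lemma cof_d {F G : Ct A t} (φ : F ⟶ G) {T : A} {j k l : ZMod t} (h : (pShape t).Rel j k) (h' : (pShape t).Rel k l)
    (w : T ⟶ (homotopyCofiber φ).X j) (a : T ⟶ F.X k) (b : T ⟶ G.X j)
    (ha : w ≫ homotopyCofiber.fstX φ j k h = a) (hb : w ≫ homotopyCofiber.sndX φ j = b) :
    (w ≫ (homotopyCofiber φ).d j k) ≫ homotopyCofiber.fstX φ k l h' = - a ≫ F.d k l ∧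
    (w ≫ (homotopyCofiber φ).d j k) ≫ homotopyCofiber.sndX φ k = a ≫ φ.f k + b ≫ G.d j k := by
  subst ha hb
  constructor
  · rw [Category.assoc]
    erw [homotopyCofiber.d_fstX φ j k l h h']
    simp
  · rw [Category.assoc]
    erw [homotopyCofiber.d_sndX φ j k h]
    simp

lemma cof_acyc {F G : Ct A t} (s : F ⟶ G) (hs : Qis A t s) : Acyc (homotopyCofiber s) := by
  rw [qis_iff] at hs
  intro i j k hi hk T w hw
  obtain ⟨d1, d2⟩ := cof_d s hk (pRel' k) w _ _ rfl rfl
  rw [hw, zero_comp] at d1 d2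
  set x := w ≫ homotopyCofiber.fstX s j k hk with hx
  set a := w ≫ homotopyCofiber.sndX s j with ha
  obtain ⟨T1, π1, _, x1, hx1⟩ := (hs j k (k+1) hk (pRel' k)).1 x (by simpa using d1.symm) (-a)
    (by rw [Preadditive.neg_comp]; exact eq_neg_of_add_eq_zero_left d2.symm)
  obtain ⟨T2, π2, _, z, hz, c, hc⟩ := (hs i j k hi hk).2 (x1 ≫ s.f j + π1 ≫ a) (by
    rw [Preadditive.add_comp, Category.assoc, s.comm, ← Category.assoc, ← hx1, Category.assoc π1 x,
      Category.assoc π1 a, ← Preadditive.comp_add, ← d2, comp_zero])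
  obtain ⟨v, hv1, hv2⟩ := cof_lift s hi (z - π2 ≫ x1) c
  refine ⟨T2, π2 ≫ π1, inferInstance, v, ?_⟩
  obtain ⟨e1, e2⟩ := cof_d s hi hk v _ _ hv1 hv2
  refine homotopyCofiber.ext_to_X s j k hk ?_ ?_
  · rw [e1, Category.assoc, Category.assoc, ← hx, hx1]; simp [hz]
  · rw [e2, Category.assoc, Category.assoc, ← ha]
    rw [Preadditive.comp_add] at hc
    have := eq_sub_of_add_eq' hc
    rw [this]; simp; abel

lemma cof_inr_qis {F G : Ct A t} (φ : F ⟶ G) (hF : Acyc F) : Qis A t (homotopyCofiber.inr φ) := by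
  rw [qis_iff]
  intro i j k hi hk
  constructor
  · intro T x hx y hy
    obtain ⟨d1, d2⟩ := cof_d φ hi hk y _ _ rfl rfl
    rw [← hy] at d1 d2
    change (x ≫ homotopyCofiber.inrX φ j) ≫ _ = _ at d1
    change (x ≫ homotopyCofiber.inrX φ j) ≫ _ = _ at d2
    simp only [Category.assoc, homotopyCofiber.inrX_sndX, homotopyCofiber.inrX_fstX, comp_zero, Category.comp_id] at d1 d2
    obtain ⟨T1, π1, _, x1, hx1⟩ := hF i j k hi hk (y ≫ homotopyCofiber.fstX φ i j hi) (by
      simpa using d1.symm)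
    refine ⟨T1, π1, inferInstance, x1 ≫ φ.f i + π1 ≫ y ≫ homotopyCofiber.sndX φ i, ?_⟩
    rw [d2]
    simp only [Preadditive.comp_add, Preadditive.add_comp, Category.assoc] at hx1 ⊢
    rw [reassoc_of% hx1]; simp
  · intro T w hw
    obtain ⟨d1, d2⟩ := cof_d φ hk (pRel' k) w _ _ rfl rfl
    rw [hw, zero_comp] at d1 d2
    obtain ⟨T1, π1, _, x1, hx1⟩ := hF j k (k+1) hk (pRel' k) (w ≫ homotopyCofiber.fstX φ j k hk) (by
      simpa using d1.symm)
    obtain ⟨v, hv1, hv2⟩ := cof_lift φ hi (-x1) (0 : T1 ⟶ G.X i)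
    obtain ⟨e1, e2⟩ := cof_d φ hi hk v _ _ hv1 hv2
    refine ⟨T1, π1, inferInstance, x1 ≫ φ.f j + π1 ≫ w ≫ homotopyCofiber.sndX φ j, ?_, v, ?_⟩
    · rw [Preadditive.add_comp, Category.assoc, φ.comm]
      rw [← Category.assoc, ← hx1]
      simp only [Category.assoc] at d2 ⊢
      rw [← Preadditive.comp_add, ← d2, comp_zero]
    · refine homotopyCofiber.ext_to_X φ j k hk ?_ ?_
      · rw [Preadditive.add_comp, e1]
        change _ = (_ ≫ homotopyCofiber.inrX φ j) ≫ _ + _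
        rw [Category.assoc]
        simp [hx1]
      · rw [Preadditive.add_comp, e2]
        change _ = (_ ≫ homotopyCofiber.inrX φ j) ≫ _ + _
        rw [Category.assoc]
        simp

lemma biprod_f_total (X Y : Ct A t) (j : ZMod t) :
    (biprod.fst : X ⊞ Y ⟶ X).f j ≫ (biprod.inl : X ⟶ X ⊞ Y).f j +
    (biprod.snd : X ⊞ Y ⟶ Y).f j ≫ (biprod.inr : Y ⟶ X ⊞ Y).f j = 𝟙 _ := by
  have := congrArg (fun f : X ⊞ Y ⟶ X ⊞ Y => f.f j) (biprod.total (X := X) (Y := Y))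
  simpa using this

lemma biprod_f_ext {X Y : Ct A t} {j : ZMod t} {T : A} {u v : T ⟶ (X ⊞ Y).X j}
    (h1 : u ≫ (biprod.fst : X ⊞ Y ⟶ X).f j = v ≫ (biprod.fst : X ⊞ Y ⟶ X).f j)
    (h2 : u ≫ (biprod.snd : X ⊞ Y ⟶ Y).f j = v ≫ (biprod.snd : X ⊞ Y ⟶ Y).f j) : u = v := by
  rw [← Category.comp_id u, ← Category.comp_id v, ← biprod_f_total, Preadditive.comp_add,
    Preadditive.comp_add, ← Category.assoc, ← Category.assoc, ← Category.assoc, ← Category.assoc,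
    h1, h2]

lemma biprod_inl_fst_f (X Y : Ct A t) (j : ZMod t) :
  (biprod.inl : X ⟶ X ⊞ Y).f j ≫ (biprod.fst : X ⊞ Y ⟶ X).f j = 𝟙 _ := by
  rw [← HomologicalComplex.comp_f, biprod.inl_fst]; rfl
lemma biprod_inr_fst_f (X Y : Ct A t) (j : ZMod t) :
  (biprod.inr : Y ⟶ X ⊞ Y).f j ≫ (biprod.fst : X ⊞ Y ⟶ X).f j = 0 := by
  rw [← HomologicalComplex.comp_f, biprod.inr_fst]; rfl
lemma biprod_inl_snd_f (X Y : Ct A t) (j : ZMod t) :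
  (biprod.inl : X ⟶ X ⊞ Y).f j ≫ (biprod.snd : X ⊞ Y ⟶ Y).f j = 0 := by
  rw [← HomologicalComplex.comp_f, biprod.inl_snd]; rfl
lemma biprod_inr_snd_f (X Y : Ct A t) (j : ZMod t) :
  (biprod.inr : Y ⟶ X ⊞ Y).f j ≫ (biprod.snd : X ⊞ Y ⟶ Y).f j = 𝟙 _ := by
  rw [← HomologicalComplex.comp_f, biprod.inr_snd]; rfl

lemma push_qis {X' X Y : Ct A t} (s : X' ⟶ X) (f : X' ⟶ Y) (hs : Qis A t s) :
    Qis A t ((biprod.inr : Y ⟶ X ⊞ Y) ≫ homotopyCofiber.inr (biprod.lift s (-f))) := by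
  rw [qis_iff] at hs ⊢
  set ψ := biprod.lift s (-f) with hψ
  have ψ1 : ∀ j, ψ.f j ≫ (biprod.fst : X ⊞ Y ⟶ X).f j = s.f j := fun j => by
    rw [← HomologicalComplex.comp_f, hψ, biprod.lift_fst]
  have ψ2 : ∀ j, ψ.f j ≫ (biprod.snd : X ⊞ Y ⟶ Y).f j = - f.f j := fun j => by
    rw [← HomologicalComplex.comp_f, hψ, biprod.lift_snd]; rfl
  intro i j k hi hk
  have key : ∀ {i j k : ZMod t} (hi : (pShape t).Rel i j) (hk : (pShape t).Rel j k) {T : A}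
      (w : T ⟶ (homotopyCofiber ψ).X i),
      (w ≫ (homotopyCofiber ψ).d i j) ≫ homotopyCofiber.fstX ψ j k hk =
        - (w ≫ homotopyCofiber.fstX ψ i j hi) ≫ X'.d j k ∧
      (w ≫ (homotopyCofiber ψ).d i j) ≫ homotopyCofiber.sndX ψ j ≫ (biprod.fst : X ⊞ Y ⟶ X).f j =
        (w ≫ homotopyCofiber.fstX ψ i j hi) ≫ s.f j +
        (w ≫ homotopyCofiber.sndX ψ i ≫ (biprod.fst : X ⊞ Y ⟶ X).f i) ≫ X.d i j ∧
      (w ≫ (homotopyCofiber ψ).d i j) ≫ homotopyCofiber.sndX ψ j ≫ (biprod.snd : X ⊞ Y ⟶ Y).f j =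
        - (w ≫ homotopyCofiber.fstX ψ i j hi) ≫ f.f j +
        (w ≫ homotopyCofiber.sndX ψ i ≫ (biprod.snd : X ⊞ Y ⟶ Y).f i) ≫ Y.d i j := by
    intro i j k hi hk T w
    obtain ⟨d1, d2⟩ := cof_d ψ hi hk w _ _ rfl rfl
    refine ⟨d1, ?_, ?_⟩
    · rw [← Category.assoc (w ≫ _), d2, Preadditive.add_comp, Category.assoc, ψ1]
      simp
    · rw [← Category.assoc (w ≫ _), d2, Preadditive.add_comp, Category.assoc, ψ2]
      simp
  have inc : ∀ (j k : ZMod t) (hk : (pShape t).Rel j k) {T : A} (y : T ⟶ Y.X j),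
      (y ≫ ((biprod.inr : Y ⟶ X ⊞ Y) ≫ homotopyCofiber.inr ψ).f j) ≫ homotopyCofiber.fstX ψ j k hk = 0 ∧
      (y ≫ ((biprod.inr : Y ⟶ X ⊞ Y) ≫ homotopyCofiber.inr ψ).f j) ≫ homotopyCofiber.sndX ψ j ≫ (biprod.fst : X ⊞ Y ⟶ X).f j = 0 ∧
      (y ≫ ((biprod.inr : Y ⟶ X ⊞ Y) ≫ homotopyCofiber.inr ψ).f j) ≫ homotopyCofiber.sndX ψ j ≫ (biprod.snd : X ⊞ Y ⟶ Y).f j = y := by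
    intro j k hk T y
    have e : ((biprod.inr : Y ⟶ X ⊞ Y) ≫ homotopyCofiber.inr ψ).f j = (biprod.inr : Y ⟶ X ⊞ Y).f j ≫ homotopyCofiber.inrX ψ j := rfl
    rw [e]
    refine ⟨?_, ?_, ?_⟩
    · simp
    · simp [biprod_inr_fst_f]
    · simp [biprod_inr_snd_f]
  constructor
  · intro T x hx w hw
    obtain ⟨d1, d2, d3⟩ := key hi hk w
    obtain ⟨i1, i2, i3⟩ := inc j k hk x
    rw [← hw] at d1 d2 d3
    rw [i1] at d1
    rw [i2] at d2
    rw [i3] at d3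
    obtain ⟨T1, π1, _, x1, hx1⟩ := (hs i j k hi hk).1 (w ≫ homotopyCofiber.fstX ψ i j hi) (by simpa using d1.symm)
      (-(w ≫ homotopyCofiber.sndX ψ i ≫ (biprod.fst : X ⊞ Y ⟶ X).f i))
      (by rw [Preadditive.neg_comp]; exact eq_neg_of_add_eq_zero_left d2.symm)
    refine ⟨T1, π1, inferInstance, π1 ≫ (w ≫ homotopyCofiber.sndX ψ i ≫ (biprod.snd : X ⊞ Y ⟶ Y).f i) - x1 ≫ f.f i, ?_⟩
    rw [d3, Preadditive.comp_add, Preadditive.comp_neg, ← Category.assoc π1, hx1]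
    simp; abel
  · intro T w hw
    obtain ⟨d1, d2, d3⟩ := key hk (pRel' k) w
    rw [hw, zero_comp] at d1 d2 d3
    set x := w ≫ homotopyCofiber.fstX ψ j k hk with hx
    set a := w ≫ homotopyCofiber.sndX ψ j ≫ (biprod.fst : X ⊞ Y ⟶ X).f j with ha
    set b := w ≫ homotopyCofiber.sndX ψ j ≫ (biprod.snd : X ⊞ Y ⟶ Y).f j with hb
    obtain ⟨T1, π1, _, x1, hx1⟩ := (hs j k (k+1) hk (pRel' k)).1 x (by simpa using d1.symm) (-a)
      (by rw [Preadditive.neg_comp]; exact eq_neg_of_add_eq_zero_left d2.symm)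
    obtain ⟨T2, π2, _, z, hz, c, hc⟩ := (hs i j k hi hk).2 (x1 ≫ s.f j + π1 ≫ a) (by
      rw [Preadditive.add_comp, Category.assoc, s.comm, ← Category.assoc, ← hx1, Category.assoc π1 x,
        Category.assoc π1 a, ← Preadditive.comp_add, ← d2, comp_zero])
    obtain ⟨v, hv1, hv2⟩ := cof_lift ψ hi (z - π2 ≫ x1) (c ≫ (biprod.inl : X ⟶ X ⊞ Y).f i)
    obtain ⟨e1, e2, e3⟩ := key hi hk v
    have hv3 : v ≫ homotopyCofiber.sndX ψ i ≫ (biprod.fst : X ⊞ Y ⟶ X).f i = c := by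
      rw [← Category.assoc, hv2, Category.assoc, biprod_inl_fst_f, Category.comp_id]
    have hv4 : v ≫ homotopyCofiber.sndX ψ i ≫ (biprod.snd : X ⊞ Y ⟶ Y).f i = 0 := by
      rw [← Category.assoc, hv2, Category.assoc, biprod_inl_snd_f, comp_zero]
    rw [hv1] at e1
    rw [hv1, hv3] at e2
    rw [hv1, hv4] at e3
    have hbd : b ≫ Y.d j k = x ≫ f.f k := by
      have := d3.symm
      rw [neg_add_eq_zero] at this
      exact this.symm
    refine ⟨T2, π2 ≫ π1, inferInstance, π2 ≫ π1 ≫ b + (z - π2 ≫ x1) ≫ f.f j, ?_, v, ?_⟩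
    · simp only [Preadditive.add_comp, Category.assoc, Preadditive.sub_comp, Hom.comm, hbd]
      rw [reassoc_of% hz, ← reassoc_of% hx1]; simp
    · obtain ⟨i1, i2, i3⟩ := inc j k hk (π2 ≫ π1 ≫ b + (z - π2 ≫ x1) ≫ f.f j)
      refine homotopyCofiber.ext_to_X ψ j k hk ?_ ?_
      · rw [Preadditive.add_comp, e1, i1, Category.assoc, Category.assoc, ← hx, hx1]; simp [hz]
      · apply biprod_f_ext
        · rw [Category.assoc _ (homotopyCofiber.sndX ψ j), Category.assoc _ (homotopyCofiber.sndX ψ j),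
            Preadditive.add_comp, e2, i2, Category.assoc, Category.assoc, ← ha]
          rw [Preadditive.comp_add] at hc
          rw [eq_sub_of_add_eq' hc]; simp; abel
        · rw [Category.assoc _ (homotopyCofiber.sndX ψ j), Category.assoc _ (homotopyCofiber.sndX ψ j),
            Preadditive.add_comp, e3, i3, Category.assoc, Category.assoc, ← hb]
          simp only [Preadditive.sub_comp, zero_comp, Category.assoc]; abel

end Frac

section Frac2
variable {t : ℕ}
open HomologicalComplex

abbrev HoQ (A : Type) [SmallCategory A] [Abelian A] (t : ℕ) :=
  HomotopyCategory.quotient A (pShape t)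

lemma quot_eq_iff {X Y : Ct A t} (f g : X ⟶ Y) :
    (HoQ A t).map f = (HoQ A t).map g ↔ Nonempty (Homotopy f g) :=
  ⟨fun h => ⟨HomotopyCategory.homotopyOfEq _ _ h⟩, fun ⟨h⟩ => HomotopyCategory.eq_of_homotopy _ _ h⟩

instance hasLCF : (HomotopyCategory.quasiIso A (pShape t)).HasLeftCalculusOfFractions where
  exists_leftFraction := by
    intro X Y φ
    obtain ⟨X', s, hs, f, rfl⟩ := φ.cases
    obtain ⟨X', rfl⟩ := HomotopyCategory.quotient_obj_surjective X'
    obtain ⟨X, rfl⟩ := HomotopyCategory.quotient_obj_surjective X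
    obtain ⟨Y, rfl⟩ := HomotopyCategory.quotient_obj_surjective Y
    obtain ⟨s, rfl⟩ := (HomotopyCategory.quotient _ _).map_surjective s
    obtain ⟨f, rfl⟩ := (HomotopyCategory.quotient _ _).map_surjective f
    rw [HomotopyCategory.quotient_map_mem_quasiIso_iff] at hs
    refine ⟨MorphismProperty.LeftFraction.mk
      ((HoQ A t).map ((biprod.inl : X ⟶ X ⊞ Y) ≫ homotopyCofiber.inr (biprod.lift s (-f))))
      ((HoQ A t).map ((biprod.inr : Y ⟶ X ⊞ Y) ≫ homotopyCofiber.inr (biprod.lift s (-f))))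
      (by rw [HomotopyCategory.quotient_map_mem_quasiIso_iff]; exact push_qis s f hs), ?_⟩
    change (HoQ A t).map f ≫ (HoQ A t).map _ = (HoQ A t).map s ≫ (HoQ A t).map _
    rw [← Functor.map_comp, ← Functor.map_comp, eq_comm, ← sub_eq_zero, ← Functor.map_sub,
      ← (HoQ A t).map_zero, quot_eq_iff]
    have := homotopyCofiber.inrCompHomotopy (biprod.lift s (-f)) pEx
    refine ⟨(Homotopy.ofEq ?_).trans this⟩
    rw [biprod.lift_eq]
    simp [sub_eq_add_neg]
  ext := by
    intro X' X Y f₁ f₂ s hs h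
    obtain ⟨X', rfl⟩ := HomotopyCategory.quotient_obj_surjective X'
    obtain ⟨X, rfl⟩ := HomotopyCategory.quotient_obj_surjective X
    obtain ⟨Y, rfl⟩ := HomotopyCategory.quotient_obj_surjective Y
    obtain ⟨s, rfl⟩ := (HomotopyCategory.quotient _ _).map_surjective s
    obtain ⟨f₁, rfl⟩ := (HomotopyCategory.quotient _ _).map_surjective f₁
    obtain ⟨f₂, rfl⟩ := (HomotopyCategory.quotient _ _).map_surjective f₂
    rw [HomotopyCategory.quotient_map_mem_quasiIso_iff] at hs
    rw [← Functor.map_comp, ← Functor.map_comp, ← sub_eq_zero, ← Functor.map_sub,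
      ← (HoQ A t).map_zero, quot_eq_iff, ← Preadditive.comp_sub] at h
    obtain ⟨h⟩ := h
    let g := homotopyCofiber.desc s (f₁ - f₂) h
    refine ⟨_, (HoQ A t).map (homotopyCofiber.inr g), ?_, ?_⟩
    · rw [HomotopyCategory.quotient_map_mem_quasiIso_iff]
      exact cof_inr_qis g (cof_acyc s hs)
    · rw [← Functor.map_comp, ← Functor.map_comp, ← sub_eq_zero, ← Functor.map_sub,
        ← (HoQ A t).map_zero, quot_eq_iff, ← Preadditive.sub_comp]
      have e : f₁ - f₂ = homotopyCofiber.inr s ≫ g := (homotopyCofiber.inr_desc _ _ _).symm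
      rw [e, Category.assoc]
      exact ⟨((homotopyCofiber.inrCompHomotopy g pEx).compLeft (homotopyCofiber.inr s)).trans
        (Homotopy.ofEq comp_zero)⟩

variable {E : Type*} [Category E] (L : Ct A t ⥤ E)
    [L.IsLocalization (HomologicalComplex.quasiIso A (pShape t))]

lemma L_inv {X Y : Ct A t} (s : X ⟶ Y) (hs : Qis A t s) : IsIso (L.map s) :=
  Localization.inverts L (HomologicalComplex.quasiIso A (pShape t)) s hs

lemma L_htpy {X Y : Ct A t} {f g : X ⟶ Y} (h : Homotopy f g) : L.map f = L.map g :=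
  h.map_eq_of_inverts_homotopyEquivalences pEx L
    (MorphismProperty.IsInvertedBy.of_le _ _ _
      (Localization.inverts L (HomologicalComplex.quasiIso A _))
      (homotopyEquivalences_le_quasiIso A _))

def Lh : HomotopyCategory A (pShape t) ⥤ E :=
  CategoryTheory.Quotient.lift _ L (fun _ _ _ _ ⟨h⟩ => L_htpy L h)

lemma Lh_fac : HoQ A t ⋙ Lh L = L := rfl

instance : (Lh L).IsLocalization (HomotopyCategory.quasiIso A (pShape t)) := by
  have := (pShape t).quotient_isLocalization pEx A
  have : (HomotopyCategory.quotient A (pShape t) ⋙ Lh L).IsLocalization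
    (HomologicalComplex.quasiIso A (pShape t)) := by rw [Lh_fac]; infer_instance
  exact Functor.IsLocalization.of_comp (HomotopyCategory.quotient A (pShape t))
    (Lh L) (HomologicalComplex.homotopyEquivalences A (pShape t))
    (HomotopyCategory.quasiIso A (pShape t)) (HomologicalComplex.quasiIso A (pShape t))
    (homotopyEquivalences_le_quasiIso A (pShape t))
    (HomotopyCategory.quasiIso_eq_quasiIso_map_quotient A (pShape t))

lemma left_fac {X Y : Ct A t} (f : L.obj X ⟶ L.obj Y) :
    ∃ (W : Ct A t) (g : X ⟶ W) (s : Y ⟶ W), Qis A t s ∧ f ≫ L.map s = L.map g := by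
  have ⟨φ, hφ⟩ := Localization.exists_leftFraction (Lh L) (HomotopyCategory.quasiIso A (pShape t))
    (X := (HoQ A t).obj X) (Y := (HoQ A t).obj Y) f
  obtain ⟨X', g, s, hs, rfl⟩ := φ.cases
  obtain ⟨X', rfl⟩ := HomotopyCategory.quotient_obj_surjective X'
  obtain ⟨s, rfl⟩ := (HomotopyCategory.quotient _ _).map_surjective s
  obtain ⟨g, rfl⟩ := (HomotopyCategory.quotient _ _).map_surjective g
  refine ⟨X', g, s, (HomotopyCategory.quotient_map_mem_quasiIso_iff _).1 hs, ?_⟩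
  have := MorphismProperty.LeftFraction.map_comp_map_s
    (MorphismProperty.LeftFraction.mk ((HoQ A t).map g) ((HoQ A t).map s) hs) (Lh L) (Localization.inverts _ _)
  rw [← hφ] at this
  exact this

lemma L_map_eq {X Y : Ct A t} (f g : X ⟶ Y) (h : L.map f = L.map g) :
    ∃ (W : Ct A t) (s : Y ⟶ W), Qis A t s ∧ Nonempty (Homotopy (f ≫ s) (g ≫ s)) := by
  obtain ⟨W, s, hs, e⟩ := (MorphismProperty.map_eq_iff_postcomp (Lh L)
    (HomotopyCategory.quasiIso A (pShape t)) ((HoQ A t).map f) ((HoQ A t).map g)).1 h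
  obtain ⟨W, rfl⟩ := HomotopyCategory.quotient_obj_surjective W
  obtain ⟨s, rfl⟩ := (HomotopyCategory.quotient _ _).map_surjective s
  refine ⟨W, s, (HomotopyCategory.quotient_map_mem_quasiIso_iff _).1 hs, ?_⟩
  rw [← Functor.map_comp, ← Functor.map_comp, quot_eq_iff] at e
  exact e

lemma ore {X' X Y : Ct A t} (s : X' ⟶ X) (f : X' ⟶ Y) (hs : Qis A t s) :
    ∃ (W : Ct A t) (s' : Y ⟶ W) (f' : X ⟶ W), Qis A t s' ∧
      Nonempty (Homotopy (f ≫ s') (s ≫ f')) := by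
  refine ⟨_, _, (biprod.inl : X ⟶ X ⊞ Y) ≫ homotopyCofiber.inr (biprod.lift s (-f)), push_qis s f hs, ?_⟩
  rw [← quot_eq_iff, eq_comm, ← sub_eq_zero, ← Functor.map_sub,
      ← (HoQ A t).map_zero, quot_eq_iff]
  have := homotopyCofiber.inrCompHomotopy (biprod.lift s (-f)) pEx
  refine ⟨(Homotopy.ofEq ?_).trans this⟩
  rw [biprod.lift_eq]
  simp [sub_eq_add_neg]

instance : (HomologicalComplex.quasiIso A (pShape t)).IsStableUnderFiniteProducts where
  isStableUnderProductsOfShape J _ := by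
    refine ⟨?_⟩
    intro X₁ X₂ c₁ c₂ h₁ h₂ f hf φ hφ
    rw [HomologicalComplex.mem_quasiIso_iff, quasiIso_iff]
    intro i
    rw [quasiIsoAt_iff_isIso_homologyMap]
    let H := HomologicalComplex.homologyFunctor A (pShape t) i
    have : IsIso (Functor.whiskerRight f H) := by
      rw [NatTrans.isIso_iff_isIso_app]
      intro j
      have := hf j
      rw [HomologicalComplex.mem_quasiIso_iff, quasiIso_iff] at this
      have := this i
      rw [quasiIsoAt_iff_isIso_homologyMap] at this
      exact this
    let e := IsLimit.conePointsIsoOfNatIso (isLimitOfPreserves H h₁) (isLimitOfPreserves H h₂)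
      (asIso (Functor.whiskerRight f H))
    have : H.map φ = e.hom := by
      refine (isLimitOfPreserves H h₂).hom_ext fun j => ?_
      have e2 := IsLimit.conePointsIsoOfNatIso_hom_comp (isLimitOfPreserves H h₁)
        (isLimitOfPreserves H h₂) (asIso (Functor.whiskerRight f H)) j
      refine Eq.trans ?_ e2.symm
      change H.map φ ≫ H.map (c₂.π.app j) = H.map (c₁.π.app j) ≫ H.map (f.app j)
      rw [← H.map_comp, ← H.map_comp, hφ]
    change IsIso (H.map φ)
    rw [this]
    infer_instance

lemma L_additive [Preadditive E] [HasZeroObject E] : L.Additive := by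
  have : PreservesFiniteProducts L :=
    Localization.preservesFiniteProducts L (HomologicalComplex.quasiIso A (pShape t))
  exact Functor.additive_of_preserves_binary_products L

end Frac2

section Model
variable {t : ℕ}
open HomologicalComplex

/-- the standard complex attached to extensions `P m` of `V (m+1)` by `x m` -/
def Qc {x V : ZMod t → A} (P : ∀ m, Ex (V (m+1)) (x m)) : Ct A t :=
  CochainComplex.of (fun m => (P m).P ⊞ V m)
    (fun m => biprod.fst ≫ (P m).π ≫ biprod.inr) (fun m => by simp)

section
variable {x V : ZMod t → A} (P : ∀ m, Ex (V (m+1)) (x m))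

def qfst (m : ZMod t) : (Qc P).X m ⟶ (P m).P := (biprod.fst : (P m).P ⊞ V m ⟶ _)
def qsnd (m : ZMod t) : (Qc P).X m ⟶ V m := (biprod.snd : (P m).P ⊞ V m ⟶ _)
def qlift {T : A} {m : ZMod t} (a : T ⟶ (P m).P) (b : T ⟶ V m) : T ⟶ (Qc P).X m :=
  (biprod.lift a b : T ⟶ (P m).P ⊞ V m)

@[simp] lemma qlift_fst {T : A} {m : ZMod t} (a : T ⟶ (P m).P) (b : T ⟶ V m) :
    qlift P a b ≫ qfst P m = a := biprod.lift_fst a b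
@[simp] lemma qlift_snd {T : A} {m : ZMod t} (a : T ⟶ (P m).P) (b : T ⟶ V m) :
    qlift P a b ≫ qsnd P m = b := biprod.lift_snd a b

lemma q_ext {T : A} {m : ZMod t} {a b : T ⟶ (Qc P).X m} (h₁ : a ≫ qfst P m = b ≫ qfst P m)
    (h₂ : a ≫ qsnd P m = b ≫ qsnd P m) : a = b :=
  biprod.hom_ext (X := (P m).P) (Y := V m) a b h₁ h₂

lemma qd_eq (m : ZMod t) : (Qc P).d m (m+1) =
    ((biprod.fst ≫ (P m).π ≫ biprod.inr : (P m).P ⊞ V m ⟶ (P (m+1)).P ⊞ V (m+1))) :=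
  CochainComplex.of_d (fun m => (P m).P ⊞ V m)
    (fun m => biprod.fst ≫ (P m).π ≫ biprod.inr) m

@[simp] lemma qd_fst (m : ZMod t) : (Qc P).d m (m+1) ≫ qfst P (m+1) = 0 := by
  rw [qd_eq]
  have : ((biprod.fst ≫ (P m).π ≫ biprod.inr : (P m).P ⊞ V m ⟶ (P (m+1)).P ⊞ V (m+1))) ≫
    biprod.fst = 0 := by simp
  exact this

@[simp] lemma qd_snd (m : ZMod t) : (Qc P).d m (m+1) ≫ qsnd P (m+1) = qfst P m ≫ (P m).π := by
  rw [qd_eq]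
  have : ((biprod.fst ≫ (P m).π ≫ biprod.inr : (P m).P ⊞ V m ⟶ (P (m+1)).P ⊞ V (m+1))) ≫
    biprod.snd = biprod.fst ≫ (P m).π := by simp
  exact this

/-- chain maps to the standard complex -/
def Qmap {W : Ct A t} (a : ∀ m, W.X m ⟶ (P m).P) (b : ∀ m, W.X m ⟶ V m)
    (ha : ∀ m, W.d m (m+1) ≫ a (m+1) = 0)
    (hb : ∀ m, W.d m (m+1) ≫ b (m+1) = a m ≫ (P m).π) : W ⟶ Qc P where
  f m := qlift P (a m) (b m)
  comm' := by
    rintro i _ rfl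
    refine q_ext P ?_ ?_
    · rw [Category.assoc, qd_fst, Category.assoc, qlift_fst, ha, comp_zero]
    · rw [Category.assoc, qd_snd, Category.assoc, qlift_snd, hb, ← Category.assoc, qlift_fst]

@[simp] lemma Qmap_f {W : Ct A t} (a : ∀ m, W.X m ⟶ (P m).P) (b : ∀ m, W.X m ⟶ V m) (ha hb)
    (m : ZMod t) : (Qmap P a b ha hb).f m = qlift P (a m) (b m) := rfl

lemma mkZero_d (f : ZMod t → A) (i j : ZMod t) : (mkZero f).d i j = 0 := rfl

def zin (f : ZMod t → A) (m : ZMod t) : f m ⟶ (mkZero f).X m := 𝟙 (f m)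
def zout (f : ZMod t → A) (m : ZMod t) : (mkZero f).X m ⟶ f m := 𝟙 (f m)
@[simp] lemma zin_zout (f : ZMod t → A) (m : ZMod t) : zin f m ≫ zout f m = 𝟙 _ :=
  Category.id_comp (𝟙 (f m))
@[simp] lemma zout_zin (f : ZMod t → A) (m : ZMod t) : zout f m ≫ zin f m = 𝟙 _ :=
  Category.id_comp (𝟙 (f m))
@[simp] lemma zin_zout' (f : ZMod t → A) (m : ZMod t) {T : A} (h : f m ⟶ T) :
    zin f m ≫ zout f m ≫ h = h := by rw [← Category.assoc, zin_zout, Category.id_comp]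
@[simp] lemma zout_zin' (f : ZMod t → A) (m : ZMod t) {T : A} (h : (mkZero f).X m ⟶ T) :
    zout f m ≫ zin f m ≫ h = h := by rw [← Category.assoc, zout_zin, Category.id_comp]
instance (f : ZMod t → A) (m : ZMod t) : IsIso (zin f m) := ⟨zout f m, by simp, by simp⟩
instance (f : ZMod t → A) (m : ZMod t) : IsIso (zout f m) := ⟨zin f m, by simp, by simp⟩

/-- the inclusion of the zero-differential complex -/
def qs : mkZero x ⟶ Qc P :=
  Qmap P (fun m => zout x m ≫ (P m).j) (fun _ => 0) (fun _ => by rw [mkZero_d, zero_comp])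
    (fun m => by rw [mkZero_d, zero_comp, Category.assoc, (P m).w, comp_zero])

lemma qs_f (m : ZMod t) : (qs P).f m = qlift P (zout x m ≫ (P m).j) 0 := rfl

lemma qs_qis : Qis A t (qs P) := by
  rw [qis_iff]
  rintro i _ _ rfl rfl
  constructor
  · intro T x₂ h y₁ e
    refine ⟨T, 𝟙 _, inferInstance, 0, ?_⟩
    have := e =≫ qfst P _
    rw [Category.assoc, Category.assoc, qs_f, qlift_fst, qd_fst, comp_zero] at this
    rw [zero_comp, Category.id_comp]
    exact (cancel_mono (zout x (i+1) ≫ (P (i+1)).j)).1 (by rw [zero_comp]; exact this)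
  · intro T y h
    have h2 := h =≫ qsnd P _
    rw [Category.assoc, qd_snd, zero_comp, ← Category.assoc] at h2
    obtain ⟨s, hs⟩ := (P (i+1)).lift' _ h2
    obtain ⟨T', p, hp, z, hz⟩ := surjective_up_to_refinements_of_epi (P i).π (y ≫ qsnd P _)
    refine ⟨T', p, hp, p ≫ s ≫ zin x _, by rw [mkZero_d, comp_zero], qlift P z 0, ?_⟩
    refine q_ext P ?_ ?_
    · simp only [Preadditive.add_comp, Category.assoc, qd_fst, comp_zero, add_zero, qs_f,
        qlift_fst, zin_zout', hs]
    · simp only [Preadditive.add_comp, Category.assoc, qd_snd, comp_zero, qs_f,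
        qlift_snd, zero_add]
      rw [hz, ← Category.assoc (qlift P z 0), qlift_fst]

end

section
variable [HasExt.{0} A] (hered : ∀ X Y : A, Subsingleton (Abelian.Ext X Y 2))
include hered

lemma buildQ (W : Ct A t) {x V : ZMod t → A} (σ : ∀ m, W.X m ⟶ V m)
    (p : ∀ m, cokernel (W.d (m-1) m) ⟶ W.X (m+1))
    (hp : ∀ m, cokernel.π _ ≫ p m = W.d m (m+1))
    (i : ∀ m, x m ⟶ cokernel (W.d (m-1) m)) [∀ m, Mono (i m)]
    (w : ∀ m, i m ≫ p m ≫ σ (m+1) = 0)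
    (hex : ∀ m, (ShortComplex.mk (i m) (p m ≫ σ (m+1)) (w m)).Exact) :
    ∃ (P : ∀ m, Ex (V (m+1)) (x m)) (u : W ⟶ Qc P)
      (um : ∀ m, cokernel (W.d (m-1) m) ⟶ (P m).P), (∀ m, Mono (um m)) ∧
      (∀ m, u.f m ≫ qfst P m = cokernel.π _ ≫ um m) ∧ (∀ m, i m ≫ um m = (P m).j) ∧
      (∀ m, u.f m ≫ qsnd P m = σ m) := by
  choose P um h₁ h₂ using fun m => exists_ex_of_left_exact hered (i m) (p m ≫ σ (m+1)) (w m) (hex m)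
  refine ⟨P, Qmap P (fun m => cokernel.π _ ≫ um m) σ ?_ ?_, um, ?_, ?_, h₁, ?_⟩
  · intro m
    have : ∀ i, i = m → W.d m (m+1) ≫ cokernel.π (W.d i (m+1)) = 0 := by
      rintro _ rfl
      exact cokernel.condition _
    have := this (m + 1 - 1) (by ring)
    rw [← Category.assoc, this, zero_comp]
  · intro m
    rw [Category.assoc, h₂, ← Category.assoc, hp]
  · intro m
    refine Preadditive.mono_of_cancel_zero _ fun {T} g hg => ?_
    have : g ≫ p m ≫ σ (m+1) = 0 := by rw [← h₂, ← Category.assoc, hg, zero_comp]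
    obtain ⟨T', q, hq, y, hy⟩ := (hex m).exact_up_to_refinements g this
    have hy' : q ≫ g = y ≫ i m := hy
    have : y ≫ (P m).j = 0 := by rw [← h₁, ← Category.assoc, ← hy', Category.assoc, hg, comp_zero]
    have : y = 0 := (cancel_mono (P m).j).1 (by rw [this, zero_comp])
    rw [this, zero_comp] at hy'
    exact (cancel_epi q).1 (by rw [hy', comp_zero])
  · intro m
    rw [Qmap_f, qlift_fst]
  · intro m
    rw [Qmap_f, qlift_snd]


omit hered [HasExt.{0} A] in
lemma exists_p (W : Ct A t) (m : ZMod t) : ∃ p : cokernel (W.d (m-1) m) ⟶ W.X (m+1),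
    cokernel.π _ ≫ p = W.d m (m+1) :=
  ⟨cokernel.desc _ (W.d m (m+1)) (W.d_comp_d _ _ _), cokernel.π_desc _ _ _⟩

/-- every quasi-isomorphism out of a zero-differential complex can be continued to a standard one -/
lemma lemmaG {x : ZMod t → A} {W : Ct A t} (s : mkZero x ⟶ W) (hs : Qis A t s) :
    ∃ (V : ZMod t → A) (P : ∀ m, Ex (V (m+1)) (x m)) (u : W ⟶ Qc P), s ≫ u = qs P := by
  rw [qis_iff] at hs
  choose p hp using exists_p W
  have hr : ∀ m : ZMod t, (pShape t).Rel (m-1) m := fun m => pRel (by ring)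
  have hm : ∀ m, Mono (zin x m ≫ s.f m ≫ cokernel.π (W.d (m-1) m)) := by
    intro m
    refine Preadditive.mono_of_cancel_zero _ fun {T} g hg => ?_
    obtain ⟨T', q, hq, y, hy⟩ := (ShortComplex.exact_cokernel (W.d (m-1) m)).exact_up_to_refinements
      (g ≫ zin x m ≫ s.f m) (by simpa using hg)
    have hy' : q ≫ g ≫ zin x m ≫ s.f m = y ≫ W.d (m-1) m := hy
    obtain ⟨T'', q', hq', z, hz⟩ := (hs (m-1) m (m+1) (hr m) (pRel' m)).1 (q ≫ g ≫ zin x m)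
      (by rw [mkZero_d, comp_zero]) y (by simpa using hy')
    rw [mkZero_d, comp_zero] at hz
    refine (cancel_mono (zin x m)).1 ((cancel_epi (q' ≫ q)).1 ?_)
    simpa using hz
  have hw : ∀ m, (zin x m ≫ s.f m ≫ cokernel.π (W.d (m-1) m)) ≫ p m ≫ cokernel.π (s.f (m+1)) = 0 := by
    intro m
    rw [Category.assoc, Category.assoc, reassoc_of% (hp m), reassoc_of% (s.comm m (m+1)), mkZero_d,
      zero_comp, comp_zero]
  have hex : ∀ m, (ShortComplex.mk _ _ (hw m)).Exact := by
    intro m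
    rw [ShortComplex.exact_iff_exact_up_to_refinements]
    intro T z hz
    change z ≫ p m ≫ cokernel.π (s.f (m+1)) = 0 at hz
    obtain ⟨T₁, q₁, h₁, w, hw⟩ := surjective_up_to_refinements_of_epi (cokernel.π (W.d (m-1) m)) z
    change T ⟶ cokernel (W.d (m-1) m) at z
    have h2 : (w ≫ W.d m (m+1)) ≫ cokernel.π (s.f (m+1)) = 0 := by
      rw [← hp m, Category.assoc, Category.assoc, ← reassoc_of% hw, hz, comp_zero]
    obtain ⟨T₂, q₂, hq₂, y, hy⟩ := (ShortComplex.exact_cokernel (s.f (m+1))).exact_up_to_refinements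
      _ h2
    change q₂ ≫ w ≫ W.d m (m+1) = y ≫ s.f (m+1) at hy
    obtain ⟨T₃, q₃, hq₃, y', hy'⟩ := (hs m (m+1) (m+1+1) (pRel' m) (pRel' _)).1 y
      (by rw [mkZero_d, comp_zero]) (q₂ ≫ w) (by rw [← hy, Category.assoc])
    rw [mkZero_d, comp_zero] at hy'
    have h3 : (q₃ ≫ q₂ ≫ w) ≫ W.d m (m+1) = 0 := by
      rw [Category.assoc, Category.assoc, hy, reassoc_of% hy', zero_comp]
    obtain ⟨T₄, q₄, hq₄, y₄, _, y₅, h4⟩ := (hs (m-1) m (m+1) (hr m) (pRel' m)).2 _ h3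
    refine ⟨T₄, q₄ ≫ q₃ ≫ q₂ ≫ q₁, inferInstance, y₄ ≫ zout x m, ?_⟩
    change (q₄ ≫ q₃ ≫ q₂ ≫ q₁) ≫ z = (y₄ ≫ zout x m) ≫ zin x m ≫ s.f m ≫ cokernel.π (W.d (m-1) m)
    have h5 := h4 =≫ cokernel.π (W.d (m-1) m)
    simp only [Preadditive.add_comp, Category.assoc, cokernel.condition, comp_zero, add_zero] at h5
    simp only [Category.assoc, zout_zin', ← h5]
    rw [hw]
  obtain ⟨P, u, um, -, h₁, h₂, h₃⟩ := buildQ hered W (V := fun m => cokernel (s.f m))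
    (fun m => cokernel.π (s.f m)) p hp _ hw hex
  refine ⟨fun m => cokernel (s.f m), P, u, ?_⟩
  ext m
  refine q_ext (V := fun m => cokernel (s.f m)) P ?_ ?_
  · rw [HomologicalComplex.comp_f, Category.assoc, h₁, qs_f, qlift_fst, ← h₂]
    simp
  · rw [HomologicalComplex.comp_f, Category.assoc, h₃, qs_f, qlift_snd, cokernel.condition]

/-- every complex is quasi-isomorphic to a standard one -/
lemma lemmaF (W : Ct A t) : ∃ (x V : ZMod t → A) (P : ∀ m, Ex (V (m+1)) (x m)) (u : W ⟶ Qc P),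
    Qis A t u := by
  choose p hp using exists_p W
  have hr : ∀ m : ZMod t, (pShape t).Rel (m-1) m := fun m => pRel (by ring)
  obtain ⟨P, u, um, h₀, h₁, h₂, h₃⟩ := buildQ hered W (V := fun m => W.X m) (fun m => 𝟙 _) p hp
    (fun m => kernel.ι (p m)) (fun m => by simp) (fun m => by
      rw [ShortComplex.exact_iff_exact_up_to_refinements]
      intro T z hz
      exact ⟨T, 𝟙 _, inferInstance, kernel.lift _ z (by simpa using hz), by simp⟩)
  refine ⟨_, _, P, u, ?_⟩
  rw [qis_iff]
  rintro i _ _ rfl rfl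
  obtain ⟨m, rfl⟩ : ∃ m, i = m - 1 := ⟨i+1, by ring⟩
  obtain ⟨n, hn⟩ : ∃ n, n = m - 1 + 1 := ⟨_, rfl⟩
  constructor
  · intro T x₂ h y₁ e
    have e2 := e =≫ qfst P _
    rw [Category.assoc, Category.assoc, qd_fst, h₁, comp_zero] at e2
    have e3 : x₂ ≫ cokernel.π (W.d (m-1+1-1) (m-1+1)) = 0 :=
      (cancel_mono (um _)).1 (by rw [Category.assoc, e2, zero_comp])
    obtain ⟨T', q, hq, y, hy⟩ :=
      (ShortComplex.exact_cokernel (W.d (m-1+1-1) (m-1+1))).exact_up_to_refinements _ e3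
    have e : m - 1 + 1 - 1 = m - 1 := by ring
    change T' ⟶ W.X (m-1+1-1) at y
    change q ≫ x₂ = y ≫ W.d (m-1+1-1) (m-1+1) at hy
    refine ⟨T', q, hq, y ≫ (W.XIsoOfEq e).hom, ?_⟩
    rw [hy, Category.assoc, HomologicalComplex.XIsoOfEq_hom_comp_d]
  · intro T y hy
    have h2 := hy =≫ qsnd P _
    rw [Category.assoc, qd_snd, zero_comp, ← Category.assoc] at h2
    obtain ⟨s, hs⟩ := (P (m-1+1)).lift' _ h2
    obtain ⟨T₁, q₁, hq₁, w, hw⟩ := surjective_up_to_refinements_of_epi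
      (cokernel.π (W.d (m-1+1-1) (m-1+1))) (s ≫ kernel.ι (p (m-1+1)))
    obtain ⟨T₂, q₂, hq₂, z, hz⟩ := surjective_up_to_refinements_of_epi (P (m-1)).π
      (q₁ ≫ y ≫ qsnd P _ - w)
    refine ⟨T₂, q₂ ≫ q₁, inferInstance, q₂ ≫ w, ?_, qlift P z 0, ?_⟩
    · rw [← hp, Category.assoc, ← reassoc_of% hw, kernel.condition]; simp
    · refine q_ext P ?_ ?_
      · simp only [Preadditive.add_comp, Category.assoc, qd_fst, comp_zero, add_zero, h₁,
          ← reassoc_of% hw, h₂, hs]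
      · simp only [Preadditive.add_comp, Category.assoc, qd_snd, h₃]
        rw [← Category.assoc (qlift P z 0), qlift_fst, ← hz]
        simp

end
end Model

section Inv
variable {t : ℕ} [HasExt.{0} A]
open HomologicalComplex

def Dat {g x V : ZMod t → A} (P : ∀ m, Ex (V (m+1)) (x m)) (φ : mkZero g ⟶ Qc P)
    (l : ∀ m, g m ⟶ x m) (e : ∀ m, Abelian.Ext (g (m+1)) (x m) 1) : Prop :=
  (∀ m, zin g m ≫ φ.f m ≫ qfst P m = l m ≫ (P m).j) ∧
  (∀ m, pull (zin g (m+1) ≫ φ.f (m+1) ≫ qsnd P (m+1)) (P m).cls = e m)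

lemma dat_exists {g x V : ZMod t → A} (P : ∀ m, Ex (V (m+1)) (x m)) (φ : mkZero g ⟶ Qc P) :
    ∃ l e, Dat P φ l e := by
  have h : ∀ m, ∃ l : g m ⟶ x m, l ≫ (P m).j = zin g m ≫ φ.f m ≫ qfst P m := by
    intro m
    refine (P m).lift' _ ?_
    have := φ.comm m (m+1) =≫ qsnd P _
    rw [mkZero_d, zero_comp, zero_comp, Category.assoc, qd_snd] at this
    rw [Category.assoc, Category.assoc, this, comp_zero]
  choose l hl using h
  exact ⟨l, _, fun m => (hl m).symm, fun m => rfl⟩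

lemma dat_map {g x V V' : ZMod t → A} {P : ∀ m, Ex (V (m+1)) (x m)} {P' : ∀ m, Ex (V' (m+1)) (x m)}
    {φ : mkZero g ⟶ Qc P} {l e} (h : Dat P φ l e) (ψ : Qc P ⟶ Qc P') (hψ : qs P ≫ ψ = qs P') :
    Dat P' (φ ≫ ψ) l e := by
  -- components
  let a m : (P m).P ⟶ (P' m).P := qlift P (𝟙 _) 0 ≫ ψ.f m ≫ qfst P' m
  let b m : V m ⟶ (P' m).P := qlift P 0 (𝟙 _) ≫ ψ.f m ≫ qfst P' m
  let c m : (P m).P ⟶ V' m := qlift P (𝟙 _) 0 ≫ ψ.f m ≫ qsnd P' m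
  let d m : V m ⟶ V' m := qlift P 0 (𝟙 _) ≫ ψ.f m ≫ qsnd P' m
  have dec : ∀ m {T : A} (u : T ⟶ (Qc P).X m),
      u = (u ≫ qfst P m) ≫ qlift P (𝟙 _) 0 + (u ≫ qsnd P m) ≫ qlift P 0 (𝟙 _) := by
    intro m T u
    refine q_ext P ?_ ?_ <;> simp
  have h1 : ∀ m {T : A} (u : T ⟶ (Qc P).X m), u ≫ ψ.f m ≫ qfst P' m =
      (u ≫ qfst P m) ≫ a m + (u ≫ qsnd P m) ≫ b m := by
    intro m T u
    conv_lhs => rw [dec m u]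
    simp only [Preadditive.add_comp, Category.assoc, a, b]
  have h2 : ∀ m {T : A} (u : T ⟶ (Qc P).X m), u ≫ ψ.f m ≫ qsnd P' m =
      (u ≫ qfst P m) ≫ c m + (u ≫ qsnd P m) ≫ d m := by
    intro m T u
    conv_lhs => rw [dec m u]
    simp only [Preadditive.add_comp, Category.assoc, c, d]
  have ja : ∀ m, (P m).j ≫ a m = (P' m).j := by
    intro m
    have := congrArg (fun k => zin x m ≫ HomologicalComplex.Hom.f k m ≫ qfst P' m) hψ
    simp only [HomologicalComplex.comp_f, Category.assoc, h1, qs_f, qlift_fst, qlift_snd,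
      zero_comp, add_zero, zin_zout'] at this
    exact this
  have jc : ∀ m, (P m).j ≫ c m = 0 := by
    intro m
    have := congrArg (fun k => zin x m ≫ HomologicalComplex.Hom.f k m ≫ qsnd P' m) hψ
    simp only [HomologicalComplex.comp_f, Category.assoc, h2, qs_f, qlift_fst, qlift_snd,
      zero_comp, add_zero, zin_zout', comp_zero] at this
    exact this
  have hb : ∀ m, (P m).π ≫ b (m+1) = 0 := by
    intro m
    have e := qlift P (𝟙 _) 0 ≫= (ψ.comm m (m+1) =≫ qfst P' _)
    simp only [Category.assoc, qd_fst, comp_zero, h1, zero_comp, zero_add, qd_snd] at e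
    rw [← Category.assoc, ← Category.assoc, qlift_fst, Category.id_comp] at e
    exact e.symm
  have hb' : ∀ m, b m = 0 := by
    intro m
    obtain ⟨n, rfl⟩ : ∃ n, m = n + 1 := ⟨m - 1, by ring⟩
    exact (cancel_epi (P n).π).1 (by rw [hb, comp_zero])
  have hπ : ∀ m, a m ≫ (P' m).π = (P m).π ≫ d (m+1) := by
    intro m
    have e := qlift P (𝟙 _) 0 ≫= (ψ.comm m (m+1) =≫ qsnd P' _)
    simp only [Category.assoc, qd_fst, comp_zero, h2, zero_comp, zero_add, qd_snd] at e
    rw [← Category.assoc (qlift P _ _) (qfst P m), qlift_fst, Category.id_comp] at e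
    rw [← e]
    simp only [a, Category.assoc]
  have hc : ∀ m, pull (d (m+1)) (P' m).cls = (P m).cls := by
    intro m
    have := Ex.naturality (P m) (P' m) (𝟙 _) (a m) (d (m+1)) (by rw [ja, Category.id_comp]) (hπ m)
    rw [← this, push_id]
  refine ⟨fun m => ?_, fun m => ?_⟩
  · have := h1 m (zin g m ≫ φ.f m)
    simp only [Category.assoc] at this
    simp only [HomologicalComplex.comp_f, Category.assoc, this, hb', comp_zero, add_zero]
    have e := h.1 m =≫ a m
    simp only [Category.assoc, ja] at e
    exact e
  · have := h2 (m+1) (zin g (m+1) ≫ φ.f (m+1))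
    simp only [Category.assoc] at this
    have e := h.1 (m+1) =≫ c (m+1)
    simp only [Category.assoc, jc, comp_zero] at e
    have e2 : zin g (m+1) ≫ (φ ≫ ψ).f (m+1) ≫ qsnd P' (m+1) =
      (zin g (m+1) ≫ φ.f (m+1) ≫ qsnd P (m+1)) ≫ d (m+1) := by
      simp only [HomologicalComplex.comp_f, Category.assoc, this, e, zero_add]
    rw [e2, pull_comp, hc, h.2]

lemma dat_sub {g x V : ZMod t → A} {P : ∀ m, Ex (V (m+1)) (x m)}
    {φ φ' : mkZero g ⟶ Qc P} {l e l' e'} (h : Dat P φ l e) (h' : Dat P φ' l' e') :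
    Dat P (φ - φ') (fun m => l m - l' m) (fun m => e m - e' m) := by
  refine ⟨fun m => ?_, fun m => ?_⟩
  · rw [HomologicalComplex.sub_f_apply, Preadditive.sub_comp, Preadditive.comp_sub, h.1, h'.1,
      Preadditive.sub_comp]
  · rw [HomologicalComplex.sub_f_apply, Preadditive.sub_comp, Preadditive.comp_sub]
    change _ = e m - e' m
    rw [← h.2, ← h'.2, eq_sub_iff_add_eq, ← add_pull, sub_add_cancel]

lemma pull_biprod {s a b c : A} (u : s ⟶ a) (v : s ⟶ b) (α : Abelian.Ext a c 1)
    (β : Abelian.Ext b c 1) : pull (u ≫ biprod.inl + v ≫ biprod.inr)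
      (pull (biprod.fst : a ⊞ b ⟶ a) α + pull biprod.snd β) = pull u α + pull v β := by
  simp only [pull_add, ← pull_comp, Preadditive.add_comp, Category.assoc, biprod.inl_fst, biprod.inl_snd,
      biprod.inr_fst, biprod.inr_snd, comp_zero, Category.comp_id, zero_pull, add_zero, zero_add]

lemma pull_neg {a' a b : A} (f : a' ⟶ a) (e : Abelian.Ext a b 1) : pull f (-e) = - pull f e :=
  eq_neg_of_add_eq_zero_left (by rw [← pull_add, neg_add_cancel, pull_zero])

lemma push_neg' {a b b' : A} (e : Abelian.Ext a b 1) (f : b ⟶ b') : push (-e) f = - push e f :=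
  eq_neg_of_add_eq_zero_left (by rw [← push_add, neg_add_cancel, push_zero])

lemma common {x V V' : ZMod t → A} (P : ∀ m, Ex (V (m+1)) (x m)) (P' : ∀ m, Ex (V' (m+1)) (x m)) :
    ∃ (V'' : ZMod t → A) (P'' : ∀ m, Ex (V'' (m+1)) (x m)) (ψ : Qc P ⟶ Qc P'') (ψ' : Qc P' ⟶ Qc P''),
      qs P ≫ ψ = qs P'' ∧ qs P' ≫ ψ' = qs P'' := by
  have h : ∀ m, ∃ Z : Ex (V (m+1) ⊞ V' (m+1)) (x m),
      Z.cls = pull biprod.fst (P m).cls + pull biprod.snd (P' m).cls := fun m => exists_ex _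
  choose Z hZ using h
  have k1 := fun m => Ex.exists_map (P m) (Z m) (𝟙 _) biprod.inl (by
    rw [hZ, pull_add, ← pull_comp, ← pull_comp]; simp)
  have k2 := fun m => Ex.exists_map (P' m) (Z m) (𝟙 _) biprod.inr (by
    rw [hZ, pull_add, ← pull_comp, ← pull_comp]; simp)
  choose a ha hπ using k1
  choose a' ha' hπ' using k2
  refine ⟨fun m => V m ⊞ V' m, Z, Qmap (V := fun m => V m ⊞ V' m) Z
    (fun m => qfst P m ≫ a m) (fun m => qsnd P m ≫ biprod.inl) ?_ ?_,
    Qmap (V := fun m => V m ⊞ V' m) Z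
    (fun m => qfst P' m ≫ a' m) (fun m => qsnd P' m ≫ biprod.inr) ?_ ?_, ?_, ?_⟩
  · intro m
    rw [← Category.assoc, qd_fst, zero_comp]
  · intro m
    rw [← Category.assoc, qd_snd, Category.assoc, Category.assoc, hπ]
  · intro m
    rw [← Category.assoc, qd_fst, zero_comp]
  · intro m
    rw [← Category.assoc, qd_snd, Category.assoc, Category.assoc, hπ']
  · ext m
    refine q_ext (V := fun m => V m ⊞ V' m) Z ?_ ?_
    · rw [HomologicalComplex.comp_f, Category.assoc, Qmap_f, qlift_fst, ← Category.assoc, qs_f, qlift_fst,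
        qs_f, qlift_fst, Category.assoc, ha, Category.id_comp]
    · rw [HomologicalComplex.comp_f, Category.assoc, Qmap_f, qlift_snd, ← Category.assoc, qs_f, qlift_snd,
        qs_f, qlift_snd, zero_comp]
  · ext m
    refine q_ext (V := fun m => V m ⊞ V' m) Z ?_ ?_
    · rw [HomologicalComplex.comp_f, Category.assoc, Qmap_f, qlift_fst, ← Category.assoc, qs_f, qlift_fst,
        qs_f, qlift_fst, Category.assoc, ha', Category.id_comp]
    · rw [HomologicalComplex.comp_f, Category.assoc, Qmap_f, qlift_snd, ← Category.assoc, qs_f, qlift_snd,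
        qs_f, qlift_snd, zero_comp]

variable {E : Type*} [Category E] [Preadditive E] [HasZeroObject E] (L : Ct A t ⥤ E)
    [L.IsLocalization (HomologicalComplex.quasiIso A (pShape t))]

lemma dat_zero {g x V : ZMod t → A} {P : ∀ m, Ex (V (m+1)) (x m)}
    {φ : mkZero g ⟶ Qc P} (h : Dat P φ 0 0) : L.map φ = 0 := by
  have := L_additive L
  choose w hw using fun m => (P m).exists_lift _ (h.2 m)
  rw [← L.map_zero]
  refine L_htpy L
    { hom := fun i j => if hh : j + 1 = i then
        eqToHom (by rw [hh]) ≫ zout g (j+1) ≫ qlift P (w j) 0 else 0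
      zero := fun i j hij => dif_neg hij
      comm := ?_ }
  intro i
  obtain ⟨m, rfl⟩ : ∃ m, i = m + 1 := ⟨i - 1, by ring⟩
  rw [dNext_eq _ (pRel' (m+1)), prevD_eq _ (pRel' m), mkZero_d, zero_comp, zero_add,
    HomologicalComplex.zero_f, add_zero, dif_pos rfl, eqToHom_refl, Category.id_comp]
  refine q_ext P ?_ ?_
  · rw [Category.assoc, Category.assoc, qd_fst, comp_zero, comp_zero]
    have := h.1 (m+1)
    rw [Pi.zero_apply, zero_comp] at this
    exact (cancel_epi (zin g (m+1))).1 (by rw [this, comp_zero])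
  · rw [Category.assoc, Category.assoc, qd_snd, ← Category.assoc (qlift P _ _), qlift_fst, hw, zout_zin']


section
variable (hered : ∀ X Y : A, Subsingleton (Abelian.Ext X Y 2))
include hered

lemma dat_eq_zero {g x V : ZMod t → A} {P : ∀ m, Ex (V (m+1)) (x m)}
    {φ : mkZero g ⟶ Qc P} {l e} (h : Dat P φ l e) (h0 : L.map φ = 0) : l = 0 ∧ e = 0 := by
  have := L_additive L
  rw [← L.map_zero] at h0
  obtain ⟨W, s, hs, ⟨H⟩⟩ := L_map_eq L _ _ h0
  obtain ⟨V', P', u, hu⟩ := lemmaG hered (qs P ≫ s) ((Qis A t).comp_mem _ _ (qs_qis P) hs)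
  have D := dat_map (P' := P') h (s ≫ u) (by rw [← hu, Category.assoc])
  have H' : Homotopy (φ ≫ s ≫ u) 0 :=
    (Homotopy.ofEq (Category.assoc _ _ _).symm).trans ((H.compRight u).trans
      (Homotopy.ofEq (by rw [zero_comp, zero_comp])))
  have key : ∀ m, (φ ≫ s ≫ u).f (m+1) = H'.hom (m+1) m ≫ (Qc P').d m (m+1) := by
    intro m
    rw [H'.comm, dNext_eq _ (pRel' (m+1)), prevD_eq _ (pRel' m), mkZero_d, zero_comp, zero_add,
      HomologicalComplex.zero_f, add_zero]
  constructor
  · ext m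
    obtain ⟨m, rfl⟩ : ∃ n, m = n + 1 := ⟨m - 1, by ring⟩
    have := D.1 (m+1)
    rw [key, Category.assoc, qd_fst, comp_zero, comp_zero] at this
    exact (cancel_mono (P' (m+1)).j).1 (by rw [← this]; exact zero_comp.symm)
  · funext m
    have := D.2 m
    rw [key, Category.assoc, qd_snd, ← Category.assoc, ← Category.assoc, pull_comp, Ex.pull_π,
      pull_zero] at this
    exact this.symm

end

/-- `(l, e)` are the invariants of the morphism `lam` -/
def IsInv {g x : ZMod t → A} (lam : L.obj (mkZero g) ⟶ L.obj (mkZero x))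
    (l : ∀ m, g m ⟶ x m) (e : ∀ m, Abelian.Ext (g (m+1)) (x m) 1) : Prop :=
  ∃ (V : ZMod t → A) (P : ∀ m, Ex (V (m+1)) (x m)) (φ : mkZero g ⟶ Qc P),
    lam ≫ L.map (qs P) = L.map φ ∧ Dat P φ l e

variable {L}

lemma isInv_sub {g x : ZMod t → A} {lam lam' : L.obj (mkZero g) ⟶ L.obj (mkZero x)} {l l' e e'}
    (h : IsInv L lam l e) (h' : IsInv L lam' l' e') :
    IsInv L (lam - lam') (l - l') (e - e') := by
  have := L_additive L
  obtain ⟨V, P, φ, h1, h2⟩ := h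
  obtain ⟨V', P', φ', h1', h2'⟩ := h'
  obtain ⟨V'', P'', ψ, ψ', k, k'⟩ := common P P'
  refine ⟨V'', P'', φ ≫ ψ - φ' ≫ ψ', ?_, dat_sub (dat_map h2 ψ k) (dat_map h2' ψ' k')⟩
  rw [Preadditive.sub_comp, L.map_sub, L.map_comp, L.map_comp, ← h1, ← h1', Category.assoc,
    Category.assoc, ← L.map_comp, ← L.map_comp, k, k']

lemma isInv_surj {g x : ZMod t → A} (l : ∀ m, g m ⟶ x m)
    (e : ∀ m, Abelian.Ext (g (m+1)) (x m) 1) : ∃ lam, IsInv L lam l e := by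
  choose P hP using fun m => exists_ex (e m)
  let φ : mkZero g ⟶ Qc P := Qmap P (fun m => zout g m ≫ l m ≫ (P m).j) (fun m => zout g m)
    (fun m => by rw [mkZero_d, zero_comp])
    (fun m => by rw [mkZero_d, zero_comp, Category.assoc, Category.assoc, (P m).w, comp_zero, comp_zero])
  have := L_inv L (qs P) (qs_qis P)
  refine ⟨L.map φ ≫ inv (L.map (qs P)), _, P, φ, by simp, fun m => ?_, fun m => ?_⟩
  · change zin g m ≫ qlift P _ _ ≫ _ = _
    rw [qlift_fst, zin_zout']
  · change pull (zin g (m+1) ≫ qlift P _ _ ≫ _) _ = _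
    rw [qlift_snd, zin_zout, pull_id, hP]

lemma isInv_id (x : ZMod t → A) : IsInv L (𝟙 (L.obj (mkZero x))) (fun m => 𝟙 _) 0 := by
  choose P hP using fun m => exists_ex (0 : Abelian.Ext (x (m+1)) (x m) 1)
  refine ⟨_, P, qs P, by simp, fun m => ?_, fun m => ?_⟩
  · rw [qs_f, qlift_fst, zin_zout', Category.id_comp]
  · rw [qs_f, qlift_snd, comp_zero, zero_pull]; rfl

lemma isInv_zero {g x : ZMod t → A} {lam : L.obj (mkZero g) ⟶ L.obj (mkZero x)}
    (h : IsInv L lam 0 0) : lam = 0 := by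
  obtain ⟨V, P, φ, h1, h2⟩ := h
  have := L_inv L (qs P) (qs_qis P)
  rw [dat_zero L h2] at h1
  exact (cancel_mono (L.map (qs P))).1 (by rw [h1, zero_comp])

section
variable (hered : ∀ X Y : A, Subsingleton (Abelian.Ext X Y 2))
include hered

lemma isInv_exists {g x : ZMod t → A} (lam : L.obj (mkZero g) ⟶ L.obj (mkZero x)) :
    ∃ l e, IsInv L lam l e := by
  obtain ⟨W, φ, s, hs, h⟩ := left_fac L lam
  obtain ⟨V, P, u, hu⟩ := lemmaG hered s hs
  obtain ⟨l, e, hD⟩ := dat_exists P (φ ≫ u)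
  refine ⟨l, e, V, P, φ ≫ u, ?_, hD⟩
  rw [← hu, L.map_comp, L.map_comp, ← h, Category.assoc]

lemma isInv_of_zero {g x : ZMod t → A} {l e}
    (h : IsInv L (0 : L.obj (mkZero g) ⟶ L.obj (mkZero x)) l e) : l = 0 ∧ e = 0 := by
  obtain ⟨V, P, φ, h1, h2⟩ := h
  rw [zero_comp] at h1
  exact dat_eq_zero L hered h2 h1.symm

lemma isInv_comp {g x y : ZMod t → A} {lam : L.obj (mkZero g) ⟶ L.obj (mkZero x)}
    {mu : L.obj (mkZero x) ⟶ L.obj (mkZero y)} {l e k ε}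
    (h : IsInv L lam l e) (h' : IsInv L mu k ε) :
    IsInv L (lam ≫ mu) (fun m => l m ≫ k m)
      (fun m => pull (l (m+1)) (ε m) + push (e m) (k m)) := by
  obtain ⟨V, P, φ, h1, h2⟩ := h
  obtain ⟨V', P', ψ, h1', h2'⟩ := h'
  let v m : x m ⟶ V' m := zin x m ≫ ψ.f m ≫ qsnd P' m
  choose T hT using fun m => exists_ex (push (P m).cls (v m))
  choose r hr hr' using fun m => Ex.exists_map (P m) (T m) (v m) (𝟙 _) (by rw [hT, pull_id])
  choose ee hee using fun m => pull_surj hered (T (m+1)).j (P' m).cls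
  have hZ : ∀ m, ∃ Z : Ex ((T (m+1)).P ⊞ V (m+1)) (y m),
      Z.cls = pull biprod.fst (ee m) + pull biprod.snd (push (P m).cls (k m)) := fun m => exists_ex _
  choose Z hZ using hZ
  have k1 := fun m => Ex.exists_map (P m) (Z m) (k m) biprod.inr (by
    rw [hZ, pull_add, ← pull_comp, ← pull_comp]; simp)
  have k2 := fun m => Ex.exists_map (P' m) (Z m) (𝟙 _) ((T (m+1)).j ≫ biprod.inl) (by
    rw [hZ, pull_add, ← pull_comp, ← pull_comp]; simp [hee])
  choose a ha hπ using k1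
  choose a' ha' hπ' using k2
  let V3 : ZMod t → A := fun m => (T m).P ⊞ V m
  let Ψ : Qc P ⟶ Qc (V := V3) Z := Qmap (V := V3) Z (fun m => qfst P m ≫ a m)
    (fun m => qfst P m ≫ r m ≫ biprod.inl + qsnd P m ≫ biprod.inr)
    (fun m => by rw [← Category.assoc, qd_fst, zero_comp])
    (fun m => by
      rw [Preadditive.comp_add, ← Category.assoc, qd_fst, zero_comp, zero_add, ← Category.assoc,
        qd_snd, Category.assoc, Category.assoc, hπ])
  let Ψ' : Qc P' ⟶ Qc (V := V3) Z := Qmap (V := V3) Z (fun m => qfst P' m ≫ a' m)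
    (fun m => qsnd P' m ≫ (T m).j ≫ biprod.inl)
    (fun m => by rw [← Category.assoc, qd_fst, zero_comp])
    (fun m => by rw [← Category.assoc, qd_snd, Category.assoc, Category.assoc, hπ'])
  have c1 : qs P' ≫ Ψ' = qs (V := V3) Z := by
    ext m
    refine q_ext (V := V3) Z ?_ ?_
    · rw [HomologicalComplex.comp_f, Category.assoc, Qmap_f, qlift_fst, ← Category.assoc, qs_f, qlift_fst,
        qs_f, qlift_fst, Category.assoc, ha', Category.id_comp]
    · rw [HomologicalComplex.comp_f, Category.assoc, Qmap_f, qlift_snd, ← Category.assoc, qs_f, qlift_snd,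
        qs_f, qlift_snd, zero_comp]
  have c2 : qs P ≫ Ψ = ψ ≫ Ψ' := by
    ext m
    refine (cancel_epi (zin x m)).1 (q_ext (V := V3) Z ?_ ?_)
    · simp only [HomologicalComplex.comp_f, Category.assoc, Ψ, Ψ', Qmap_f, qlift_fst]
      rw [reassoc_of% (h2'.1 m), ha', Category.id_comp, ← Category.assoc ((qs P).f m), qs_f, qlift_fst,
        Category.assoc, zin_zout', ha]
    · simp only [HomologicalComplex.comp_f, Category.assoc, Ψ, Ψ', Qmap_f, qlift_snd,
        Preadditive.comp_add]
      rw [← Category.assoc ((qs P).f m), ← Category.assoc ((qs P).f m), qs_f, qlift_fst, qlift_snd,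
        zero_comp, comp_zero, add_zero, Category.assoc, zin_zout', reassoc_of% (hr m)]
      simp only [v, Category.assoc]
  refine ⟨V3, Z, φ ≫ Ψ, ?_, fun m => ?_, fun m => ?_⟩
  · rw [L.map_comp, ← h1, Category.assoc, Category.assoc, ← L.map_comp, c2, L.map_comp, ← h1',
      Category.assoc, ← L.map_comp, c1]
  · simp only [HomologicalComplex.comp_f, Category.assoc, Ψ, Qmap_f, qlift_fst]
    rw [reassoc_of% (h2.1 m), ha]
  · simp only [HomologicalComplex.comp_f, Category.assoc, Ψ, Qmap_f, qlift_snd, Preadditive.comp_add]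
    rw [reassoc_of% (h2.1 (m+1)), reassoc_of% (hr (m+1)), hZ]
    have := pull_biprod (l (m+1) ≫ v (m+1) ≫ (T (m+1)).j) (zin g (m+1) ≫ φ.f (m+1) ≫ qsnd P (m+1))
      (ee m) (push (P m).cls (k m))
    simp only [Category.assoc] at this
    refine this.trans ?_
    rw [pull_comp, pull_comp, hee, h2'.2, ← h2.2, pull_push]

/-- the invariants as an additive equivalence -/
def invE (g x : ZMod t → A) : (L.obj (mkZero g) ⟶ L.obj (mkZero x)) ≃
    (∀ m, g m ⟶ x m) × (∀ m, Abelian.Ext (g (m+1)) (x m) 1) :=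
  Equiv.ofBijective (fun lam => ((isInv_exists hered lam).choose,
      (isInv_exists hered lam).choose_spec.choose)) (by
    have hs : ∀ lam : L.obj (mkZero g) ⟶ L.obj (mkZero x), IsInv L lam
      (isInv_exists hered lam).choose (isInv_exists hered lam).choose_spec.choose :=
      fun lam => (isInv_exists hered lam).choose_spec.choose_spec
    constructor
    · intro lam lam' h
      have h1 := (Prod.mk.inj h).1
      have h2 := (Prod.mk.inj h).2
      have := isInv_sub (hs lam) (hs lam')
      rw [sub_eq_zero.2 h1, sub_eq_zero.2 h2] at this
      exact sub_eq_zero.1 (isInv_zero this)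
    · rintro ⟨l, e⟩
      obtain ⟨lam, h⟩ := isInv_surj (L := L) l e
      have := isInv_sub (hs lam) h
      rw [sub_self] at this
      obtain ⟨h1, h2⟩ := isInv_of_zero hered this
      exact ⟨lam, Prod.ext (sub_eq_zero.1 h1) (sub_eq_zero.1 h2)⟩)

lemma invE_spec {g x : ZMod t → A} (lam : L.obj (mkZero g) ⟶ L.obj (mkZero x)) :
    IsInv L lam (invE hered g x lam).1 (invE hered g x lam).2 :=
  (isInv_exists hered lam).choose_spec.choose_spec

lemma invE_eq {g x : ZMod t → A} {lam : L.obj (mkZero g) ⟶ L.obj (mkZero x)} {l e}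
    (h : IsInv L lam l e) : invE hered g x lam = (l, e) := by
  have := isInv_sub (invE_spec hered lam) h
  rw [sub_self] at this
  obtain ⟨h1, h2⟩ := isInv_of_zero hered this
  exact Prod.ext (sub_eq_zero.1 h1) (sub_eq_zero.1 h2)

lemma invE_comp {g x y : ZMod t → A} (lam : L.obj (mkZero g) ⟶ L.obj (mkZero x))
    (mu : L.obj (mkZero x) ⟶ L.obj (mkZero y)) : invE hered g y (lam ≫ mu) =
      (fun m => (invE hered g x lam).1 m ≫ (invE hered x y mu).1 m,
       fun m => pull ((invE hered g x lam).1 (m+1)) ((invE hered x y mu).2 m) +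
        push ((invE hered g x lam).2 m) ((invE hered x y mu).1 m)) :=
  invE_eq hered (isInv_comp hered (invE_spec hered lam) (invE_spec hered mu))

lemma invE_id (x : ZMod t → A) : invE (L := L) hered x x (𝟙 _) = (fun _ => 𝟙 _, 0) :=
  invE_eq hered (isInv_id x)

/-- a morphism is an isomorphism iff its degree-zero part is -/
lemma isIso_iff_inv {g x : ZMod t → A} (lam : L.obj (mkZero g) ⟶ L.obj (mkZero x)) :
    IsIso lam ↔ ∀ m, IsIso ((invE hered g x lam).1 m) := by
  constructor
  · intro h m
    have e1 := invE_comp hered lam (inv lam)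
    have e2 := invE_comp hered (inv lam) lam
    rw [IsIso.hom_inv_id, invE_id] at e1
    rw [IsIso.inv_hom_id, invE_id] at e2
    exact ⟨(invE hered x g (inv lam)).1 m, (congrFun (Prod.mk.inj e1).1 m).symm,
      (congrFun (Prod.mk.inj e2).1 m).symm⟩
  · intro h
    let l := (invE hered g x lam).1
    let e := (invE hered g x lam).2
    have hl : ∀ m, IsIso (l m) := h
    obtain ⟨mu, hmu⟩ := isInv_surj (L := L) (fun m => inv (l m))
      (fun m => - pull (inv (l (m+1))) (push (e m) (inv (l m))))
    have hm := invE_eq hered hmu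
    refine ⟨mu, (invE hered g g).injective ?_, (invE hered x x).injective ?_⟩
    · rw [invE_comp, hm, invE_id]
      refine Prod.ext ?_ ?_
      · funext m
        exact IsIso.hom_inv_id (l m)
      · funext m
        change pull (l (m+1)) (- pull (inv (l (m+1))) (push (e m) (inv (l m)))) +
          push (e m) (inv (l m)) = 0
        rw [pull_neg, ← pull_comp, IsIso.hom_inv_id, pull_id, neg_add_cancel]
    · rw [invE_comp, hm, invE_id]
      refine Prod.ext ?_ ?_
      · funext m
        exact IsIso.inv_hom_id (l m)
      · funext m
        change pull (inv (l (m+1))) (e m) +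
          push (- pull (inv (l (m+1))) (push (e m) (inv (l m)))) (l m) = 0
        rw [push_neg', pull_push, ← push_comp, IsIso.inv_hom_id, push_id, add_neg_cancel]

end

end Inv

section Odd

lemma preorder_sum {α : Type*} [Finite α] [Preorder α] (f : α → ℤ)
    (h : ∀ b, ∑ᶠ a ∈ {a | a ≤ b}, f a = 0) (n : ℕ) : ∀ U : Set α, IsLowerSet U → U.ncard ≤ n →
    ∑ᶠ a ∈ U, f a = 0 := by
  induction n with
  | zero =>
    intro U _ hn
    have : U = ∅ := (Set.ncard_eq_zero (Set.toFinite U)).1 (by omega)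
    subst this; simp
  | succ n ih =>
    intro U hU hn
    rcases U.eq_empty_or_nonempty with rfl | hne
    · simp
    obtain ⟨m, hm⟩ := (Set.toFinite U).exists_maximal hne
    have hsplit : ∀ (S : Set α) (T : Set α), Disjoint S T →
      ∑ᶠ a ∈ S ∪ T, f a = ∑ᶠ a ∈ S, f a + ∑ᶠ a ∈ T, f a := fun S T hd =>
        finsum_mem_union hd (Set.toFinite _) (Set.toFinite _)
    have e1 : U = {a ∈ U | ¬ m ≤ a} ∪ {a | a ≤ m ∧ m ≤ a} := by
      ext a
      constructor
      · intro ha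
        by_cases hh : m ≤ a
        · exact Or.inr ⟨hm.2 ha hh, hh⟩
        · exact Or.inl ⟨ha, hh⟩
      · rintro (ha | ha)
        · exact ha.1
        · exact hU ha.1 hm.1
    have e2 : {a | a ≤ m} = {a | a < m} ∪ {a | a ≤ m ∧ m ≤ a} := by
      ext a
      simp only [Set.mem_setOf_eq, Set.mem_union, lt_iff_le_not_ge]
      tauto
    have d1 : Disjoint {a ∈ U | ¬ m ≤ a} {a | a ≤ m ∧ m ≤ a} :=
      Set.disjoint_left.2 fun a h1 h2 => h1.2 h2.2
    have d2 : Disjoint {a | a < m} {a | a ≤ m ∧ m ≤ a} :=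
      Set.disjoint_left.2 fun a h1 h2 => (lt_iff_le_not_ge.1 h1).2 h2.2
    have s1 : ∑ᶠ a ∈ {a ∈ U | ¬ m ≤ a}, f a = 0 := by
      refine ih _ (fun a b hab ha => ⟨hU hab ha.1, fun hh => ha.2 (hh.trans hab)⟩) ?_
      have : {a ∈ U | ¬ m ≤ a}.ncard < U.ncard := Set.ncard_lt_ncard
        ⟨fun a ha => ha.1, fun hh => (hh hm.1).2 le_rfl⟩ (Set.toFinite _)
      omega
    have s2 : ∑ᶠ a ∈ {a | a < m}, f a = 0 := by
      refine ih _ (fun a b hab ha => lt_of_le_of_lt hab ha) ?_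
      have : {a | a < m}.ncard < U.ncard := Set.ncard_lt_ncard
        ⟨fun a ha => hU (le_of_lt ha) hm.1, fun hh => lt_irrefl _ (hh hm.1)⟩ (Set.toFinite _)
      omega
    have h3 := h m
    rw [e2, hsplit _ _ d2, s2, zero_add] at h3
    rw [e1, hsplit _ _ d1, s1, h3, zero_add]

lemma preorder_class {α β : Type*} [Finite α] [Finite β] [Preorder (α ⊕ β)]
    (h : ∀ b : α ⊕ β, Nat.card {a : α // Sum.inl a ≤ b} = Nat.card {a : β // Sum.inr a ≤ b})
    (a : α) : ∃ b : β, (Sum.inr b : α ⊕ β) ≤ Sum.inl a ∧ (Sum.inl a : α ⊕ β) ≤ Sum.inr b := by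
  classical
  have := Fintype.ofFinite α
  have := Fintype.ofFinite β
  let f : α ⊕ β → ℤ := Sum.elim (fun _ => 1) (fun _ => -1)
  have key : ∀ p : α ⊕ β → Prop, ∑ᶠ a ∈ {a | p a}, f a =
      Nat.card {a : α // p (Sum.inl a)} - Nat.card {a : β // p (Sum.inr a)} := by
    intro p
    rw [finsum_mem_eq_finite_toFinset_sum _ (Set.toFinite _)]
    simp only [Set.toFinite_toFinset, Set.toFinset_setOf]
    rw [Finset.sum_filter, Fintype.sum_sum_type]
    simp [f, Finset.sum_ite, Fintype.card_subtype, sub_eq_add_neg]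
  have h0 : ∀ b, ∑ᶠ a ∈ {a | a ≤ b}, f a = 0 := by
    intro b; rw [key, h]; simp
  have h1 := h0 (Sum.inl a)
  have s2 : ∑ᶠ x ∈ {x | x < (Sum.inl a : α ⊕ β)}, f x = 0 :=
    preorder_sum f h0 _ _ (fun a b hab ha => lt_of_le_of_lt hab ha) le_rfl
  have e2 : {x | x ≤ (Sum.inl a : α ⊕ β)} = {x | x < (Sum.inl a : α ⊕ β)} ∪
      {x | x ≤ (Sum.inl a : α ⊕ β) ∧ (Sum.inl a : α ⊕ β) ≤ x} := by
    ext x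
    simp only [Set.mem_setOf_eq, Set.mem_union, lt_iff_le_not_ge]
    tauto
  have d2 : Disjoint {x | x < (Sum.inl a : α ⊕ β)}
      {x | x ≤ (Sum.inl a : α ⊕ β) ∧ (Sum.inl a : α ⊕ β) ≤ x} :=
    Set.disjoint_left.2 fun a h1 h2 => (lt_iff_le_not_ge.1 h1).2 h2.2
  rw [e2, finsum_mem_union d2 (Set.toFinite _) (Set.toFinite _), s2, zero_add, key] at h1
  have hpos : 0 < Nat.card {x : α // (Sum.inl x : α ⊕ β) ≤ Sum.inl a ∧ (Sum.inl a : α ⊕ β) ≤ Sum.inl x} :=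
    Nat.card_pos_iff.2 ⟨⟨⟨a, le_rfl, le_rfl⟩⟩, inferInstance⟩
  have hpos' : 0 < Nat.card {x : β // (Sum.inr x : α ⊕ β) ≤ Sum.inl a ∧ (Sum.inl a : α ⊕ β) ≤ Sum.inr x} := by
    omega
  obtain ⟨⟨⟨b, hb⟩⟩, _⟩ := Nat.card_pos_iff.1 hpos'
  exact ⟨b, hb⟩

section
variable {E : Type*} [Category E]

/-- the number of maps from `V` that factor through `φ` -/
def rk {Y Z : E} (φ : Y ⟶ Z) (V : E) : ℕ := Nat.card (Set.range (fun u : V ⟶ Y => u ≫ φ))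

lemma rk_iso {Y Z : E} (φ : Y ⟶ Z) {V V' : E} (i : V ≅ V') : rk φ V = rk φ V' := by
  refine Nat.card_congr (Equiv.subtypeEquiv i.homFromEquiv ?_)
  intro u
  constructor
  · rintro ⟨v, rfl⟩
    exact ⟨i.inv ≫ v, by simp⟩
  · rintro ⟨v, hv⟩
    refine ⟨i.hom ≫ v, ?_⟩
    have : v ≫ φ = i.inv ≫ u := hv
    simp [this]

lemma retract_of_rk [∀ X Y : E, Finite (X ⟶ Y)] (X X' : E)
    (h : ∀ {Y Z : E} (φ : Y ⟶ Z), rk φ X = rk φ X') : ∃ (u : X' ⟶ X) (v : X ⟶ X'), v ≫ u = 𝟙 X := by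
  let src : (X ⟶ X) ⊕ (X' ⟶ X) → E := Sum.elim (fun _ => X) (fun _ => X')
  let arr : ∀ a : (X ⟶ X) ⊕ (X' ⟶ X), src a ⟶ X := fun a => match a with
    | Sum.inl u => u
    | Sum.inr u => u
  let _ : Preorder ((X ⟶ X) ⊕ (X' ⟶ X)) :=
    { le := fun a b => ∃ w : src a ⟶ src b, w ≫ arr b = arr a
      le_refl := fun a => ⟨𝟙 _, Category.id_comp _⟩
      le_trans := fun a b c ⟨w, hw⟩ ⟨w', hw'⟩ => ⟨w ≫ w', by rw [Category.assoc, hw', hw]⟩ }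
  obtain ⟨u, -, v, hv⟩ := preorder_class (α := X ⟶ X) (β := X' ⟶ X) (fun b => h (arr b)) (𝟙 X)
  exact ⟨u, v, hv⟩

lemma iso_of_rk [∀ X Y : E, Finite (X ⟶ Y)] (X X' : E)
    (h : ∀ {Y Z : E} (φ : Y ⟶ Z), rk φ X = rk φ X') : Nonempty (X ≅ X') := by
  obtain ⟨u, v, huv⟩ := retract_of_rk X X' h
  obtain ⟨u', v', huv'⟩ := retract_of_rk X' X (fun φ => (h φ).symm)
  have inj : Function.Injective (fun w : X ⟶ X => w ≫ v ≫ v') := by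
    intro a b hab
    have := congrArg (fun w => w ≫ u' ≫ u) hab
    simpa [reassoc_of% huv', huv] using this
  obtain ⟨w, hw⟩ := (Finite.injective_iff_surjective.1 inj) (𝟙 X)
  have hw' : w ≫ v ≫ v' = 𝟙 X := hw
  have h2 : u' = w ≫ v := by
    rw [← Category.comp_id (w ≫ v), ← huv']
    simp only [Category.assoc]
    rw [← Category.assoc v, ← Category.assoc w, hw', Category.id_comp]
  exact ⟨⟨u', v', by rw [h2, Category.assoc, hw'], huv'⟩⟩

end

section
variable {E : Type*} [Category E] [Preadditive E] [HasZeroObject E] [HasShift E ℤ]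
  [∀ n : ℤ, (shiftFunctor E n).Additive] [Pretriangulated E]

lemma card_range_mul {G H K : Type*} [AddGroup G] [AddGroup H] [AddGroup K] (f : G →+ H) (g : H →+ K)
    (hex : ∀ y, g y = 0 ↔ ∃ x, f x = y) : Nat.card H = Nat.card (Set.range f) * Nat.card (Set.range g) := by
  have h1 : Nat.card (Set.range f) = Nat.card g.ker := by
    refine Nat.card_congr (Equiv.setCongr ?_)
    ext y
    exact (hex y).symm
  have h2 : Nat.card (Set.range g) = Nat.card g.range := rfl
  rw [h1, h2, mul_comm, AddSubgroup.card_eq_card_quotient_mul_card_addSubgroup g.ker,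
    Nat.card_congr (QuotientAddGroup.quotientKerEquivRange g).toEquiv]

lemma homCard_rk {X Y Z : E} (f : X ⟶ Y) (g : Y ⟶ Z) (W : E) (h0 : f ≫ g = 0)
    (hex : ∀ u : W ⟶ Y, u ≫ g = 0 → ∃ v, u = v ≫ f) : homCard W Y = rk f W * rk g W := by
  refine card_range_mul (Preadditive.rightComp W f) (Preadditive.rightComp W g) ?_
  intro y
  constructor
  · intro h
    obtain ⟨v, hv⟩ := hex y h
    exact ⟨v, hv.symm⟩
  · rintro ⟨v, rfl⟩
    change (v ≫ f) ≫ g = 0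
    rw [Category.assoc, h0, comp_zero]

lemma rk_shift {Y Z : E} (φ : Y ⟶ Z) (V : E) : rk (φ⟦(1:ℤ)⟧') (V⟦(1:ℤ)⟧) = rk φ V := by
  refine (Nat.card_congr (Equiv.subtypeEquiv (Functor.FullyFaithful.ofFullyFaithful (shiftFunctor E (1:ℤ))).homEquiv ?_)).symm
  intro u
  constructor
  · rintro ⟨v, rfl⟩
    exact ⟨v⟦(1:ℤ)⟧', ((shiftFunctor E (1:ℤ)).map_comp v φ).symm⟩
  · rintro ⟨v, hv⟩
    obtain ⟨v, rfl⟩ := (shiftFunctor E (1:ℤ)).map_surjective v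
    refine ⟨v, (shiftFunctor E (1:ℤ)).map_injective ?_⟩
    rw [Functor.map_comp]
    exact hv

lemma homCard_shift (V Y : E) : homCard (V⟦(1:ℤ)⟧) (Y⟦(1:ℤ)⟧) = homCard V Y :=
  (Nat.card_congr (Functor.FullyFaithful.ofFullyFaithful (shiftFunctor E (1:ℤ))).homEquiv).symm

lemma rk_rec {Y Z : E} (φ : Y ⟶ Z) : ∃ C : E, ∀ V : E,
    homCard (V⟦(1:ℤ)⟧) C * (rk φ (V⟦(1:ℤ)⟧) * rk φ V) = homCard (V⟦(1:ℤ)⟧) Z * homCard V Y := by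
  obtain ⟨C, c, d, hT⟩ := distinguished_cocone_triangle φ
  refine ⟨C, fun V => ?_⟩
  have h1 := homCard_rk φ c (V⟦(1:ℤ)⟧) (comp_distTriang_mor_zero₁₂ _ hT)
    (fun u hu => Triangle.coyoneda_exact₂ _ hT u hu)
  have h2 := homCard_rk c d (V⟦(1:ℤ)⟧) (comp_distTriang_mor_zero₂₃ _ hT)
    (fun u hu => Triangle.coyoneda_exact₃ _ hT u hu)
  have h3 := homCard_rk d (φ⟦(1:ℤ)⟧') (V⟦(1:ℤ)⟧) (comp_distTriang_mor_zero₃₁ _ hT)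
    (fun u hu => Triangle.coyoneda_exact₁ _ hT u hu)
  rw [homCard_shift, rk_shift] at h3
  rw [h1, h2, h3]
  ring

lemma homCard_iso {X X' Y Y' : E} (i : X ≅ X') (j : Y ≅ Y') : homCard X Y = homCard X' Y' :=
  Nat.card_congr (i.homCongr j)

def Hc (X X' : E) : Prop := ∀ Z : E, homCard X Z = homCard X' Z

lemma Hc.shift {X X' : E} (h : Hc X X') : Hc (X⟦(1:ℤ)⟧) (X'⟦(1:ℤ)⟧) := by
  intro Z
  have i : (Z⟦(-1:ℤ)⟧)⟦(1:ℤ)⟧ ≅ Z := (shiftFunctorCompIsoId E (-1:ℤ) 1 (by norm_num)).app Z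
  have : ∀ W : E, homCard (W⟦(1:ℤ)⟧) Z = homCard W (Z⟦(-1:ℤ)⟧) := by
    intro W
    rw [← homCard_shift W (Z⟦(-1:ℤ)⟧)]
    exact homCard_iso (Iso.refl _) i.symm
  rw [this, this, h]

lemma rk_pos [∀ X Y : E, Finite (X ⟶ Y)] {Y Z : E} (φ : Y ⟶ Z) (V : E) : 0 < rk φ V :=
  Nat.card_pos_iff.2 ⟨⟨⟨_, 0, rfl⟩⟩, inferInstance⟩

lemma homCard_pos [∀ X Y : E, Finite (X ⟶ Y)] (Y Z : E) : 0 < homCard Y Z :=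
  Nat.card_pos_iff.2 ⟨⟨0⟩, inferInstance⟩

/-- the odd lemma -/
lemma iso_of_homCard [∀ X Y : E, Finite (X ⟶ Y)] {t : ℕ} (ht : Odd t) (X X' : E)
    (i : X⟦(t:ℤ)⟧ ≅ X) (i' : X'⟦(t:ℤ)⟧ ≅ X') (h : Hc X X') : Nonempty (X ≅ X') := by
  refine iso_of_rk X X' fun {Y Z} φ => ?_
  obtain ⟨C, hC⟩ := rk_rec φ
  have s : ∀ (W : E) (n : ℕ), W⟦((n+1:ℕ):ℤ)⟧ ≅ (W⟦(n:ℤ)⟧)⟦(1:ℤ)⟧ := fun W n =>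
    (shiftFunctorAdd' E (n:ℤ) 1 ((n+1:ℕ):ℤ) (by push_cast; rfl)).app W
  have hh : ∀ n : ℕ, Hc (X⟦(n:ℤ)⟧) (X'⟦(n:ℤ)⟧) := by
    intro n
    induction n with
    | zero =>
      intro Z
      exact ((homCard_iso ((shiftFunctorZero E ℤ).app X) (Iso.refl Z)).trans (h Z)).trans
        (homCard_iso ((shiftFunctorZero E ℤ).app X') (Iso.refl Z)).symm
    | succ n ih =>
      intro Z
      rw [homCard_iso (s X n) (Iso.refl Z), ih.shift, ← homCard_iso (s X' n) (Iso.refl Z)]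
  let a : ℕ → ℕ := fun n => rk φ (X⟦(n:ℤ)⟧)
  let b : ℕ → ℕ := fun n => rk φ (X'⟦(n:ℤ)⟧)
  have hrec : ∀ n, a (n+1) * a n = b (n+1) * b n := by
    intro n
    have h1 := hC (X⟦(n:ℤ)⟧)
    have h2 := hC (X'⟦(n:ℤ)⟧)
    rw [(hh n).shift, (hh n).shift, hh n, ← h2] at h1
    have := Nat.eq_of_mul_eq_mul_left (homCard_pos _ _) h1
    simp only [a, b]
    rw [rk_iso φ (s X n), rk_iso φ (s X' n)]
    exact this
  have hpa : ∀ n, 0 < a n := fun n => rk_pos _ _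
  have hpb : ∀ n, 0 < b n := fun n => rk_pos _ _
  have key : ∀ k, a (2*k) * b 0 = b (2*k) * a 0 := by
    intro k
    induction k with
    | zero => simp [mul_comm]
    | succ k ih =>
      have r1 := hrec (2*k)
      have r2 := hrec (2*k+1)
      have : a (2*(k+1)) * b (2*k) = b (2*(k+1)) * a (2*k) := by
        have e : 2*(k+1) = 2*k+1+1 := by ring
        rw [e]
        have p := Nat.mul_pos (hpa (2*k+1)) (hpb (2*k+1))
        refine Nat.eq_of_mul_eq_mul_left p ?_
        calc _ = (a (2*k+1+1) * a (2*k+1)) * (b (2*k+1) * b (2*k)) := by ring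
          _ = (b (2*k+1+1) * b (2*k+1)) * (a (2*k+1) * a (2*k)) := by rw [r1, r2]
          _ = _ := by ring
      refine Nat.eq_of_mul_eq_mul_left (hpb (2*k)) ?_
      calc _ = (a (2*(k+1)) * b (2*k)) * b 0 := by ring
        _ = b (2*(k+1)) * (a (2*k) * b 0) := by rw [this]; ring
        _ = _ := by rw [ih]; ring
  obtain ⟨k, rfl⟩ := ht
  have r1 := hrec (2*k)
  have z1 : a 0 = rk φ X := rk_iso φ ((shiftFunctorZero E ℤ).app X)
  have z2 : b 0 = rk φ X' := rk_iso φ ((shiftFunctorZero E ℤ).app X')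
  have z3 : a (2*k+1) = a 0 := (rk_iso φ i).trans z1.symm
  have z4 : b (2*k+1) = b 0 := (rk_iso φ i').trans z2.symm
  rw [← z1, ← z2]
  rw [z3, z4] at r1
  have h5 : a 0 * a 0 = b 0 * b 0 := by
    refine Nat.eq_of_mul_eq_mul_left (hpa (2*k)) ?_
    calc _ = (a 0 * a (2*k)) * a 0 := by ring
      _ = b 0 * (b (2*k) * a 0) := by rw [r1]; ring
      _ = _ := by rw [← key k]; ring
  exact Nat.mul_self_inj.1 h5

end
end Odd

section LES
variable [HasExt.{0} A]
open Abelian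

def pullH {a' a : A} (f : a' ⟶ a) (b : A) : Ext a b 1 →+ Ext a' b 1 :=
  AddMonoidHom.mk' (pull f) (pull_add f)
def pushH {b b' : A} (f : b ⟶ b') (a : A) : Ext a b 1 →+ Ext a b' 1 :=
  AddMonoidHom.mk' (fun e => push e f) (push_add f)
def deltaH {a b : A} (e : Ext a b 1) (z : A) : (b ⟶ z) →+ Ext a z 1 :=
  AddMonoidHom.mk' (fun f => push e f) (fun f g => push_add' f g e)
def deltaH' {a b : A} (e : Ext a b 1) (z : A) : (z ⟶ a) →+ Ext z b 1 :=
  AddMonoidHom.mk' (fun f => pull f e) (fun f g => add_pull f g e)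

lemma Ex.ex_a {a b z : A} (X : Ex a b) (e : Ext a z 1) :
    pull X.π e = 0 ↔ ∃ v, push X.cls v = e := by
  constructor
  · intro h
    obtain ⟨s, hs⟩ := Ext.contravariant_sequence_exact₃ X.se _ e h (add_zero 1)
    obtain ⟨s, rfl⟩ := (Ext.mk₀_bijective _ _).2 s
    exact ⟨s, hs⟩
  · rintro ⟨v, rfl⟩
    rw [← pull_push, X.pull_π, push_zero]

lemma Ex.ex_P {a b z : A} (X : Ex a b) (e : Ext X.P z 1) :
    pull X.j e = 0 ↔ ∃ v, pull X.π v = e := by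
  constructor
  · intro h
    obtain ⟨s, hs⟩ := Ext.contravariant_sequence_exact₂ X.se _ e h
    exact ⟨s, hs⟩
  · rintro ⟨v, rfl⟩
    rw [← pull_comp, X.w, zero_pull]

lemma Ex.ex_b' {a b z : A} (X : Ex a b) (e : Ext z b 1) :
    push e X.j = 0 ↔ ∃ v, pull v X.cls = e := by
  constructor
  · intro h
    obtain ⟨s, hs⟩ := Ext.covariant_sequence_exact₁ _ X.se e h (zero_add 1)
    obtain ⟨s, rfl⟩ := (Ext.mk₀_bijective _ _).2 s
    exact ⟨s, hs⟩
  · rintro ⟨v, rfl⟩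
    rw [pull_push, X.push_j, pull_zero]

lemma Ex.ex_P' {a b z : A} (X : Ex a b) (e : Ext z X.P 1) :
    push e X.π = 0 ↔ ∃ v, push v X.j = e := by
  constructor
  · intro h
    obtain ⟨s, hs⟩ := Ext.covariant_sequence_exact₂ _ X.se e h
    exact ⟨s, hs⟩
  · rintro ⟨v, rfl⟩
    rw [← push_comp, X.w, push_zero']

def kd {a b : A} (c : Ext a b 1) (z : A) : ℕ := Nat.card {κ : b ⟶ z // push c κ = 0}

lemma card_range_of_inj {G H : Type*} (f : G → H) (h : Function.Injective f) :
    Nat.card (Set.range f) = Nat.card G := (Nat.card_congr (Equiv.ofInjective f h)).symm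

lemma card_range_of_surj {G H : Type*} (f : G → H) (h : ∀ y, ∃ x, f x = y) :
    Nat.card (Set.range f) = Nat.card H :=
  Nat.card_congr ((Equiv.setCongr (Set.range_eq_univ.2 h)).trans (Equiv.Set.univ _))

lemma Ex.hom_j {a b z : A} (X : Ex a b) :
    Nat.card (Set.range (Preadditive.leftComp z X.j)) = kd X.cls z := by
  refine Nat.card_congr (Equiv.setCongr ?_)
  ext v
  constructor
  · rintro ⟨s, rfl⟩
    change push X.cls (X.j ≫ s) = 0
    rw [push_comp, X.push_j, push_zero]
  · exact X.exists_ext v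

lemma Ex.card_hom {a b : A} (X : Ex a b) (z : A) :
    homCard X.P z = homCard a z * kd X.cls z := by
  rw [← X.hom_j]
  have := card_range_mul (Preadditive.leftComp z X.π) (Preadditive.leftComp z X.j) (fun v => by
    constructor
    · exact X.desc' v
    · rintro ⟨s, rfl⟩
      simp [Preadditive.leftComp])
  rw [homCard, this, card_range_of_inj]
  · rfl
  · intro u v h
    exact (cancel_epi X.π).1 h

lemma kd_mul {a b : A} (c : Ext a b 1) (z : A) :
    homCard b z = kd c z * Nat.card (Set.range (deltaH c z)) := by
  have h := card_range_mul (deltaH c z).ker.subtype (deltaH c z) (fun y => by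
    constructor
    · intro h; exact ⟨⟨y, h⟩, rfl⟩
    · rintro ⟨x, rfl⟩; exact x.2)
  rw [homCard, h, card_range_of_inj (deltaH c z).ker.subtype Subtype.val_injective]
  rfl

section
variable (hered : ∀ X Y : A, Subsingleton (Abelian.Ext X Y 2))
include hered

lemma Ex.card_ext {a b : A} (X : Ex a b) (z : A) :
    ext1Card X.P z * homCard b z = ext1Card a z * ext1Card b z * kd X.cls z := by
  have h1 := card_range_mul (deltaH X.cls z) (pullH X.π z) X.ex_a
  have h2 := card_range_mul (pullH X.π z) (pullH X.j z) X.ex_P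
  rw [card_range_of_surj (pullH X.j z) (pull_surj hered X.j)] at h2
  rw [ext1Card, ext1Card, ext1Card, h1, h2, kd_mul X.cls z]
  ring

lemma Ex.euler {a b : A} (X : Ex a b) (z : A) [∀ X Y : A, Finite (X ⟶ Y)] :
    homCard X.P z * (ext1Card a z * ext1Card b z) = ext1Card X.P z * (homCard a z * homCard b z) := by
  have h1 := X.card_hom z
  have h2 := X.card_ext hered z
  calc _ = homCard a z * (ext1Card a z * ext1Card b z * kd X.cls z) := by rw [h1]; ring
    _ = _ := by rw [← h2]; ring

lemma Ex.euler' {a b : A} (X : Ex a b) (z : A) [∀ X Y : A, Finite (X ⟶ Y)] :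
    homCard z X.P * (ext1Card z a * ext1Card z b) = ext1Card z X.P * (homCard z a * homCard z b) := by
  have h1 := card_range_mul (Preadditive.rightComp z X.j) (Preadditive.rightComp z X.π) (fun v => by
    constructor
    · exact X.lift' v
    · rintro ⟨s, rfl⟩
      simp [Preadditive.rightComp])
  rw [card_range_of_inj (Preadditive.rightComp z X.j) (fun u v h => (cancel_mono X.j).1 h)] at h1
  have h2 := card_range_mul (Preadditive.rightComp z X.π) (deltaH' X.cls z) (fun v => by
    constructor
    · exact X.exists_lift v
    · rintro ⟨s, rfl⟩
      change pull (s ≫ X.π) X.cls = 0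
      rw [pull_comp, X.pull_π, pull_zero])
  have h3 := card_range_mul (deltaH' X.cls z) (pushH X.j z) X.ex_b'
  have h4 := card_range_mul (pushH X.j z) (pushH X.π z) X.ex_P'
  rw [card_range_of_surj (pushH X.π z) (push_surj hered X.π)] at h4
  simp only [homCard, ext1Card]
  rw [h1, h2, h3, h4]
  ring
end

lemma homCard_pos' [∀ X Y : A, Finite (X ⟶ Y)] (X Y : A) : 0 < homCard X Y :=
  Nat.card_pos_iff.2 ⟨⟨0⟩, inferInstance⟩
lemma ext1Card_pos [∀ X Y : A, Finite (Ext X Y 1)] (X Y : A) : 0 < ext1Card X Y :=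
  Nat.card_pos_iff.2 ⟨⟨0⟩, inferInstance⟩

end LES

section KC
variable {g x : A} (l : g ⟶ x)

@[reducible] def exKer : Ex (image l) (kernel l) where
  P := g
  j := kernel.ι l
  π := factorThruImage l
  w := by rw [← cancel_mono (image.ι l)]; simp
  se := by
    refine ShortComplex.ShortExact.mk' ?_ inferInstance inferInstance
    refine ShortComplex.exact_of_f_is_kernel _ (KernelFork.IsLimit.ofι' _ _ fun k hk =>
      ⟨kernel.lift l k (by
        have : k ≫ factorThruImage l = 0 := hk
        rw [← image.fac l, reassoc_of% this, zero_comp]), kernel.lift_ι _ _ _⟩)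

@[reducible] def exCok : Ex (cokernel l) (image l) where
  P := x
  j := image.ι l
  π := cokernel.π l
  w := by rw [← cancel_epi (factorThruImage l)]; simp
  se := by
    refine ShortComplex.ShortExact.mk' ?_ inferInstance inferInstance
    refine ShortComplex.exact_of_g_is_cokernel _ (CokernelCofork.IsColimit.ofπ' _ _ fun k hk =>
      ⟨cokernel.desc l k (by
        have : image.ι l ≫ k = 0 := hk
        rw [← image.fac l, Category.assoc, this, comp_zero]), cokernel.π_desc _ _ _⟩)

variable [HasExt.{0} A] (hered : ∀ X Y : A, Subsingleton (Abelian.Ext X Y 2))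
include hered

def Kc (z : A) : ℕ := Nat.card {e : Abelian.Ext x z 1 // pull l e = 0}

lemma pull_ex (z : A) (e : Abelian.Ext g z 1) : pull (kernel.ι l) e = 0 ↔ ∃ v, pull l v = e := by
  constructor
  · intro h
    obtain ⟨v, hv⟩ := ((exKer l).ex_P e).1 h
    obtain ⟨w, hw⟩ := pull_surj hered (image.ι l) v
    refine ⟨w, ?_⟩
    rw [← hv, ← hw, ← pull_comp, image.fac]
  · rintro ⟨v, rfl⟩
    rw [← pull_comp, kernel.condition, zero_pull]

lemma Kc_mul (z : A) : ext1Card x z * ext1Card (kernel l) z = Kc l z * ext1Card g z := by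
  have h1 := card_range_mul (pullH l z).ker.subtype (pullH l z) (fun y => by
    constructor
    · intro h; exact ⟨⟨y, h⟩, rfl⟩
    · rintro ⟨x, rfl⟩; exact x.2)
  rw [card_range_of_inj (pullH l z).ker.subtype Subtype.val_injective] at h1
  have h2 := card_range_mul (pullH l z) (pullH (kernel.ι l) z) (pull_ex l hered z)
  rw [card_range_of_surj (pullH (kernel.ι l) z) (pull_surj hered _)] at h2
  have h3 : Kc l z = Nat.card (pullH l z).ker := rfl
  rw [ext1Card, ext1Card, ext1Card, h1, h2, h3]
  ring

/-- `⟨S⟩⟨x⟩ = ⟨M⟩⟨g⟩`. -/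
lemma euler_kc (z : A) [∀ X Y : A, Finite (X ⟶ Y)] [∀ X Y : A, Finite (Abelian.Ext X Y 1)] :
    homCard (kernel l) z * homCard x z * (ext1Card (cokernel l) z * ext1Card g z) =
    ext1Card (kernel l) z * ext1Card x z * (homCard (cokernel l) z * homCard g z) := by
  have h1 := (exKer l).euler hered z
  have h2 := (exCok l).euler hered z
  have p : 0 < homCard (image l) z * ext1Card (image l) z :=
    Nat.mul_pos (homCard_pos' _ _) (ext1Card_pos _ _)
  refine Nat.eq_of_mul_eq_mul_left p ?_
  calc _ = ext1Card g z * (homCard (image l) z * homCard (kernel l) z) *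
      (homCard x z * (ext1Card (cokernel l) z * ext1Card (image l) z)) := by ring
    _ = homCard g z * (ext1Card (image l) z * ext1Card (kernel l) z) *
      (ext1Card x z * (homCard (cokernel l) z * homCard (image l) z)) := by rw [h1, h2]
    _ = _ := by ring

def wc (l : g ⟶ x) {g' x' : A} (l' : g' ⟶ x') (e : Abelian.Ext g x' 1) :
  Abelian.Ext (kernel l) (cokernel l') 1 := push (pull (kernel.ι l) e) (cokernel.π l')

/-- count of one component of the kernel of `l^*` -/
lemma card_comp {g' x' : A} (l' : g' ⟶ x') (e : Abelian.Ext g x' 1) (z : A)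
    [∀ X Y : A, Finite (X ⟶ Y)] [∀ X Y : A, Finite (Abelian.Ext X Y 1)] :
    Nat.card {p : (x' ⟶ z) × Abelian.Ext x z 1 // l' ≫ p.1 = 0 ∧ pull l p.2 + push e p.1 = 0} =
      kd (wc l l' e) z * Kc l z := by
  have hκ : ∀ κ : {κ : cokernel l' ⟶ z // push (wc l l' e) κ = 0},
      ∃ w : Abelian.Ext x z 1, pull l w + push e (cokernel.π l' ≫ κ.1) = 0 := by
    rintro ⟨κ, hκ⟩
    obtain ⟨w, hw⟩ := (pull_ex l hered z (push e (cokernel.π l' ≫ κ))).1 (by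
      rw [← pull_push, push_comp]; exact hκ)
    exact ⟨-w, by rw [pull_neg, hw]; simp⟩
  choose w hw using hκ
  rw [kd, Kc, ← Nat.card_prod]
  refine (Nat.card_congr (Equiv.ofBijective (fun q => ⟨(cokernel.π l' ≫ q.1.1, w q.1 + q.2.1),
    by simp, by
      have := hw q.1
      rw [pull_add, q.2.2, add_zero, this]⟩) ⟨?_, ?_⟩)).symm
  · rintro ⟨q1, q2⟩ ⟨r1, r2⟩ h
    simp only [Subtype.mk.injEq, Prod.mk.injEq] at h
    have h1 : q1 = r1 := Subtype.ext ((cancel_epi _).1 h.1)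
    subst h1
    simp only [add_right_inj] at h
    rw [Subtype.ext h.2]
  · rintro ⟨⟨k, ε⟩, h1, h2⟩
    have hk : cokernel.π l' ≫ cokernel.desc l' k h1 = k := cokernel.π_desc _ _ _
    let κ : {κ : cokernel l' ⟶ z // push (wc l l' e) κ = 0} := ⟨cokernel.desc l' k h1, by
      rw [wc, ← push_comp, hk, pull_push]
      refine (pull_ex l hered z _).2 ⟨-ε, ?_⟩
      rw [pull_neg]
      exact (neg_eq_of_add_eq_zero_right h2)⟩
    refine ⟨(κ, ⟨ε - w κ, ?_⟩), ?_⟩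
    · have := hw κ
      change pull l (ε - w κ) = 0
      simp only [κ, hk] at this
      have h2' : pull l ε + push e k = 0 := h2
      rw [sub_eq_add_neg, pull_add, pull_neg, eq_neg_of_add_eq_zero_left this,
        eq_neg_of_add_eq_zero_left h2']
      simp
    · apply Subtype.ext
      simp [κ]

/-- numerical identity for one component -/
lemma comp_identity {g₁ x₁ g₂ x₂ : A} (l₁ : g₁ ⟶ x₁) (l₂ : g₂ ⟶ x₂) 
    (e₀ : Abelian.Ext g₁ x 1) (e₁ : Abelian.Ext g₂ x₁ 1) (X₀ : Ex (kernel l₁) (cokernel l))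
    (X₁ : Ex (kernel l₂) (cokernel l₁)) (h₀ : X₀.cls = wc l₁ l e₀) (h₁ : X₁.cls = wc l₂ l₁ e₁) (z : A)
    [∀ X Y : A, Finite (X ⟶ Y)] [∀ X Y : A, Finite (Abelian.Ext X Y 1)] :
    (homCard X₀.P z * ext1Card X₁.P z) * (homCard x₁ z * ext1Card x₂ z) = 
    (kd (wc l₁ l e₀) z * Kc l₁ z) * (homCard g₁ z * ext1Card g₂ z) *
      (kd (wc l₂ l₁ e₁) z * Kc l₂ z) := by
  have a1 := X₀.card_hom z
  have a2 := X₁.card_ext hered z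
  have a3 := euler_kc l₁ hered z
  have a4 := Kc_mul l₁ hered z
  have a5 := Kc_mul l₂ hered z
  rw [h₀] at a1
  rw [h₁] at a2
  have p : 0 < homCard (cokernel l₁) z * ext1Card g₁ z :=
    Nat.mul_pos (homCard_pos' _ _) (ext1Card_pos _ _)
  refine Nat.eq_of_mul_eq_mul_left p ?_
  calc _ = homCard X₀.P z * ext1Card g₁ z * (ext1Card X₁.P z * homCard (cokernel l₁) z) *
      (homCard x₁ z * ext1Card x₂ z) := by ring
    _ = (homCard (kernel l₁) z * homCard x₁ z * (ext1Card (cokernel l₁) z * ext1Card g₁ z)) *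
      (ext1Card x₂ z * ext1Card (kernel l₂) z) * kd (wc l₁ l e₀) z * kd (wc l₂ l₁ e₁) z := by
        rw [a1, a2]; ring
    _ = (ext1Card x₁ z * ext1Card (kernel l₁) z) * (homCard (cokernel l₁) z * homCard g₁ z) *
      (ext1Card x₂ z * ext1Card (kernel l₂) z) * kd (wc l₁ l e₀) z * kd (wc l₂ l₁ e₁) z := by
        rw [a3]; ring
    _ = _ := by rw [a4, a5]; ring
end KC

section KerC
variable {E : Type*} [Category E] [Preadditive E] [HasZeroObject E] [HasShift E ℤ]
  [∀ n : ℤ, (shiftFunctor E n).Additive] [Pretriangulated E]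

def kerC {X Y : E} (l : X ⟶ Y) (Z : E) : ℕ := Nat.card {u : Y ⟶ Z // l ≫ u = 0}

omit [HasZeroObject E] [HasShift E ℤ] [∀ n : ℤ, (shiftFunctor E n).Additive]
  [Pretriangulated E] in
lemma kerC_iso {X Y : E} (l : X ⟶ Y) {Z Z' : E} (i : Z ≅ Z') : kerC l Z = kerC l Z' := by
  refine Nat.card_congr (Equiv.subtypeEquiv i.homToEquiv fun u => ?_)
  change _ ↔ l ≫ u ≫ i.hom = 0
  rw [← Category.assoc]
  exact ⟨fun h => by rw [h, zero_comp], fun h => (cancel_mono i.hom).1 (by rw [h, zero_comp])⟩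

omit [HasZeroObject E] [Pretriangulated E] in
lemma kerC_shift {X Y : E} (l : X ⟶ Y) (Z : E) : kerC (l⟦(1:ℤ)⟧') (Z⟦(1:ℤ)⟧) = kerC l Z := by
  refine (Nat.card_congr (Equiv.subtypeEquiv
    (Functor.FullyFaithful.ofFullyFaithful (shiftFunctor E (1:ℤ))).homEquiv fun u => ?_)).symm
  change _ ↔ l⟦(1:ℤ)⟧' ≫ u⟦(1:ℤ)⟧' = 0
  rw [← Functor.map_comp]
  exact ⟨fun h => by rw [h, Functor.map_zero], fun h =>
    (shiftFunctor E (1:ℤ)).map_injective (by rw [h, Functor.map_zero])⟩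

omit [HasZeroObject E] [HasShift E ℤ] [∀ n : ℤ, (shiftFunctor E n).Additive]
  [Pretriangulated E] in
lemma kerC_mul {X Y : E} (l : X ⟶ Y) (Z : E) :
    homCard Y Z = kerC l Z * Nat.card (Set.range (Preadditive.leftComp Z l)) := by
  have h := card_range_mul (Preadditive.leftComp Z l).ker.subtype (Preadditive.leftComp Z l) (fun y => by
    constructor
    · intro h; exact ⟨⟨y, h⟩, rfl⟩
    · rintro ⟨x, rfl⟩; exact x.2)
  rw [homCard, h, card_range_of_inj (Preadditive.leftComp Z l).ker.subtype Subtype.val_injective]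
  rfl

lemma tri_card {X Y C : E} (l : X ⟶ Y) (a : Y ⟶ C) (b : C ⟶ X⟦(1:ℤ)⟧)
    (hT : Triangle.mk l a b ∈ distTriang E) (Z : E) :
    homCard C (Z⟦(1:ℤ)⟧) * homCard Y Z = kerC l (Z⟦(1:ℤ)⟧) * homCard X Z * kerC l Z := by
  have h1 := card_range_mul (Preadditive.leftComp (Z⟦(1:ℤ)⟧) b) (Preadditive.leftComp (Z⟦(1:ℤ)⟧) a)
    (fun y => by
      constructor
      · intro h
        obtain ⟨u, hu⟩ := Triangle.yoneda_exact₃ _ hT y h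
        exact ⟨u, hu.symm⟩
      · rintro ⟨u, rfl⟩
        have := comp_distTriang_mor_zero₂₃ _ hT
        change a ≫ b = 0 at this
        change a ≫ b ≫ u = 0
        rw [← Category.assoc, this, zero_comp])
  have h2 := card_range_mul (Preadditive.leftComp (Z⟦(1:ℤ)⟧) (l⟦(1:ℤ)⟧'))
    (Preadditive.leftComp (Z⟦(1:ℤ)⟧) b)
    (fun y => by
      constructor
      · intro h
        obtain ⟨u, hu⟩ := Triangle.yoneda_exact₃ _ (rot_of_distTriang _ hT) y h
        refine ⟨-u, ?_⟩
        change l⟦(1:ℤ)⟧' ≫ (-u) = y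
        rw [hu]
        change _ = (-(l⟦(1:ℤ)⟧')) ≫ u
        exact (Preadditive.comp_neg _ _).trans (Preadditive.neg_comp _ _).symm
      · rintro ⟨u, rfl⟩
        have := comp_distTriang_mor_zero₃₁ _ hT
        change b ≫ l⟦(1:ℤ)⟧' = 0 at this
        change b ≫ l⟦(1:ℤ)⟧' ≫ u = 0
        rw [← Category.assoc, this, zero_comp])
  have h3 := kerC_mul (l⟦(1:ℤ)⟧') (Z⟦(1:ℤ)⟧)
  have h4 : Nat.card (Set.range (Preadditive.leftComp (Z⟦(1:ℤ)⟧) a)) = kerC l (Z⟦(1:ℤ)⟧) := by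
    refine Nat.card_congr (Equiv.setCongr ?_)
    ext y
    constructor
    · rintro ⟨u, rfl⟩
      have := comp_distTriang_mor_zero₁₂ _ hT
      change l ≫ a = 0 at this
      change l ≫ a ≫ u = 0
      rw [← Category.assoc, this, zero_comp]
    · intro h
      obtain ⟨u, hu⟩ := Triangle.yoneda_exact₂ _ hT y h
      exact ⟨u, hu.symm⟩
  rw [h4] at h1
  rw [kerC_shift, homCard_shift] at h3
  have h2' : homCard X Z = _ := (homCard_shift X Z).symm.trans h2
  rw [homCard, h1, h3, h2']
  ring
end KerC

section Cone
variable {t : ℕ} [NeZero t] [HasExt.{0} A]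
variable {E : Type*} [Category E] [Preadditive E] [HasZeroObject E] {L : Ct A t ⥤ E}
    [L.IsLocalization (HomologicalComplex.quasiIso A (pShape t))]
variable (hered : ∀ X Y : A, Subsingleton (Abelian.Ext X Y 2))
include hered

variable (L) in
lemma ess (Z : E) : ∃ z : ZMod t → A, Nonempty (Z ≅ L.obj (mkZero z)) := by
  have := Localization.essSurj L (HomologicalComplex.quasiIso A (pShape t))
  obtain ⟨x, V, P, u, hu⟩ := lemmaF hered (L.objPreimage Z)
  have h1 := L_inv L u hu
  have h2 := L_inv L (qs P) (qs_qis P)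
  exact ⟨x, ⟨(L.objObjPreimageIso Z).symm ≪≫ asIso (L.map u) ≪≫ (asIso (L.map (qs P))).symm⟩⟩

lemma iso_iff (f h : ZMod t → A) :
    Nonempty (L.obj (mkZero f) ≅ L.obj (mkZero h)) ↔ ∀ m, Nonempty (f m ≅ h m) := by
  constructor
  · rintro ⟨i⟩ m
    have := (isIso_iff_inv hered i.hom).1 inferInstance m
    exact ⟨asIso ((invE hered f h i.hom).1 m)⟩
  · intro H
    have i : ∀ m, f m ≅ h m := fun m => (H m).some
    obtain ⟨lam, hl⟩ := isInv_surj (L := L) (fun m => (i m).hom) (0 : ∀ m, Abelian.Ext (f (m+1)) (h m) 1)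
    have : IsIso lam := (isIso_iff_inv hered lam).2 fun m => by
      rw [invE_eq hered hl]; infer_instance
    exact ⟨asIso lam⟩

variable (L) in
lemma hom_card (g x : ZMod t → A) : homCard (L.obj (mkZero g)) (L.obj (mkZero x)) =
    ∏ m, homCard (g m) (x m) * ext1Card (g (m+1)) (x m) := by
  rw [homCard, Nat.card_congr (invE hered g x), Nat.card_prod, Nat.card_pi, Nat.card_pi,
    Finset.prod_mul_distrib]
  rfl

variable (L) in
include L in
lemma finE [∀ X Y : A, Finite (X ⟶ Y)] [∀ X Y : A, Finite (Abelian.Ext X Y 1)] (X Y : E) :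
    Finite (X ⟶ Y) := by
  obtain ⟨x, ⟨i⟩⟩ := ess L hered X
  obtain ⟨y, ⟨j⟩⟩ := ess L hered Y
  exact Finite.of_equiv _ ((i.homCongr j).trans (invE hered x y)).symm

lemma invE_zero (g x : ZMod t → A) : invE (L := L) hered g x 0 = (0, 0) := by
  have h := invE_spec (L := L) hered (0 : L.obj (mkZero g) ⟶ L.obj (mkZero x))
  have := isInv_sub h h
  rw [sub_self, sub_self, sub_self] at this
  exact invE_eq hered this

lemma kerC_card [∀ X Y : A, Finite (X ⟶ Y)] [∀ X Y : A, Finite (Abelian.Ext X Y 1)]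
    {g x : ZMod t → A} (lam : L.obj (mkZero g) ⟶ L.obj (mkZero x)) (z : ZMod t → A)
    (l : ∀ m, g m ⟶ x m) (e : ∀ m, Abelian.Ext (g (m+1)) (x m) 1)
    (hle : invE hered g x lam = (l, e)) :
    kerC lam (L.obj (mkZero z)) =
      ∏ m, (kd (wc (l (m+1)) (l m) (e m)) (z m) * Kc (l (m+1)) (z m)) := by
  have h1 : ∀ m, kd (wc (l (m+1)) (l m) (e m)) (z m) * Kc (l (m+1)) (z m) = 
    Nat.card {p : (x m ⟶ z m) × Abelian.Ext (x (m+1)) (z m) 1 // l m ≫ p.1 = 0 ∧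
      pull (l (m+1)) p.2 + push (e m) p.1 = 0} := fun m => (card_comp _ hered _ _ _).symm
  rw [Finset.prod_congr rfl (fun m _ => h1 m), ← Nat.card_pi]
  let e1 : ((∀ m, x m ⟶ z m) × (∀ m, Abelian.Ext (x (m+1)) (z m) 1)) ≃
    ∀ m, (x m ⟶ z m) × Abelian.Ext (x (m+1)) (z m) 1 :=
    { toFun := fun p m => (p.1 m, p.2 m)
      invFun := fun p => (fun m => (p m).1, fun m => (p m).2)
      left_inv := fun _ => rfl
      right_inv := fun _ => rfl }
  refine Nat.card_congr ((Equiv.subtypeEquiv ((invE hered x z).trans e1)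
    (q := fun p => ∀ m, l m ≫ (p m).1 = 0 ∧ pull (l (m+1)) (p m).2 + push (e m) (p m).1 = 0)
    fun mu => ?_).trans (Equiv.subtypePiEquivPi (p := fun m (p : (x m ⟶ z m) ×
      Abelian.Ext (x (m+1)) (z m) 1) => l m ≫ p.1 = 0 ∧ pull (l (m+1)) p.2 + push (e m) p.1 = 0)))
  have h2 := invE_comp hered lam mu
  rw [hle] at h2
  constructor
  · intro h m
    rw [h, invE_zero] at h2
    exact ⟨(congrFun (congrArg Prod.fst h2) m).symm, (congrFun (congrArg Prod.snd h2) m).symm⟩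
  · intro h
    apply (invE hered g z).injective
    rw [h2, invE_zero]
    refine Prod.ext ?_ ?_
    · funext m; exact (h m).1
    · funext m; exact (h m).2

variable [HasShift E ℤ] [∀ n : ℤ, (shiftFunctor E n).Additive] [Pretriangulated E]
variable (hshift : ∀ (f : ZMod t → A) (n : ℤ),
      Nonempty ((L.obj (mkZero f))⟦n⟧ ≅ L.obj (mkZero (fun j => f (j + n)))))
include hshift

variable (L) in
lemma periodic (X : E) : Nonempty (X⟦(t:ℤ)⟧ ≅ X) := by
  obtain ⟨x, ⟨i⟩⟩ := ess L hered X
  obtain ⟨j⟩ := hshift x t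
  have : (fun j => x (j + ((t:ℤ) : ZMod t))) = x := by funext j; simp
  rw [this] at j
  exact ⟨(shiftFunctor E (t:ℤ)).mapIso i ≪≫ j ≪≫ i.symm⟩

lemma cone_iso [∀ X Y : A, Finite (X ⟶ Y)] [∀ X Y : A, Finite (Abelian.Ext X Y 1)] (ht : Odd t)
    {g x : ZMod t → A} (lam : L.obj (mkZero g) ⟶ L.obj (mkZero x))
    (l : ∀ m, g m ⟶ x m) (e : ∀ m, Abelian.Ext (g (m+1)) (x m) 1)
    (hle : invE hered g x lam = (l, e))
    (X : ∀ m, Ex (kernel (l (m+1))) (cokernel (l m)))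
    (hX : ∀ m, (X m).cls = wc (l (m+1)) (l m) (e m))
    {C : E} (a : L.obj (mkZero x) ⟶ C) (b : C ⟶ (L.obj (mkZero g))⟦(1:ℤ)⟧)
    (hT : Triangle.mk lam a b ∈ distTriang E) :
    Nonempty (C ≅ L.obj (mkZero (fun m => (X m).P))) := by
  have := finE L hered
  obtain ⟨i⟩ := periodic L hered hshift C
  obtain ⟨i'⟩ := periodic L hered hshift (L.obj (mkZero (fun m => (X m).P)))
  refine iso_of_homCard ht _ _ i i' fun Z => ?_
  obtain ⟨z, ⟨k⟩⟩ := ess L hered Z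
  let z' : ZMod t → A := fun m => z (m-1)
  obtain ⟨q⟩ := hshift z' 1
  have hz : (fun j => z' (j + ((1:ℤ):ZMod t))) = z := by funext j; simp [z']
  rw [hz] at q
  have hq : Z ≅ (L.obj (mkZero z'))⟦(1:ℤ)⟧ := k ≪≫ q.symm
  have h1 := tri_card lam a b hT (L.obj (mkZero z'))
  rw [kerC_iso lam q, ← homCard_iso (Iso.refl C) hq, kerC_card hered lam z l e hle,
    kerC_card hered lam z' l e hle, hom_card L hered, hom_card L hered] at h1
  rw [homCard_iso (Iso.refl (L.obj (mkZero fun m => (X m).P))) k, hom_card L hered]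
  have hp : 0 < ∏ m, (homCard (x m) (z' m) * ext1Card (x (m + 1)) (z' m)) :=
    Finset.prod_pos fun m _ => Nat.mul_pos (homCard_pos' _ _) (ext1Card_pos _ _)
  refine Nat.eq_of_mul_eq_mul_right hp (h1.trans ?_)
  have sh : ∀ F : ZMod t → A → ℕ, ∏ m, F m (z' m) = ∏ m, F (m+1) (z m) := by
    intro F
    rw [← Equiv.prod_comp (Equiv.addRight (1 : ZMod t))]
    refine Finset.prod_congr rfl fun m _ => ?_
    simp [z']
  rw [sh (fun m z => homCard (g m) z * ext1Card (g (m+1)) z),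
    sh (fun m z => homCard (x m) z * ext1Card (x (m+1)) z),
    sh (fun m z => kd (wc (l (m+1)) (l m) (e m)) z * Kc (l (m+1)) z),
    ← Finset.prod_mul_distrib, ← Finset.prod_mul_distrib, ← Finset.prod_mul_distrib]
  refine Finset.prod_congr rfl fun m _ => ?_
  exact (comp_identity (l m) hered (l (m+1)) (l (m+1+1)) (e m) (e (m+1)) (X m) (X (m+1)) (hX _) (hX _)
    (z m)).symm

lemma cone_iff [∀ X Y : A, Finite (X ⟶ Y)] [∀ X Y : A, Finite (Abelian.Ext X Y 1)] (ht : Odd t)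
    {g x f : ZMod t → A} (lam : L.obj (mkZero g) ⟶ L.obj (mkZero x))
    (l : ∀ m, g m ⟶ x m) (e : ∀ m, Abelian.Ext (g (m+1)) (x m) 1)
    (hle : invE hered g x lam = (l, e)) :
    (∃ (a : L.obj (mkZero x) ⟶ L.obj (mkZero f)) (b : L.obj (mkZero f) ⟶ (L.obj (mkZero g))⟦(1:ℤ)⟧),
      Triangle.mk lam a b ∈ distTriang E) ↔
    ∀ m, ∃ X : Ex (kernel (l (m+1))) (cokernel (l m)), X.cls = wc (l (m+1)) (l m) (e m) ∧
      Nonempty (X.P ≅ f m) := by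
  constructor
  · rintro ⟨a, b, hT⟩
    choose X hX using fun m => exists_ex (wc (l (m+1)) (l m) (e m))
    have h1 := cone_iso hered hshift ht lam l e hle X hX a b hT
    intro m
    obtain ⟨i⟩ := (iso_iff hered _ _).1 h1 m
    exact ⟨X m, hX m, ⟨i.symm⟩⟩
  · intro H
    choose X hX i using H
    obtain ⟨C, a, b, hT⟩ := distinguished_cocone_triangle lam
    obtain ⟨j⟩ := cone_iso hered hshift ht lam l e hle X hX a b hT
    obtain ⟨j'⟩ := (iso_iff (L := L) hered (fun m => (X m).P) f).2 i
    refine ⟨a ≫ (j ≪≫ j').hom, (j ≪≫ j').inv ≫ b, isomorphic_distinguished _ hT _ ?_⟩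
    exact Triangle.isoMk _ _ (Iso.refl _) (Iso.refl _) (j ≪≫ j').symm
      (by change lam ≫ 𝟙 _ = 𝟙 _ ≫ lam; simp)
      (by change (a ≫ (j ≪≫ j').hom) ≫ (j ≪≫ j').inv = 𝟙 _ ≫ a
          rw [Category.assoc, Iso.hom_inv_id, Category.comp_id, Category.id_comp])
      (by change ((j ≪≫ j').inv ≫ b) ≫ (𝟙 _)⟦(1:ℤ)⟧' = (j ≪≫ j').inv ≫ b
          rw [CategoryTheory.Functor.map_id, Category.comp_id])
end Cone

section Ried
variable [HasExt.{0} A]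
open Abelian

lemma homCard_iso' {C : Type*} [Category C] {X X' Y Y' : C} (i : X ≅ X') (j : Y ≅ Y') :
    homCard X Y = homCard X' Y' := Nat.card_congr (i.homCongr j)

lemma autCard_iso {C : Type*} [Category C] {X Y : C} (i : X ≅ Y) : autCard X = autCard Y :=
  Nat.card_congr (Aut.autMulEquivOfIso i).toEquiv

def extIso {a a' b b' : A} (i : a ≅ a') (j : b ≅ b') : Ext a b 1 ≃ Ext a' b' 1 where
  toFun c := push (pull i.inv c) j.hom
  invFun c := push (pull i.hom c) j.inv
  left_inv c := by
    dsimp only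
    rw [pull_push i.hom, ← push_comp, j.hom_inv_id, push_id, ← pull_comp, i.hom_inv_id, pull_id]
  right_inv c := by
    dsimp only
    rw [pull_push i.inv, ← push_comp, j.inv_hom_id, push_id, ← pull_comp, i.inv_hom_id, pull_id]

lemma ext1Card_iso {a a' b b' : A} (i : a ≅ a') (j : b ≅ b') : ext1Card a b = ext1Card a' b' :=
  Nat.card_congr (extIso i j)

omit [HasExt.{0} A] in
lemma se_iso {b f a b' f' a' : A} {j : b ⟶ f} {π : f ⟶ a} {w : j ≫ π = 0}
    (h : (ShortComplex.mk j π w).ShortExact) (β : b ≅ b') (φ : f ≅ f') (α : a ≅ a')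
    (j' : b' ⟶ f') (π' : f' ⟶ a') (hj : j' = β.inv ≫ j ≫ φ.hom) (hπ : π' = φ.inv ≫ π ≫ α.hom) :
    ∃ w' : j' ≫ π' = 0, (ShortComplex.mk j' π' w').ShortExact := by
  have w' : j' ≫ π' = 0 := by rw [hj, hπ]; simp [reassoc_of% w]
  refine ⟨w', ?_⟩
  let I : ShortComplex.mk j π w ≅ ShortComplex.mk j' π' w' :=
    ShortComplex.isoMk β φ α (by simp [hj]) (by simp [hπ])
  exact ShortComplex.shortExact_of_iso I h

@[reducible] def Ex.trans {a a' b b' : A} (X : Ex a b) (i : a ≅ a') (j : b ≅ b') : Ex a' b' where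
  P := X.P
  j := j.inv ≫ X.j
  π := X.π ≫ i.hom
  w := by simp
  se := (se_iso X.se j (Iso.refl _) i (j.inv ≫ X.j) (X.π ≫ i.hom) (by simp) (by simp)).2

lemma Ex.trans_cls {a a' b b' : A} (X : Ex a b) (i : a ≅ a') (j : b ≅ b') :
    (X.trans i j).cls = extIso i j X.cls := by
  have := X.naturality (X.trans i j) j.hom (𝟙 _) i.hom (by simp) (by simp)
  change _ = push (pull i.inv X.cls) j.hom
  rw [pull_push, this, ← pull_comp, i.inv_hom_id, pull_id]

def Mid {a b : A} (c : Ext a b 1) (f : A) : Prop := ∃ X : Ex a b, X.cls = c ∧ Nonempty (X.P ≅ f)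

def extMid (a b f : A) : ℕ := Nat.card {c : Ext a b 1 // Mid c f}

lemma Mid.trans {a a' b b' f : A} {c : Ext a b 1} (h : Mid c f) (i : a ≅ a') (j : b ≅ b') :
    Mid (extIso i j c) f := by
  obtain ⟨X, rfl, hX⟩ := h
  exact ⟨X.trans i j, X.trans_cls i j, hX⟩

lemma extMid_iso {a a' b b' : A} (i : a ≅ a') (j : b ≅ b') (f : A) :
    extMid a b f = extMid a' b' f := by
  refine Nat.card_congr (Equiv.subtypeEquiv (extIso i j) fun c => ⟨fun h => h.trans i j, fun h => ?_⟩)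
  have h' := h.trans i.symm j.symm
  have : extIso i.symm j.symm (extIso i j c) = c := (extIso i j).left_inv c
  rwa [this] at h'

/-- `|{(j,π)}|` -/
def SE (a b f : A) : Type := {q : (b ⟶ f) × (f ⟶ a) // ∃ w : q.1 ≫ q.2 = 0,
  (ShortComplex.mk q.1 q.2 w).ShortExact}

@[reducible] def SE.ex {a b f : A} (q : SE a b f) : Ex a b := ⟨f, q.1.1, q.1.2, q.2.1, q.2.2⟩

lemma se_card (a b f : A) : Nat.card (SE a b f) = hall a b f * (autCard a * autCard b) := by
  have iU : ∀ U : {S : Subobject f // Nonempty ((S : A) ≅ b) ∧ Nonempty ((cokernel S.arrow) ≅ a)},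
    (U.1 : A) ≅ b := fun U => U.2.1.some
  have pU : ∀ U : {S : Subobject f // Nonempty ((S : A) ≅ b) ∧ Nonempty ((cokernel S.arrow) ≅ a)},
    cokernel U.1.arrow ≅ a := fun U => U.2.2.some
  rw [hall, autCard, autCard, ← Nat.card_prod, ← Nat.card_prod]
  symm
  have hse0 : ∀ U (α : a ≅ a) (β : b ≅ b), ∃ w : (β.hom ≫ (iU U).inv ≫ U.1.arrow) ≫
      (cokernel.π U.1.arrow ≫ (pU U).hom ≫ α.hom) = 0, (ShortComplex.mk _ _ w).ShortExact := by
    intro U α β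
    have h : (ShortComplex.mk U.1.arrow (cokernel.π U.1.arrow) (cokernel.condition _)).ShortExact :=
      ShortComplex.ShortExact.mk' (ShortComplex.exact_cokernel _) inferInstance inferInstance
    exact se_iso h ((iU U) ≪≫ β.symm) (Iso.refl _) (pU U ≪≫ α) _ _ (by simp) (by simp)
  refine Nat.card_congr (Equiv.ofBijective (fun p => ⟨(p.2.2.hom ≫ (iU p.1).inv ≫ p.1.1.arrow,
    cokernel.π p.1.1.arrow ≫ (pU p.1).hom ≫ p.2.1.hom), hse0 p.1 p.2.1 p.2.2⟩) ⟨?_, ?_⟩)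
  · rintro ⟨U, (α : a ≅ a), (β : b ≅ b)⟩ ⟨U', (α' : a ≅ a), (β' : b ≅ b)⟩ h
    have h1 : β.hom ≫ (iU U).inv ≫ U.1.arrow = β'.hom ≫ (iU U').inv ≫ U'.1.arrow :=
      congrArg (fun q : SE a b f => q.1.1) h
    have h2 : cokernel.π U.1.arrow ≫ (pU U).hom ≫ α.hom =
      cokernel.π U'.1.arrow ≫ (pU U').hom ≫ α'.hom := congrArg (fun q : SE a b f => q.1.2) h
    have hU : U = U' := by
      apply Subtype.ext
      have e1 : Subobject.mk (β.hom ≫ (iU U).inv ≫ U.1.arrow) = U.1 := by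
        conv_rhs => rw [← Subobject.mk_arrow U.1]
        exact Subobject.mk_eq_mk_of_comm _ _ (β ≪≫ (iU U).symm) (by simp)
      have e2 : Subobject.mk (β'.hom ≫ (iU U').inv ≫ U'.1.arrow) = U'.1 := by
        conv_rhs => rw [← Subobject.mk_arrow U'.1]
        exact Subobject.mk_eq_mk_of_comm _ _ (β' ≪≫ (iU U').symm) (by simp)
      rw [← e1, ← e2]
      congr 1
    subst hU
    have e1 : β = β' := by
      apply Iso.ext
      rw [← cancel_mono ((iU U).inv ≫ U.1.arrow)]
      exact h1
    have e2 : α = α' := by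
      apply Iso.ext
      rw [← cancel_epi (cokernel.π U.1.arrow ≫ (pU U).hom)]
      simpa using h2
    rw [e1, e2]
  · rintro ⟨⟨j, π⟩, w, hse⟩
    have w : j ≫ π = 0 := w
    have hm : Mono j := hse.mono_f
    have he : Epi π := hse.epi_g
    let i0 : ((Subobject.mk j : Subobject f) : A) ≅ b := Subobject.underlyingIso j
    have hi0 : i0.hom ≫ j = (Subobject.mk j).arrow := Subobject.underlyingIso_hom_comp_eq_mk j
    have hi0' : i0.inv ≫ (Subobject.mk j).arrow = j := by rw [← hi0]; simp
    have hz : (Subobject.mk j).arrow ≫ π = 0 := by rw [← hi0, Category.assoc, w, comp_zero]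
    obtain ⟨q, hq⟩ := (⟨f, j, π, w, hse⟩ : Ex a b).desc' (cokernel.π (Subobject.mk j).arrow) (by
      change j ≫ _ = 0
      have : i0.inv ≫ (Subobject.mk j).arrow ≫ cokernel.π (Subobject.mk j).arrow = 0 := by
        rw [cokernel.condition, comp_zero]
      rwa [reassoc_of% hi0'] at this)
    let p0 : cokernel (Subobject.mk j).arrow ≅ a :=
      ⟨cokernel.desc _ π hz, q, by
        rw [← cancel_epi (cokernel.π (Subobject.mk j).arrow), cokernel.π_desc_assoc, Category.comp_id]
        exact hq, by
        rw [← cancel_epi π]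
        erw [reassoc_of% hq]
        rw [cokernel.π_desc, Category.comp_id]⟩
    let U : {S : Subobject f // Nonempty ((S : A) ≅ b) ∧ Nonempty ((cokernel S.arrow) ≅ a)} :=
      ⟨Subobject.mk j, ⟨i0⟩, ⟨p0⟩⟩
    refine ⟨(U, (pU U).symm ≪≫ p0, i0.symm ≪≫ iU U), ?_⟩
    apply Subtype.ext
    refine Prod.ext ?_ ?_
    · change (i0.inv ≫ (iU U).hom) ≫ (iU U).inv ≫ (Subobject.mk j).arrow = j
      simp [hi0']
    · change cokernel.π (Subobject.mk j).arrow ≫ (pU U).hom ≫ ((pU U).inv ≫ p0.hom) = π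
      rw [Iso.hom_inv_id_assoc]
      exact cokernel.π_desc _ _ _

lemma riedtmann (a b f : A) :
    extMid a b f * autCard f = hall a b f * (autCard a * autCard b) * homCard a b := by
  rw [← se_card, extMid, autCard, homCard, ← Nat.card_prod, ← Nat.card_prod]
  have hc : ∀ c : {c : Ext a b 1 // Mid c f}, ∃ q : SE a b f, q.ex.cls = c.1 := by
    rintro ⟨c, X, hX, ⟨i⟩⟩
    let q : SE a b f := ⟨(X.j ≫ i.hom, i.inv ≫ X.π),
      se_iso X.se (Iso.refl _) i (Iso.refl _) _ _ (by simp) (by simp)⟩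
    refine ⟨q, ?_⟩
    have := X.naturality q.ex (𝟙 _) i.hom (𝟙 _) (by simp [q]) (by simp [q])
    rw [push_id, pull_id] at this
    exact this.symm.trans hX
  choose s hs using hc
  let k : SE a b f → {c : Ext a b 1 // Mid c f} := fun q => ⟨q.ex.cls, q.ex, rfl, ⟨Iso.refl _⟩⟩
  have hφ : ∀ q : SE a b f, ∃ φ : f ≅ f, (s (k q)).1.1 ≫ φ.hom = q.1.1 ∧
      φ.hom ≫ q.1.2 = (s (k q)).1.2 := by
    intro q
    have hcls : (s (k q)).ex.cls = q.ex.cls := hs (k q)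
    obtain ⟨φ, h1, h2⟩ := (s (k q)).ex.exists_map q.ex (𝟙 _) (𝟙 _) (by rw [push_id, pull_id, hcls])
    have : IsIso φ := by
      let Φ : ShortComplex.mk (s (k q)).ex.j (s (k q)).ex.π (s (k q)).ex.w ⟶
        ShortComplex.mk q.ex.j q.ex.π q.ex.w :=
        { τ₁ := 𝟙 _, τ₂ := φ, τ₃ := 𝟙 _, comm₁₂ := h1.symm, comm₂₃ := h2 }
      have i1 : IsIso Φ.τ₁ := inferInstanceAs (IsIso (𝟙 _))
      have i3 : IsIso Φ.τ₃ := inferInstanceAs (IsIso (𝟙 _))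
      exact ShortComplex.isIso₂_of_shortExact_of_isIso₁₃ Φ (s (k q)).ex.se q.ex.se
    exact ⟨asIso φ, h1.trans (Category.id_comp _), h2.trans (Category.comp_id _)⟩
  choose φ hφ1 hφ2 using hφ
  have hw : ∀ q : SE a b f, q.1.1 ≫ q.1.2 = 0 := fun q => q.2.1
  let u : SE a b f → (a ⟶ b) → (f ≅ f) := fun q h =>
    ⟨𝟙 _ + q.1.2 ≫ h ≫ q.1.1, 𝟙 _ - q.1.2 ≫ h ≫ q.1.1, by
      simp [Preadditive.add_comp, Preadditive.comp_sub, reassoc_of% (hw q)], by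
      simp [Preadditive.sub_comp, Preadditive.comp_add, reassoc_of% (hw q)]⟩
  have mo : ∀ q : SE a b f, Mono q.1.1 := fun q => q.ex.se.mono_f
  have ep : ∀ q : SE a b f, Epi q.1.2 := fun q => q.ex.se.epi_g
  have u1 : ∀ q h, q.1.1 ≫ (u q h).hom = q.1.1 := by
    intro q h
    simp [u, reassoc_of% (hw q)]
  have u2 : ∀ q h, (u q h).hom ≫ q.1.2 = q.1.2 := by
    intro q h
    simp [u, hw q]
  symm
  refine Nat.card_congr (Equiv.ofBijective (fun p => (k p.1, (u (s (k p.1)) p.2 ≪≫ φ p.1 : Aut f))) ⟨?_, ?_⟩)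
  · rintro ⟨q, h⟩ ⟨q', h'⟩ H
    have hk : k q = k q' := congrArg Prod.fst H
    have H' : (u (s (k q)) h).hom ≫ (φ q).hom = (u (s (k q')) h').hom ≫ (φ q').hom :=
      congrArg (fun p => Iso.hom (Prod.snd p)) H
    rw [← hk] at H'
    have hq : q = q' := by
      apply Subtype.ext
      have h1 := hφ1 q'
      have h2 := hφ2 q'
      rw [← hk] at h1 h2
      refine Prod.ext ?_ ?_
      · rw [← hφ1 q, ← h1]
        conv_lhs => rw [← u1 (s (k q)) h]
        conv_rhs => rw [← u1 (s (k q)) h']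
        rw [Category.assoc, Category.assoc, H']
      · have : Epi ((u (s (k q)) h).hom ≫ (φ q).hom) := by
          have : Epi ((u (s (k q)) h ≪≫ φ q).hom) := inferInstance
          exact this
        rw [← cancel_epi ((u (s (k q)) h).hom ≫ (φ q).hom)]
        conv_rhs => rw [H']
        rw [Category.assoc, Category.assoc, hφ2 q, h2, u2, u2]
    subst hq
    rw [cancel_mono] at H'
    simp only [u, add_right_inj] at H'
    have := mo (s (k q))
    have := ep (s (k q))
    rw [cancel_epi, cancel_mono] at H'
    rw [H']
  · rintro ⟨c, (ψ : f ≅ f)⟩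
    let q : SE a b f := ⟨((s c).1.1 ≫ ψ.hom, ψ.inv ≫ (s c).1.2),
      se_iso (s c).ex.se (Iso.refl _) ψ (Iso.refl _) _ _ (by simp) (by simp)⟩
    have hk : k q = c := by
      apply Subtype.ext
      have := (s c).ex.naturality q.ex (𝟙 _) ψ.hom (𝟙 _) (by simp [q]) (by simp [q])
      rw [push_id, pull_id] at this
      change q.ex.cls = c.1
      rw [← this, hs]
    have h1 := hφ1 q
    have h2 := hφ2 q
    rw [hk] at h1 h2
    change _ = (s c).1.1 ≫ ψ.hom at h1
    change _ ≫ ψ.inv ≫ (s c).1.2 = _ at h2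
    have k2 : (ψ.hom ≫ (φ q).inv - 𝟙 _) ≫ (s c).1.2 = 0 := by
      rw [Preadditive.sub_comp, Category.id_comp, sub_eq_zero, Category.assoc]
      rw [← h2, Iso.inv_hom_id_assoc, Iso.hom_inv_id_assoc, h2]
    have k1 : (s c).1.1 ≫ (ψ.hom ≫ (φ q).inv - 𝟙 _) = 0 := by
      rw [Preadditive.comp_sub, Category.comp_id, sub_eq_zero, ← Category.assoc, ← h1]
      simp
    obtain ⟨v, hv⟩ := (s c).ex.desc' _ k1
    have := ep (s c)
    obtain ⟨h, hh⟩ := (s c).ex.lift' v (by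
      change v ≫ (s c).1.2 = 0
      rw [← cancel_epi (s c).1.2, ← Category.assoc, comp_zero]
      exact (congrArg (· ≫ (s c).1.2) hv).trans k2)
    refine ⟨(q, h), ?_⟩
    refine Prod.ext hk (Iso.ext ?_)
    change (u (s (k q)) h).hom ≫ (φ q).hom = ψ.hom
    rw [hk]
    have : (u (s c) h).hom = ψ.hom ≫ (φ q).inv := by
      change 𝟙 _ + (s c).1.2 ≫ h ≫ (s c).1.1 = _
      have h3 : h ≫ (s c).1.1 = v := hh
      have h4 : (s c).1.2 ≫ v = ψ.hom ≫ (φ q).inv - 𝟙 _ := hv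
      rw [h3, h4]; abel
    rw [this]; simp

end Ried

section Count

lemma card_fiber_surj {G H : Type*} [AddGroup G] [AddGroup H] (φ : G →+ H)
    (hφ : Function.Surjective φ) (p : H → Prop) :
    Nat.card {e : G // p (φ e)} = Nat.card {c : H // p c} * Nat.card φ.ker := by
  rw [← Nat.card_prod]
  choose s hs using hφ
  refine Nat.card_congr
    { toFun := fun e => (⟨φ e.1, e.2⟩, ⟨e.1 - s (φ e.1), by
        rw [AddMonoidHom.mem_ker, map_sub, hs, sub_self]⟩)
      invFun := fun q => ⟨q.2.1 + s q.1.1, by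
        have : φ q.2.1 = 0 := q.2.2
        rw [map_add, this, zero_add, hs]; exact q.1.2⟩
      left_inv := fun e => by simp
      right_inv := ?_ }
  rintro ⟨⟨c, hc⟩, ⟨n, hn⟩⟩
  have hn' : φ n = 0 := hn
  simp [hn', hs]

lemma card_fiber_surj' {G H : Type*} [AddGroup G] [AddGroup H] (φ : G →+ H)
    (hφ : Function.Surjective φ) (p : H → Prop) :
    Nat.card {e : G // p (φ e)} * Nat.card H = Nat.card {c : H // p c} * Nat.card G := by
  have h1 := card_fiber_surj φ hφ p
  have h2 := card_fiber_surj φ hφ (fun _ => True)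
  rw [Nat.card_congr (Equiv.subtypeUnivEquiv (fun _ => trivial)),
    Nat.card_congr (Equiv.subtypeUnivEquiv (fun _ => trivial))] at h2
  rw [h1, h2]; ring

lemma hall_iso {a a' b b' : A} (i : a ≅ a') (j : b ≅ b') (f : A) : hall a b f = hall a' b' f := by
  refine Nat.card_congr (Equiv.subtypeEquivRight fun U => ?_)
  exact ⟨fun ⟨⟨u⟩, ⟨v⟩⟩ => ⟨⟨u ≪≫ j⟩, ⟨v ≪≫ i⟩⟩, fun ⟨⟨u⟩, ⟨v⟩⟩ => ⟨⟨u ≪≫ j.symm⟩, ⟨v ≪≫ i.symm⟩⟩⟩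

lemma Ex.subobj {a b : A} (X : Ex a b) : ∃ (i : ((Subobject.mk X.j : Subobject X.P) : A) ≅ b)
    (p : cokernel (Subobject.mk X.j).arrow ≅ a), i.hom ≫ X.j = (Subobject.mk X.j).arrow ∧
      cokernel.π (Subobject.mk X.j).arrow ≫ p.hom = X.π := by
  let i0 : ((Subobject.mk X.j : Subobject X.P) : A) ≅ b := Subobject.underlyingIso X.j
  have hi0 : i0.hom ≫ X.j = (Subobject.mk X.j).arrow := Subobject.underlyingIso_hom_comp_eq_mk X.j
  have hi0' : i0.inv ≫ (Subobject.mk X.j).arrow = X.j := by rw [← hi0]; simp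
  have hz : (Subobject.mk X.j).arrow ≫ X.π = 0 := by rw [← hi0, Category.assoc, X.w, comp_zero]
  obtain ⟨q, hq⟩ := X.desc' (cokernel.π (Subobject.mk X.j).arrow) (by
    have : i0.inv ≫ (Subobject.mk X.j).arrow ≫ cokernel.π (Subobject.mk X.j).arrow = 0 := by
      rw [cokernel.condition, comp_zero]
    rwa [reassoc_of% hi0'] at this)
  refine ⟨i0, ⟨cokernel.desc _ X.π hz, q, ?_, ?_⟩, hi0, cokernel.π_desc _ _ _⟩
  · rw [← cancel_epi (cokernel.π (Subobject.mk X.j).arrow), cokernel.π_desc_assoc, Category.comp_id]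
    exact hq
  · rw [← cancel_epi X.π, reassoc_of% hq, cokernel.π_desc, Category.comp_id]

@[reducible] def subEx {g : A} (U : Subobject g) : Ex (cokernel U.arrow) (U : A) where
  P := g
  j := U.arrow
  π := cokernel.π U.arrow
  w := cokernel.condition _
  se := ShortComplex.ShortExact.mk' (ShortComplex.exact_cokernel _) inferInstance inferInstance

lemma sub_le {g : A} {U V : Subobject g} (h : U.arrow ≫ cokernel.π V.arrow = 0) : U ≤ V := by
  obtain ⟨s, hs⟩ := (subEx V).lift' U.arrow h
  exact Subobject.le_of_comm s hs

lemma Ex.kerIso {a b : A} (X : Ex a b) : Nonempty (kernel X.π ≅ b) := by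
  obtain ⟨s, hs⟩ := X.lift' (kernel.ι X.π) (kernel.condition _)
  refine ⟨⟨s, kernel.lift _ X.j X.w, ?_, ?_⟩⟩
  · rw [← cancel_mono (kernel.ι X.π), Category.assoc, kernel.lift_ι, hs, Category.id_comp]
  · rw [← cancel_mono X.j, Category.assoc, hs, kernel.lift_ι, Category.id_comp]

lemma map_count (g x s n c : A) :
    Nat.card {l : g ⟶ x // Nonempty (cokernel l ≅ c) ∧ Nonempty (image l ≅ n) ∧
      Nonempty (kernel l ≅ s)} = hall n s g * hall c n x * autCard n := by
  symm
  have iU : ∀ U : {S : Subobject g // Nonempty ((S : A) ≅ s) ∧ Nonempty ((cokernel S.arrow) ≅ n)},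
    cokernel U.1.arrow ≅ n := fun U => U.2.2.some
  have iW : ∀ U : {S : Subobject x // Nonempty ((S : A) ≅ n) ∧ Nonempty ((cokernel S.arrow) ≅ c)},
    (U.1 : A) ≅ n := fun U => U.2.1.some
  rw [hall, hall, autCard, ← Nat.card_prod, ← Nat.card_prod]
  have key : ∀ U W (α : n ≅ n), Nonempty (cokernel
      ((cokernel.π U.1.arrow ≫ (iU U).hom ≫ α.hom ≫ (iW W).inv) ≫ W.1.arrow) ≅ c) ∧
      Nonempty (image ((cokernel.π U.1.arrow ≫ (iU U).hom ≫ α.hom ≫ (iW W).inv) ≫ W.1.arrow) ≅ n) ∧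
      Nonempty (kernel ((cokernel.π U.1.arrow ≫ (iU U).hom ≫ α.hom ≫ (iW W).inv) ≫ W.1.arrow) ≅ s) := by
    intro U W α
    refine ⟨?_, ?_, ?_⟩
    · obtain ⟨w⟩ := W.2.2
      exact ⟨cokernelEpiComp _ _ ≪≫ w⟩
    · exact ⟨(image.isoStrongEpiMono (cokernel.π U.1.arrow ≫ (iU U).hom ≫ α.hom ≫ (iW W).inv)
        W.1.arrow rfl).symm ≪≫ iW W⟩
    · obtain ⟨w⟩ := U.2.1
      obtain ⟨v⟩ := (subEx U.1).kerIso
      exact ⟨kernelCompMono _ _ ≪≫ kernelCompMono _ _ ≪≫ v ≪≫ w⟩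
  refine Nat.card_congr (Equiv.ofBijective (fun p => ⟨_, key p.1.1 p.1.2 p.2⟩) ⟨?_, ?_⟩)
  · rintro ⟨⟨U, W⟩, (α : n ≅ n)⟩ ⟨⟨U', W'⟩, (α' : n ≅ n)⟩ h
    have h : (cokernel.π U.1.arrow ≫ (iU U).hom ≫ α.hom ≫ (iW W).inv) ≫ W.1.arrow =
      (cokernel.π U'.1.arrow ≫ (iU U').hom ≫ α'.hom ≫ (iW W').inv) ≫ W'.1.arrow :=
      congrArg Subtype.val h
    have hU : ∀ (U U' W W') (α α' : n ≅ n),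
      (cokernel.π U.1.arrow ≫ (iU U).hom ≫ α.hom ≫ (iW W).inv) ≫ W.1.arrow =
      (cokernel.π U'.1.arrow ≫ (iU U').hom ≫ α'.hom ≫ (iW W').inv) ≫ W'.1.arrow → U.1 ≤ U'.1 := by
      intro U U' W W' α α' h
      apply sub_le
      rw [← cancel_mono (((iU U').hom ≫ α'.hom ≫ (iW W').inv) ≫ W'.1.arrow), zero_comp]
      have h2 : U.1.arrow ≫ (cokernel.π U.1.arrow ≫ (iU U).hom ≫ α.hom ≫ (iW W).inv) ≫ W.1.arrow
        = 0 := by simp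
      rw [h] at h2
      simpa using h2
    have hW : ∀ (U U' W W') (α α' : n ≅ n),
      (cokernel.π U.1.arrow ≫ (iU U).hom ≫ α.hom ≫ (iW W).inv) ≫ W.1.arrow =
      (cokernel.π U'.1.arrow ≫ (iU U').hom ≫ α'.hom ≫ (iW W').inv) ≫ W'.1.arrow → W.1 ≤ W'.1 := by
      intro U U' W W' α α' h
      apply sub_le
      rw [← cancel_epi (cokernel.π U.1.arrow ≫ (iU U).hom ≫ α.hom ≫ (iW W).inv), comp_zero,
        ← Category.assoc, h]
      simp
    have e1 : U = U' := Subtype.ext (le_antisymm (hU _ _ _ _ _ _ h) (hU _ _ _ _ _ _ h.symm))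
    have e2 : W = W' := Subtype.ext (le_antisymm (hW _ _ _ _ _ _ h) (hW _ _ _ _ _ _ h.symm))
    subst e1
    subst e2
    rw [cancel_mono, cancel_epi, cancel_epi, cancel_mono] at h
    have : α = α' := Iso.ext h
    rw [this]
  · rintro ⟨l, ⟨ic⟩, ⟨im⟩, ⟨ik⟩⟩
    obtain ⟨i1, p1, h1, h1'⟩ := (exKer l).subobj
    obtain ⟨i2, p2, h2, h2'⟩ := (exCok l).subobj
    let U : {S : Subobject g // Nonempty ((S : A) ≅ s) ∧ Nonempty ((cokernel S.arrow) ≅ n)} :=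
      ⟨Subobject.mk (exKer l).j, ⟨i1 ≪≫ ik⟩, ⟨p1 ≪≫ im⟩⟩
    let W : {S : Subobject x // Nonempty ((S : A) ≅ n) ∧ Nonempty ((cokernel S.arrow) ≅ c)} :=
      ⟨Subobject.mk (exCok l).j, ⟨i2 ≪≫ im⟩, ⟨p2 ≪≫ ic⟩⟩
    refine ⟨((U, W), ((iU U).symm ≪≫ p1 ≪≫ i2.symm ≪≫ iW W : n ≅ n)), ?_⟩
    apply Subtype.ext
    change (cokernel.π (Subobject.mk (exKer l).j).arrow ≫ (iU U).hom ≫ ((iU U).inv ≫ p1.hom ≫ i2.inv ≫ (iW W).hom)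
      ≫ (iW W).inv) ≫ (Subobject.mk (exCok l).j).arrow = l
    rw [← h2]
    simp only [Category.assoc, Iso.hom_inv_id_assoc, Iso.inv_hom_id_assoc]
    rw [reassoc_of% h1']
    exact image.fac l

end Count

section Good
variable [HasExt.{0} A] (hered : ∀ X Y : A, Subsingleton (Abelian.Ext X Y 2))
include hered

def gd (K C f g' x : A) : ℝ :=
  hall K C f * (autCard K * autCard C) * eulerR K C * ext1Card g' x / autCard f

omit hered in
lemma eulerR_iso {a a' b b' : A} (i : a ≅ a') (j : b ≅ b') : eulerR a b = eulerR a' b' := by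
  rw [eulerR, eulerR, homCard_iso' i j, ext1Card_iso i j]

omit hered in
lemma gd_iso {K K' C C' : A} (i : K ≅ K') (j : C ≅ C') (f g' x : A) :
    gd K C f g' x = gd K' C' f g' x := by
  rw [gd, gd, hall_iso i j, autCard_iso i, autCard_iso j, eulerR_iso i j]

omit [Abelian A] [HasExt.{0} A] hered in
lemma autCard_pos [∀ X Y : A, Finite (X ⟶ Y)] (X : A) : 0 < autCard X := by
  have : Finite (Aut X) := Finite.of_injective (fun i : X ≅ X => i.hom) fun i j h => Iso.ext h
  have : Nonempty (Aut X) := ⟨Iso.refl X⟩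
  exact Nat.card_pos

lemma good_count [∀ X Y : A, Finite (X ⟶ Y)] [∀ X Y : A, Finite (Abelian.Ext X Y 1)]
    {g x g' x' : A} (l : g ⟶ x) (l' : g' ⟶ x') (f : A) :
    (Nat.card {e : Abelian.Ext g x' 1 // Mid (wc l l' e) f} : ℝ) =
      gd (kernel l) (cokernel l') f g x' := by
  let φ : Abelian.Ext g x' 1 →+ Abelian.Ext (kernel l) (cokernel l') 1 :=
    (pushH (cokernel.π l') _).comp (pullH (kernel.ι l) _)
  have hφ : Function.Surjective φ := by
    intro c
    obtain ⟨c', hc'⟩ := push_surj hered (cokernel.π l') c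
    obtain ⟨e, he⟩ := pull_surj hered (kernel.ι l) c'
    refine ⟨e, ?_⟩
    change push (pull (kernel.ι l) e) (cokernel.π l') = c
    rw [he, hc']
  have h1 : Nat.card {e : Abelian.Ext g x' 1 // Mid (wc l l' e) f} *
    ext1Card (kernel l) (cokernel l') = extMid (kernel l) (cokernel l') f * ext1Card g x' :=
    card_fiber_surj' φ hφ (fun c => Mid c f)
  have h2 := riedtmann (kernel l) (cokernel l') f
  have h3 : (ext1Card (kernel l) (cokernel l') : ℝ) ≠ 0 := Nat.cast_ne_zero.2 (ext1Card_pos _ _).ne'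
  have h4 : (autCard f : ℝ) ≠ 0 := Nat.cast_ne_zero.2 (autCard_pos _).ne'
  have h1' := congrArg (Nat.cast : ℕ → ℝ) h1
  have h2' := congrArg (Nat.cast : ℕ → ℝ) h2
  push_cast at h1' h2'
  rw [gd, eulerR]
  field_simp
  linear_combination (autCard f : ℝ) * h1' + ext1Card g x' * h2'

end Good

section Sums
open scoped Classical in
lemma sum_fiber {Λ α : Type*} [Fintype Λ] (M : Λ → α) (G : Λ → ℝ) :
    ∑ l, G l = ∑ᶠ a, ∑ l, if M l = a then G l else 0 := by
  rw [finsum_sum_comm]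
  · refine Finset.sum_congr rfl fun l _ => ?_
    rw [finsum_eq_single _ (M l)]
    · simp
    · intro a ha; rw [if_neg (Ne.symm ha)]
  · intro l _
    refine (Set.finite_singleton (M l)).subset fun a ha => ?_
    by_contra h
    exact ha (if_neg (Ne.symm h))

lemma sum_fiber3 {Λ α β γ : Type*} [Fintype Λ] (M : Λ → α) (N : Λ → β) (S : Λ → γ)
    (F : α → β → γ → ℝ) : ∑ l, F (M l) (N l) (S l) =
      ∑ᶠ a, ∑ᶠ b, ∑ᶠ c, (Nat.card {l // M l = a ∧ N l = b ∧ S l = c} : ℝ) * F a b c := by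
  classical
  rw [sum_fiber M]
  refine finsum_congr fun a => ?_
  rw [sum_fiber N]
  refine finsum_congr fun b => ?_
  rw [sum_fiber S]
  refine finsum_congr fun c => ?_
  rw [Nat.card_eq_fintype_card, Fintype.card_subtype, ← nsmul_eq_mul, ← Finset.sum_const,
    Finset.sum_filter]
  refine Finset.sum_congr rfl fun l _ => ?_
  split_ifs <;> simp_all

lemma card_sigma_pi {Λ ι : Type*} [Finite Λ] [Fintype ι] {β : ι → Type*} [∀ i, Finite (β i)] (P : Λ → ∀ i, β i → Prop) :
    Nat.card {q : Λ × (∀ i, β i) // ∀ i, P q.1 i (q.2 i)} =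
      letI := Fintype.ofFinite Λ
      ∑ l, ∏ i, Nat.card {e : β i // P l i e} := by
  letI := Fintype.ofFinite Λ
  have e : {q : Λ × (∀ i, β i) // ∀ i, P q.1 i (q.2 i)} ≃ Σ l, ∀ i, {e : β i // P l i e} :=
    { toFun := fun q => ⟨q.1.1, fun i => ⟨q.1.2 i, q.2 i⟩⟩
      invFun := fun s => ⟨(s.1, fun i => (s.2 i).1), fun i => (s.2 i).2⟩
      left_inv := fun _ => rfl
      right_inv := fun _ => rfl }
  rw [Nat.card_congr e, Nat.card_sigma]
  simp_rw [Nat.card_pi]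

lemma cl_eq {C : Type*} [Category C] (X : C) (s : IsoCl C) : cl X = s ↔ Nonempty (X ≅ s.out) := by
  constructor
  · rintro rfl
    obtain ⟨i⟩ := Quotient.mk_out (s := isIsomorphicSetoid C) X
    exact ⟨i.symm⟩
  · rintro ⟨i⟩
    have : cl s.out = s := Quotient.out_eq s
    rw [← this]
    exact Quotient.sound ⟨i⟩

def autEquiv {C : Type*} [Category C] (X : C) : Aut X ≃ {u : X ⟶ X // IsIso u} where
  toFun i := ⟨Iso.hom i, Iso.isIso_hom i⟩
  invFun u := @asIso _ _ _ _ u.1 u.2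
  left_inv _ := Iso.ext rfl
  right_inv _ := rfl

end Sums

section Cone
variable {E : Type*} [Category E] [Preadditive E] [HasZeroObject E] [HasShift E ℤ]
  [∀ n : ℤ, (shiftFunctor E n).Additive] [Pretriangulated E]
variable [HasExt.{0} A] {t : ℕ} [NeZero t] (L : Ct A t ⥤ E)
  [L.IsLocalization (HomologicalComplex.quasiIso A (pShape t))]
variable (hered : ∀ X Y : A, Subsingleton (Abelian.Ext X Y 2))
include hered

lemma cone_count (hshift : ∀ (f : ZMod t → A) (n : ℤ),
      Nonempty ((L.obj (mkZero f))⟦n⟧ ≅ L.obj (mkZero (fun j => f (j + n)))))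
    [∀ X Y : A, Finite (X ⟶ Y)] [∀ X Y : A, Finite (Abelian.Ext X Y 1)] (ht : Odd t)
    (g x f : ZMod t → A) :
    (coneHomCard (L.obj (mkZero g)) (L.obj (mkZero x)) (L.obj (mkZero f)) : ℝ) =
      ∑ᶠ M : ZMod t → IsoCl A, ∑ᶠ N : ZMod t → IsoCl A, ∑ᶠ S : ZMod t → IsoCl A,
      (∏ m, ((hall (N m).out (S m).out (g m) : ℝ) * hall (M m).out (N m).out (x m) *
        autCard (N m).out)) *
      ∏ m, gd (S (m+1)).out (M m).out (f m) (g (m+1)) (x m) := by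
  have h1 : coneHomCard (L.obj (mkZero g)) (L.obj (mkZero x)) (L.obj (mkZero f)) =
    Nat.card {q : (∀ m, g m ⟶ x m) × (∀ m, Abelian.Ext (g (m+1)) (x m) 1) //
      ∀ m, Mid (wc (q.1 (m+1)) (q.1 m) (q.2 m)) (f m)} := by
    refine Nat.card_congr (Equiv.subtypeEquiv (invE hered g x) fun lam => ?_)
    exact cone_iff hered hshift ht lam _ _ rfl
  rw [h1, card_sigma_pi (fun (l : ∀ m, g m ⟶ x m) m (e : Abelian.Ext (g (m+1)) (x m) 1) =>
    Mid (wc (l (m+1)) (l m) e) (f m))]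
  push_cast
  letI := Fintype.ofFinite (∀ m, g m ⟶ x m)
  have h2 : ∀ l : ∀ m, g m ⟶ x m, ∏ m, (Nat.card {e : Abelian.Ext (g (m+1)) (x m) 1 //
      Mid (wc (l (m+1)) (l m) e) (f m)} : ℝ) =
      ∏ m, gd (cl (kernel (l (m+1)))).out (cl (cokernel (l m))).out (f m) (g (m+1)) (x m) := by
    intro l
    refine Finset.prod_congr rfl fun m _ => ?_
    rw [good_count hered]
    exact gd_iso ((cl_eq _ _).1 rfl).some ((cl_eq _ _).1 rfl).some _ _ _
  rw [Finset.sum_congr rfl fun l _ => h2 l]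
  have h3 := sum_fiber3 (fun (l : ∀ m, g m ⟶ x m) m => cl (cokernel (l m)))
    (fun l m => cl (image (l m))) (fun l m => cl (kernel (l m)))
    (fun M N S => ∏ m, gd (S (m+1)).out (M m).out (f m) (g (m+1)) (x m))
  refine h3.trans ?_
  refine finsum_congr fun M => finsum_congr fun N => finsum_congr fun S => ?_
  congr 1
  have h4 : Nat.card {l : ∀ m, g m ⟶ x m // (fun m => cl (cokernel (l m))) = M ∧
      (fun m => cl (image (l m))) = N ∧ (fun m => cl (kernel (l m))) = S} =
      ∏ m, Nat.card {l : g m ⟶ x m // Nonempty (cokernel l ≅ (M m).out) ∧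
        Nonempty (image l ≅ (N m).out) ∧ Nonempty (kernel l ≅ (S m).out)} := by
    rw [← Nat.card_pi]
    refine Nat.card_congr
      { toFun := fun l m => ⟨l.1 m, (cl_eq _ _).1 (congrFun l.2.1 m),
          (cl_eq _ _).1 (congrFun l.2.2.1 m), (cl_eq _ _).1 (congrFun l.2.2.2 m)⟩
        invFun := fun l => ⟨fun m => (l m).1, funext fun m => (cl_eq _ _).2 (l m).2.1,
          funext fun m => (cl_eq _ _).2 (l m).2.2.1, funext fun m => (cl_eq _ _).2 (l m).2.2.2⟩
        left_inv := fun _ => rfl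
        right_inv := fun _ => rfl }
  rw [h4, Nat.cast_prod]
  refine Finset.prod_congr rfl fun m _ => ?_
  rw [map_count]; push_cast; rfl

omit [HasShift E ℤ]  [∀ n : ℤ, (shiftFunctor E n).Additive] [Pretriangulated E] in
lemma aut_count (x : ZMod t → A) : autCard (L.obj (mkZero x)) =
    (∏ m, autCard (x m)) * ∏ m, ext1Card (x (m+1)) (x m) := by
  have e2 : Nat.card (Aut (L.obj (mkZero x))) = Nat.card {q : (∀ m, x m ⟶ x m) ×
      (∀ m, Abelian.Ext (x (m+1)) (x m) 1) // ∀ m, IsIso (q.1 m)} :=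
    Nat.card_congr ((autEquiv _).trans (Equiv.subtypeEquiv (invE hered x x)
      fun lam => isIso_iff_inv hered lam))
  have e3 : {q : (∀ m, x m ⟶ x m) ×
      (∀ m, Abelian.Ext (x (m+1)) (x m) 1) // ∀ m, IsIso (q.1 m)} ≃
      (∀ m, {u : x m ⟶ x m // IsIso u}) × (∀ m, Abelian.Ext (x (m+1)) (x m) 1) :=
    { toFun := fun q => (fun m => ⟨q.1.1 m, q.2 m⟩, q.1.2)
      invFun := fun q => ⟨(fun m => (q.1 m).1, q.2), fun m => (q.1 m).2⟩
      left_inv := fun _ => rfl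
      right_inv := fun _ => rfl }
  rw [autCard, e2, Nat.card_congr e3, Nat.card_prod, Nat.card_pi, Nat.card_pi]
  congr 1
  refine Finset.prod_congr rfl fun m _ => ?_
  exact (Nat.card_congr (autEquiv _)).symm

end Cone

section Arith

lemma alt_sum (a : ℕ → ℝ) (n : ℕ) : ∑ i ∈ Finset.Icc 1 n, (-1 : ℝ) ^ i * (a i + a (i+1)) =
    - a 1 + (-1 : ℝ) ^ n * a (n+1) := by
  induction n with
  | zero => simp
  | succ n ih => rw [Finset.sum_Icc_succ_top (by omega), ih, pow_succ]; ring

lemma exp_zpow (x : ℝ) (z : ℤ) : Real.exp x ^ z = Real.exp (z * x) := by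
  rw [← Real.rpow_intCast, ← Real.exp_mul, mul_comm]

variable [HasExt.{0} A] 

def ep (a b : A) : ℝ := Real.log (eulerR a b)

def et (a b : A) : ℝ := Real.log (ext1Card a b)

variable {t : ℕ} [NeZero t]

def cc (X Y : ZMod t → A) (i : ℕ) : ℝ := ∑ j, ep (X (j + i)) (Y j)
def ee (X Y : ZMod t → A) : ℝ := ∑ i ∈ Finset.Icc 1 t, (-1 : ℝ) ^ i * cc X Y i
def nn (X Y : ZMod t → A) : ℝ := ∑ j, et (X (j + 1)) (Y j)

lemma cc_t (X Y : ZMod t → A) (i : ℕ) : cc X Y (t + i) = cc X Y i := by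
  simp [cc]

lemma ee_shift_left (ht : Odd t) (X Y : ZMod t → A) :
    ee (fun j => X (j+1)) Y = - ee X Y - 2 * cc X Y 1 := by
  have h : ∀ i, cc (fun j => X (j+1)) Y i = cc X Y (i+1) := by
    intro i
    refine Finset.sum_congr rfl fun j _ => ?_
    push_cast
    rw [add_assoc]
  have := alt_sum (cc X Y) t
  rw [ht.neg_one_pow, cc_t] at this
  simp_rw [ee, h]
  simp_rw [mul_add] at this
  rw [Finset.sum_add_distrib] at this
  linarith

lemma ee_shift_right (ht : Odd t) (X Y : ZMod t → A) :
    ee Y (fun j => X (j+1)) = - ee Y X - 2 * cc Y X 0 := by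
  have h : ∀ i, cc Y (fun j => X (j+1)) (i+1) = cc Y X i := by
    intro i
    refine Fintype.sum_equiv (Equiv.addRight 1) _ _ fun j => ?_
    simp only [Equiv.coe_addRight]
    push_cast
    rw [add_assoc, add_comm (i : ZMod t)]
  have := alt_sum (cc Y (fun j => X (j+1))) t
  have h0 := cc_t Y X 0
  have h1 := h 0
  rw [ht.neg_one_pow] at this
  simp_rw [h] at this
  rw [zero_add] at h1
  rw [add_zero] at h0
  simp_rw [mul_add] at this
  rw [Finset.sum_add_distrib, h0] at this
  rw [ee, ee]
  linarith

lemma cc_add_left {X Y Z W : ZMod t → A} (h : ∀ j z, ep (X j) z = ep (Y j) z + ep (Z j) z) (i : ℕ) :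
    cc X W i = cc Y W i + cc Z W i := by
  rw [cc, cc, cc, ← Finset.sum_add_distrib]
  exact Finset.sum_congr rfl fun j _ => h _ _

lemma cc_add_right {X Y Z W : ZMod t → A} (h : ∀ j z, ep z (X j) = ep z (Y j) + ep z (Z j)) (i : ℕ) :
    cc W X i = cc W Y i + cc W Z i := by
  rw [cc, cc, cc, ← Finset.sum_add_distrib]
  exact Finset.sum_congr rfl fun j _ => h _ _

lemma ee_add_left {X Y Z W : ZMod t → A} (h : ∀ j z, ep (X j) z = ep (Y j) z + ep (Z j) z) :
    ee X W = ee Y W + ee Z W := by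
  rw [ee, ee, ee, ← Finset.sum_add_distrib]
  refine Finset.sum_congr rfl fun j _ => ?_
  rw [cc_add_left h]; ring

lemma ee_add_right {X Y Z W : ZMod t → A} (h : ∀ j z, ep z (X j) = ep z (Y j) + ep z (Z j)) :
    ee W X = ee W Y + ee W Z := by
  rw [ee, ee, ee, ← Finset.sum_add_distrib]
  refine Finset.sum_congr rfl fun j _ => ?_
  rw [cc_add_right h]; ring

lemma ee_identity (ht : Odd t) {f g x M N S : ZMod t → A}
    (gl : ∀ j z, ep (g j) z = ep (N j) z + ep (S j) z)
    (gr : ∀ j z, ep z (g j) = ep z (N j) + ep z (S j))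
    (xl : ∀ j z, ep (x j) z = ep (M j) z + ep (N j) z)
    (xr : ∀ j z, ep z (x j) = ep z (M j) + ep z (N j))
    (fl : ∀ j z, ep (f j) z = ep (S (j+1)) z + ep (M j) z)
    (fr : ∀ j z, ep z (f j) = ep z (S (j+1)) + ep z (M j)) :
    cc S M 1 + ee g x / 2 = - cc f S 0 - cc S N 1 - ee f g / 2 + ee x x / 2 - ee f f / 2 := by
  have h1 : ee g x = ee N M + ee N N + (ee S M + ee S N) := by
    rw [ee_add_left gl, ee_add_right xr, ee_add_right xr]
  have h2 : ee x x = ee M M + ee M N + (ee N M + ee N N) := by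
    rw [ee_add_left xl, ee_add_right xr, ee_add_right xr]
  have h3 : ee f f = - ee f S - 2 * cc f S 0 + ee f M := by
    rw [ee_add_right (Y := fun j => S (j+1)) (W := f) fr, ee_shift_right ht]
  have h4 : ee f g = ee f N + ee f S := ee_add_right gr
  have h5 : ∀ W, ee f W = - ee S W - 2 * cc S W 1 + ee M W := fun W => by
    rw [ee_add_left (Y := fun j => S (j+1)) (W := W) fl, ee_shift_left ht]
  rw [h1, h2, h3, h4, h5 M, h5 N]
  ring

section Fin
variable [∀ X Y : A, Finite (X ⟶ Y)] [∀ X Y : A, Finite (Abelian.Ext X Y 1)]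

omit [NeZero t] in
lemma eulerR_pos (a b : A) : 0 < eulerR a b :=
  div_pos (Nat.cast_pos.2 (homCard_pos' _ _)) (Nat.cast_pos.2 (ext1Card_pos _ _))

lemma exp_ep (a b : A) : Real.exp (ep a b) = eulerR a b := Real.exp_log (eulerR_pos a b)

lemma exp_et (a b : A) : Real.exp (et a b) = ext1Card a b :=
  Real.exp_log (Nat.cast_pos.2 (ext1Card_pos _ _))

lemma homCard_exp (a b : A) : (homCard a b : ℝ) = Real.exp (ep a b + et a b) := by
  have : (ext1Card a b : ℝ) ≠ 0 := Nat.cast_ne_zero.2 (ext1Card_pos _ _).ne'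
  rw [Real.exp_add, exp_ep, exp_et, eulerR]
  field_simp

lemma Ex.ep_left (hered : ∀ X Y : A, Subsingleton (Abelian.Ext X Y 2)) {a b : A} (X : Ex a b) (z : A) :
    ep X.P z = ep a z + ep b z := by
  have h := congrArg (Nat.cast : ℕ → ℝ) (X.euler hered z)
  push_cast at h
  rw [homCard_exp, homCard_exp, homCard_exp, ← exp_et, ← exp_et, ← exp_et, ← Real.exp_add,
    ← Real.exp_add, ← Real.exp_add, ← Real.exp_add] at h
  have := Real.exp_injective h
  linarith

lemma Ex.ep_right (hered : ∀ X Y : A, Subsingleton (Abelian.Ext X Y 2)) {a b : A} (X : Ex a b) (z : A) :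
    ep z X.P = ep z a + ep z b := by
  have h := congrArg (Nat.cast : ℕ → ℝ) (X.euler' hered z)
  push_cast at h
  rw [homCard_exp, homCard_exp, homCard_exp, ← exp_et, ← exp_et, ← exp_et, ← Real.exp_add,
    ← Real.exp_add, ← Real.exp_add, ← Real.exp_add] at h
  have := Real.exp_injective h
  linarith

lemma hall_ep (hered : ∀ X Y : A, Subsingleton (Abelian.Ext X Y 2)) {a b c : A} (h : hall a b c ≠ 0) :
    (∀ z, ep c z = ep a z + ep b z) ∧ (∀ z, ep z c = ep z a + ep z b) := by
  obtain ⟨⟨U, ⟨i⟩, ⟨j⟩⟩⟩ := (Nat.card_ne_zero.1 h).1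
  constructor
  · intro z
    rw [(subEx U).ep_left hered z, ep, ep, eulerR_iso j (Iso.refl z), eulerR_iso i (Iso.refl z)]
    rfl
  · intro z
    rw [(subEx U).ep_right hered z, ep, ep, eulerR_iso (Iso.refl z) j, eulerR_iso (Iso.refl z) i]
    rfl

variable {E : Type*} [Category E] [Preadditive E] [HasZeroObject E] [HasShift E ℤ]
  [∀ n : ℤ, (shiftFunctor E n).Additive] [Pretriangulated E] (L : Ct A t ⥤ E)
  [L.IsLocalization (HomologicalComplex.quasiIso A (pShape t))]
  (hered : ∀ X Y : A, Subsingleton (Abelian.Ext X Y 2))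
  (hshift : ∀ (f : ZMod t → A) (n : ℤ),
      Nonempty ((L.obj (mkZero f))⟦n⟧ ≅ L.obj (mkZero (fun j => f (j + n)))))
include hered hshift

lemma hom_shift_exp (X Y : ZMod t → A) (i : ℕ) :
    (Nat.card ((L.obj (mkZero X))⟦(i : ℤ)⟧ ⟶ L.obj (mkZero Y)) : ℝ) =
      Real.exp (cc X Y i + ((∑ j, et (X (j + i)) (Y j)) + ∑ j, et (X (j + (i + 1 : ℕ))) (Y j))) := by
  obtain ⟨s⟩ := hshift X i
  have h := (homCard_iso' s (Iso.refl (L.obj (mkZero Y)))).trans (hom_card L hered _ Y)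
  rw [homCard] at h
  rw [h, cc, ← Finset.sum_add_distrib, ← Finset.sum_add_distrib, Real.exp_sum]
  push_cast
  refine Finset.prod_congr rfl fun j _ => ?_
  rw [homCard_exp, ← exp_et, ← Real.exp_add]
  have : j + 1 + (i : ZMod t) = j + (i + 1) := by ring
  rw [this]
  congr 1; ring

lemma Hprod (ht : Odd t) (X Y : ZMod t → A) : ∏ i ∈ Finset.Icc 1 t,
      (Nat.card ((L.obj (mkZero X))⟦(i : ℤ)⟧ ⟶ L.obj (mkZero Y)) : ℝ) ^ ((-1 : ℤ) ^ i) =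
      Real.exp (ee X Y - 2 * nn X Y) := by
  simp_rw [hom_shift_exp L hered hshift, exp_zpow]
  rw [← Real.exp_sum]
  congr 1
  push_cast
  simp_rw [mul_add ((-1 : ℝ) ^ _) (cc X Y _)]
  rw [Finset.sum_add_distrib, ← ee]
  have := alt_sum (fun i => ∑ j, et (X (j + (i : ZMod t))) (Y j)) t
  push_cast at this
  rw [this, ht.neg_one_pow, nn]
  simp
  ring

lemma aprime_eq (ht : Odd t) (X : ZMod t → A) :
    aprime L X = (∏ m, (autCard (X m) : ℝ)) * Real.exp (ee X X / 2) := by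
  rw [aprime, Hprod L hered hshift ht, aut_count L hered]
  push_cast
  simp_rw [← exp_et]
  rw [← Real.exp_sum, ← nn, ← Real.exp_half, mul_assoc, ← Real.exp_add]
  congr 2; ring

lemma Fodd_eq (ht : Odd t) (f g x : ZMod t → A) :
    Fodd t (L.obj (mkZero f)) (L.obj (mkZero g)) (L.obj (mkZero x)) =
      (coneHomCard (L.obj (mkZero g)) (L.obj (mkZero x)) (L.obj (mkZero f)) : ℝ) *
      ((∏ m, (autCard (g m) : ℝ))⁻¹ * Real.exp (ee g x / 2 - ee g g / 2 - nn g x)) := by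
  rw [Fodd, aut_count L hered]
  simp_rw [div_zpow]
  rw [Finset.prod_div_distrib, Hprod L hered hshift ht, Hprod L hered hshift ht, ← Real.exp_sub,
    ← Real.exp_half]
  push_cast
  simp_rw [← exp_et]
  rw [← Real.exp_sum, ← nn, div_eq_mul_inv, mul_inv, ← Real.exp_neg, mul_assoc, mul_assoc,
    ← Real.exp_add]
  congr 3; ring

omit hered hshift in
lemma sqrt_prod (ht : Odd t) (f g : ZMod t → A) : ∏ i : ZMod t, Real.sqrt (eulerR (f i) (g i) *
                  ∏ j ∈ Finset.Icc 1 (t - 1),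
                    (eulerR (f (i + (j : ZMod t))) (g i)) ^ ((-1 : ℤ) ^ (j + 1))) =
    Real.exp (- ee f g / 2) := by
  simp_rw [← exp_ep, exp_zpow, ← Real.exp_sum, ← Real.exp_add, ← Real.exp_half]
  rw [← Real.exp_sum]
  congr 1
  rw [← Finset.sum_div]
  congr 1
  rw [Finset.sum_add_distrib, Finset.sum_comm, ee]
  obtain ⟨s, rfl⟩ : ∃ s, t = s + 1 := ⟨t - 1, by have := NeZero.ne t; omega⟩
  rw [Finset.sum_Icc_succ_top (by omega), ht.neg_one_pow]
  have h0 := cc_t f g 0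
  rw [add_zero] at h0
  rw [h0, cc]
  simp only [Nat.cast_zero, add_zero, Nat.add_sub_cancel]
  rw [neg_add, add_comm, ← Finset.sum_neg_distrib]
  congr 1
  · refine Finset.sum_congr rfl fun i _ => ?_
    rw [cc, ← Finset.mul_sum]
    push_cast
    rw [pow_succ]; ring
  · ring

end Fin
end Arith

section FIso
variable {E : Type*} [Category E] [Preadditive E] [HasZeroObject E] [HasShift E ℤ]
  [∀ n : ℤ, (shiftFunctor E n).Additive] [Pretriangulated E]

lemma coneHomCard_iso {Y Y' Z Z' X X' : E} (iY : Y ≅ Y') (iZ : Z ≅ Z') (iX : X ≅ X') :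
    coneHomCard Y Z X = coneHomCard Y' Z' X' := by
  have key : ∀ {Y Y' Z Z' X X' : E} (iY : Y ≅ Y') (iZ : Z ≅ Z') (_ : X ≅ X') (l : Y ⟶ Z),
      (∃ (g : Z ⟶ X) (h : X ⟶ Y⟦(1 : ℤ)⟧), Triangle.mk l g h ∈ distinguishedTriangles (C := E)) →
      ∃ (g : Z' ⟶ X') (h : X' ⟶ Y'⟦(1 : ℤ)⟧), Triangle.mk (iY.inv ≫ l ≫ iZ.hom) g h ∈
        distinguishedTriangles (C := E) := by
    rintro Y Y' Z Z' X X' iY iZ iX l ⟨g, h, H⟩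
    refine ⟨iZ.inv ≫ g ≫ iX.hom, iX.inv ≫ h ≫ iY.hom⟦(1 : ℤ)⟧', ?_⟩
    refine isomorphic_distinguished _ H _ (Triangle.isoMk _ _ iY.symm iZ.symm iX.symm ?_ ?_ ?_)
    · change (iY.inv ≫ l ≫ iZ.hom) ≫ iZ.inv = iY.inv ≫ l
      simp only [Category.assoc, Iso.hom_inv_id, Category.comp_id]
    · change (iZ.inv ≫ g ≫ iX.hom) ≫ iX.inv = iZ.inv ≫ g
      simp only [Category.assoc, Iso.hom_inv_id, Category.comp_id]
    · change (iX.inv ≫ h ≫ iY.hom⟦(1 : ℤ)⟧') ≫ iY.inv⟦(1 : ℤ)⟧' = iX.inv ≫ h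
      rw [Category.assoc, Category.assoc, ← Functor.map_comp, Iso.hom_inv_id,
        CategoryTheory.Functor.map_id, Category.comp_id]
  refine Nat.card_congr (Equiv.subtypeEquiv (iY.homCongr iZ) fun l => ⟨key iY iZ iX l, fun h => ?_⟩)
  have := key iY.symm iZ.symm iX.symm _ h
  simpa using this

lemma Fodd_iso (t : ℕ) {Y Y' Z Z' X X' : E} (iX : X ≅ X') (iY : Y ≅ Y') (iZ : Z ≅ Z') :
    Fodd t X Y Z = Fodd t X' Y' Z' := by
  have h1 : ∀ i : ℕ, Nat.card (Y⟦(i:ℤ)⟧ ⟶ Z) = Nat.card (Y'⟦(i:ℤ)⟧ ⟶ Z') := fun i =>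
    homCard_iso' ((shiftFunctor E (i:ℤ)).mapIso iY) iZ
  have h2 : ∀ i : ℕ, Nat.card (Y⟦(i:ℤ)⟧ ⟶ Y) = Nat.card (Y'⟦(i:ℤ)⟧ ⟶ Y') := fun i =>
    homCard_iso' ((shiftFunctor E (i:ℤ)).mapIso iY) iY
  rw [Fodd, Fodd, coneHomCard_iso iY iZ iX, autCard_iso iY]
  simp_rw [h1, h2]

lemma dhMul_delta (t : ℕ) (X Y : E) (Lc : IsoCl E) :
    dhMulOdd t (delta (cl X)) (delta (cl Y)) Lc = Fodd t X Y Lc.out := by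
  rw [dhMulOdd, finsum_eq_single _ (cl X), finsum_eq_single _ (cl Y)]
  · obtain ⟨i⟩ := (cl_eq X _).1 rfl
    obtain ⟨j⟩ := (cl_eq Y _).1 rfl
    simp only [delta, if_true, one_mul]
    exact (Fodd_iso t i j (Iso.refl _)).symm
  · intro y hy
    simp [delta, hy]
  · intro y hy
    simp [delta, hy]
end FIso

section Term
lemma alg_id {b1 b2 b3 b4 b5 b6 c1 c2 c3 u1 u2 u3 u4 u5 u6 u7 u8 u9 : ℝ} (h3 : b3 ≠ 0)
    (hexp : u1 * u2 * u3 = u4⁻¹ * u5⁻¹ * u9 * (u8 * (u6⁻¹ * u7⁻¹))) :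
    c1 * c2 * b6 * (c3 * (b4 * b5) * u1 * u2 / b1) * (b2⁻¹ * u3) =
    c3 * c2 * c1 * (b5 * b6 * b4) / (b3 * u4 * u5) * u9 *
      (b3 * u8 / (b1 * u6 * (b2 * u7))) := by
  have hb : b3 * b3⁻¹ = 1 := mul_inv_cancel₀ h3
  simp only [div_eq_mul_inv, mul_inv]
  linear_combination (c1 * c2 * c3 * b4 * b5 * b6 * b1⁻¹ * b2⁻¹) * hexp -
    (c1 * c2 * c3 * b4 * b5 * b6 * b1⁻¹ * b2⁻¹) *
      (u4⁻¹ * u5⁻¹ * u9 * (u8 * (u6⁻¹ * u7⁻¹))) * hb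

variable [HasExt.{0} A] {t : ℕ} [NeZero t]
variable [∀ X Y : A, Finite (X ⟶ Y)] [∀ X Y : A, Finite (Abelian.Ext X Y 1)]
variable {E : Type*} [Category E] [Preadditive E] [HasZeroObject E] [HasShift E ℤ]
  [∀ n : ℤ, (shiftFunctor E n).Additive] [Pretriangulated E] (L : Ct A t ⥤ E)
  [L.IsLocalization (HomologicalComplex.quasiIso A (pShape t))]
  (hered : ∀ X Y : A, Subsingleton (Abelian.Ext X Y 2))
  (hshift : ∀ (f : ZMod t → A) (n : ℤ),
      Nonempty ((L.obj (mkZero f))⟦n⟧ ≅ L.obj (mkZero (fun j => f (j + n)))))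
include hered hshift

lemma term_eq (ht : Odd t) (f g x M N S : ZMod t → A) :
    (∏ m, ((hall (N m) (S m) (g m) : ℝ) * hall (M m) (N m) (x m) * autCard (N m))) *
      (∏ m, gd (S (m+1)) (M m) (f m) (g (m+1)) (x m)) *
      ((∏ m, (autCard (g m) : ℝ))⁻¹ * Real.exp (ee g x / 2 - ee g g / 2 - nn g x)) =
    (∏ i : ZMod t,
              (hall (S (i + 1)) (M i) (f i) : ℝ) *
                (hall (M i) (N i) (x i) : ℝ) *
                (hall (N i) (S i) (g i) : ℝ) *
                ((autCard (M i) : ℝ) * (autCard (N i) : ℝ) *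
                  (autCard (S i) : ℝ)) /
                ((autCard (x i) : ℝ) * eulerR (f i) (S i) *
                  eulerR (S (i + 1)) (N i)) *
                Real.sqrt (eulerR (f i) (g i) *
                  ∏ j ∈ Finset.Icc 1 (t - 1),
                    (eulerR (f (i + (j : ZMod t))) (g i)) ^ ((-1 : ℤ) ^ (j + 1)))) *
          (aprime L x / (aprime L f * aprime L g)) := by
  by_cases hz : ∀ m, hall (S (m + 1)) (M m) (f m) ≠ 0 ∧ hall (M m) (N m) (x m) ≠ 0 ∧
    hall (N m) (S m) (g m) ≠ 0
  · have hid := ee_identity (f := f) (g := g) (x := x) (M := M) (N := N) (S := S) ht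
      (fun j => (hall_ep hered (hz j).2.2).1) (fun j => (hall_ep hered (hz j).2.2).2)
      (fun j => (hall_ep hered (hz j).2.1).1) (fun j => (hall_ep hered (hz j).2.1).2)
      (fun j => (hall_ep hered (hz j).1).1) (fun j => (hall_ep hered (hz j).1).2)
    simp only [gd]
    simp only [Finset.prod_mul_distrib, Finset.prod_div_distrib]
    rw [sqrt_prod ht, aprime_eq L hered hshift ht, aprime_eq L hered hshift ht,
      aprime_eq L hered hshift ht]
    have r1 : ∏ m, (autCard (S (m+1)) : ℝ) = ∏ m, (autCard (S m) : ℝ) :=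
      Fintype.prod_equiv (Equiv.addRight 1) _ _ fun _ => rfl
    have q1 : ∏ m, eulerR (S (m+1)) (M m) = Real.exp (cc S M 1) := by
      rw [cc, Real.exp_sum]; simp_rw [exp_ep]; simp
    have q2 : ∏ m, eulerR (S (m+1)) (N m) = Real.exp (cc S N 1) := by
      rw [cc, Real.exp_sum]; simp_rw [exp_ep]; simp
    have q3 : ∏ m, eulerR (f m) (S m) = Real.exp (cc f S 0) := by
      rw [cc, Real.exp_sum]; simp_rw [exp_ep]; simp
    have q4 : ∏ m, (ext1Card (g (m+1)) (x m) : ℝ) = Real.exp (nn g x) := by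
      rw [nn, Real.exp_sum]; simp_rw [exp_et]
    rw [r1, q1, q2, q3, q4]
    have a1 : ∏ m, (autCard (f m) : ℝ) ≠ 0 :=
      Finset.prod_ne_zero_iff.2 fun m _ => Nat.cast_ne_zero.2 (autCard_pos _).ne'
    have a2 : ∏ m, (autCard (g m) : ℝ) ≠ 0 :=
      Finset.prod_ne_zero_iff.2 fun m _ => Nat.cast_ne_zero.2 (autCard_pos _).ne'
    have a3 : ∏ m, (autCard (x m) : ℝ) ≠ 0 :=
      Finset.prod_ne_zero_iff.2 fun m _ => Nat.cast_ne_zero.2 (autCard_pos _).ne'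
    have hexp : Real.exp (cc S M 1) * Real.exp (nn g x) *
        Real.exp (ee g x / 2 - ee g g / 2 - nn g x) =
        (Real.exp (cc f S 0))⁻¹ * (Real.exp (cc S N 1))⁻¹ * Real.exp (- ee f g / 2) *
        (Real.exp (ee x x / 2) * ((Real.exp (ee f f / 2))⁻¹ * (Real.exp (ee g g / 2))⁻¹)) := by
      simp only [← Real.exp_neg, ← Real.exp_add]
      congr 1
      linarith
    exact alg_id a3 hexp
  · push Not at hz
    obtain ⟨m, hm⟩ := hz
    have hl : ((hall (N m) (S m) (g m) : ℝ) * hall (M m) (N m) (x m) * autCard (N m)) *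
      gd (S (m+1)) (M m) (f m) (g (m+1)) (x m) = 0 := by
      by_cases h1 : hall (S (m + 1)) (M m) (f m) = 0
      · simp [gd, h1]
      by_cases h2 : hall (M m) (N m) (x m) = 0
      · simp [h2]
      · simp [hm h1 h2]
    rw [← Finset.prod_mul_distrib, Finset.prod_eq_zero (Finset.mem_univ m) hl, zero_mul,
      Finset.prod_eq_zero (Finset.mem_univ m), zero_mul]
    by_cases h1 : hall (S (m + 1)) (M m) (f m) = 0
    · simp [h1]
    by_cases h2 : hall (M m) (N m) (x m) = 0
    · simp [h2]
    · simp [hm h1 h2]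

lemma Fodd_sum (ht : Odd t) (f g x : ZMod t → A) :
    Fodd t (L.obj (mkZero f)) (L.obj (mkZero g)) (L.obj (mkZero x)) =
    (∑ᶠ M : ZMod t → IsoCl A, ∑ᶠ N : ZMod t → IsoCl A, ∑ᶠ S : ZMod t → IsoCl A,
            ∏ i : ZMod t,
              (hall ((S (i + 1)).out) ((M i).out) (f i) : ℝ) *
                (hall ((M i).out) ((N i).out) (x i) : ℝ) *
                (hall ((N i).out) ((S i).out) (g i) : ℝ) *
                ((autCard ((M i).out) : ℝ) * (autCard ((N i).out) : ℝ) *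
                  (autCard ((S i).out) : ℝ)) /
                ((autCard (x i) : ℝ) * eulerR (f i) ((S i).out) *
                  eulerR ((S (i + 1)).out) ((N i).out)) *
                Real.sqrt (eulerR (f i) (g i) *
                  ∏ j ∈ Finset.Icc 1 (t - 1),
                    (eulerR (f (i + (j : ZMod t))) (g i)) ^ ((-1 : ℤ) ^ (j + 1)))) *
          (aprime L x / (aprime L f * aprime L g)) := by
  have fm : ∀ {ι : Type} (F : ι → ℝ) (c : ℝ), (∑ᶠ i, F i) * c = ∑ᶠ i, F i * c := by
    intro ι F c
    rw [mul_comm, ← smul_eq_mul, smul_finsum]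
    exact finsum_congr fun i => by rw [smul_eq_mul, mul_comm]
  rw [Fodd_eq L hered hshift ht, cone_count L hered hshift ht, fm, fm]
  refine finsum_congr fun M => ?_
  rw [fm, fm]
  refine finsum_congr fun N => ?_
  rw [fm, fm]
  refine finsum_congr fun S => ?_
  exact term_eq L hered hshift ht f g x (fun m => (M m).out) (fun m => (N m).out)
    (fun m => (S m).out)

end Term

open scoped Classical in
theorem odd_periodic_derived_hall_product_of_zero_differential_complexes
    (k : Type) [Field k] [Fintype k]
    (A : Type) [SmallCategory A] [Abelian A] [CategoryTheory.Linear k A]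
    [HasExt.{0} A]
    (hfinHom : ∀ X Y : A, Finite (X ⟶ Y))
    (hfinExt : ∀ X Y : A, Finite (Abelian.Ext X Y 1))
    (hered : ∀ X Y : A, Subsingleton (Abelian.Ext X Y 2))
    (t : ℕ) [NeZero t] (ht : Odd t)
    (E : Type*) [Category E] [Preadditive E] [HasZeroObject E] [HasShift E ℤ]
    [∀ n : ℤ, (shiftFunctor E n).Additive] [Pretriangulated E]
    (L : Ct A t ⥤ E)
    [L.IsLocalization (HomologicalComplex.quasiIso A (pShape t))]
    (hshift : ∀ (f : ZMod t → A) (n : ℤ),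
      Nonempty ((L.obj (mkZero f))⟦n⟧ ≅ L.obj (mkZero (fun j => f (j + n)))))
    (f g : ZMod t → A) :
    dhMulOdd t (delta (cl (L.obj (mkZero f)))) (delta (cl (L.obj (mkZero g))))
      = fun Lc => ∑ᶠ X : ZMod t → IsoCl A,
          (∑ᶠ M : ZMod t → IsoCl A, ∑ᶠ N : ZMod t → IsoCl A, ∑ᶠ S : ZMod t → IsoCl A,
            ∏ i : ZMod t,
              (hall ((S (i + 1)).out) ((M i).out) (f i) : ℝ) *
                (hall ((M i).out) ((N i).out) ((X i).out) : ℝ) *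
                (hall ((N i).out) ((S i).out) (g i) : ℝ) *
                ((autCard ((M i).out) : ℝ) * (autCard ((N i).out) : ℝ) *
                  (autCard ((S i).out) : ℝ)) /
                ((autCard ((X i).out) : ℝ) * eulerR (f i) ((S i).out) *
                  eulerR ((S (i + 1)).out) ((N i).out)) *
                Real.sqrt (eulerR (f i) (g i) *
                  ∏ j ∈ Finset.Icc 1 (t - 1),
                    (eulerR (f (i + (j : ZMod t))) (g i)) ^ ((-1 : ℤ) ^ (j + 1)))) *
          (aprime L (fun i => (X i).out) / (aprime L f * aprime L g)) *
          (if Lc = cl (L.obj (mkZero (fun i => (X i).out))) then 1 else 0) := by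
  funext Lc
  rw [dhMul_delta]
  obtain ⟨z, ⟨iz⟩⟩ := ess L hered Lc.out
  have hz : ∀ m, z m ≅ (cl (z m)).out := fun m => ((cl_eq _ _).1 rfl).some
  obtain ⟨iz'⟩ := (iso_iff (L := L) hered z (fun m => (cl (z m)).out)).2 fun m => ⟨hz m⟩
  rw [finsum_eq_single _ (fun m => cl (z m))]
  · have hL : Lc = cl (L.obj (mkZero (fun i => (cl (z i)).out))) :=
      ((cl_eq _ _).2 ⟨(iz ≪≫ iz').symm⟩).symm
    rw [if_pos hL, mul_one, Fodd_iso t (Iso.refl _) (Iso.refl _) (iz ≪≫ iz'),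
      Fodd_sum L hered hshift ht]
  · intro X hX
    rw [if_neg, mul_zero]
    intro h
    apply hX
    obtain ⟨i⟩ := (cl_eq _ _).1 h.symm
    have h2 := (iso_iff (L := L) hered _ _).1 ⟨i ≪≫ iz⟩
    funext m
    exact ((cl_eq _ _).2 ⟨(h2 m).some.symm⟩).symm

end GreenDH
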